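/- arXiv:1505.04652 — 3 statements merged into one kernel-verified Lean document; each statement's English description precedes it below -/
import Mathlib

section
/- Let k be an imaginary quadratic field of discriminant Δ_k and let ε > 0. There is a constant c > 0 (depending on k and ε) such that the following holds for every positive integer n. Let p₁ < p₂ < … < pₙ be the first n odd rational primes that split in k. Then for each i = 1, …, n there exists a nonnegative integer x_i with x_i ≤ c·pₙ^{4+ε} such that x_i² ≡ Δ_k + p_i (mod p_i²) and, for every j ≠ i with 1 ≤ j ≤ n, x_i² ≢ Δ_k (mod p_j). -/
open NumberField

/-- A rational prime `p` *splits* in the number field `k` if `p O_k` is a product of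
two distinct prime ideals of `O_k`. -/
def RatPrimeSplitsIn (k : IntermediateField ℚ ℂ) (p : ℕ) : Prop :=
  ∃ P Q : Ideal (𝓞 ↥k), P ≠ Q ∧ P.IsPrime ∧ Q.IsPrime ∧
    Ideal.span {(p : 𝓞 ↥k)} = P * Q

open Finset in
/-- Partial summation: if the partial sums of nonnegative weights `a` sitting at points `t` grow
at most like `η + c (t - s)`, then a nonnegative antitone function is integrated against them
at most like against `η δ_s + c dt`. -/
theorem sum_mul_le_of_partialSum_le {ι : Type*} (S : Finset ι) (t a : ι → ℝ) {s η c : ℝ}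
    (ha : ∀ i ∈ S, 0 ≤ a i) (hη : 0 ≤ η) (hc : 0 ≤ c) {h : ℝ → ℝ} (hanti : AntitoneOn h (Set.Ici s))
    (hnn : ∀ u, s ≤ u → 0 ≤ h u)
    (hB : ∀ i ∈ S, ∑ j ∈ S with t j ≤ t i, a j ≤ η + c * (t i - s))
    (ht : ∀ i ∈ S, s ≤ t i) {M : ℝ} (hsM : s ≤ M) (hM : ∀ i ∈ S, t i ≤ M) :
    ∑ i ∈ S, a i * h (t i) ≤ η * h s + c * ∫ u in s..M, h u := by
  classical
  have hii : ∀ x y, s ≤ x → s ≤ y → IntervalIntegrable h MeasureTheory.volume x y :=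
    fun x y hx hy => (hanti.mono fun u hu => (le_min hx hy).trans hu.1).intervalIntegrable
  have hstep : ∀ x y, s ≤ x → x ≤ y → (y - x) * h y ≤ ∫ u in x..y, h u := by
    intro x y hx hxy
    have := intervalIntegral.integral_mono_on (f := fun _ => h y) (g := h) hxy (by simp)
      (hii x y hx (hx.trans hxy)) (fun u hu => hanti (hx.trans hu.1) (hx.trans hxy) hu.2)
    simpa using this
  suffices H : ∀ M, s ≤ M → (∀ i ∈ S, t i ≤ M) →
      ∑ i ∈ S, a i * h (t i) + (η + c * (M - s) - ∑ i ∈ S, a i) * h M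
        ≤ η * h s + c * (∫ u in s..M, h u) ∧ ∑ i ∈ S, a i ≤ η + c * (M - s) by
    obtain ⟨h1, h2⟩ := H M hsM hM
    nlinarith [hnn M hsM, mul_nonneg (sub_nonneg.2 h2) (hnn M hsM)]
  clear hM hsM M
  induction S using Finset.induction_on_max_value t with
  | empty =>
    intro M hM _
    have h1 := hstep s M le_rfl hM
    have h2 := hanti Set.self_mem_Ici hM hM
    simp only [sum_empty, zero_add, sub_zero]
    constructor
    · nlinarith [mul_le_mul_of_nonneg_left h1 hc, mul_le_mul_of_nonneg_left h2 hη]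
    · nlinarith [mul_nonneg hc (sub_nonneg.2 hM)]
  | insert i S hi hmax ih =>
    intro M hM hMS
    have hti : s ≤ t i := ht i (mem_insert_self _ _)
    have htM : t i ≤ M := hMS i (mem_insert_self _ _)
    have hBi := hB i (mem_insert_self _ _)
    rw [filter_true_of_mem (by
      intro j hj
      rcases mem_insert.1 hj with rfl | hj
      · exact le_rfl
      · exact hmax j hj), sum_insert hi] at hBi
    have key : ∀ j ∈ S, ∑ k ∈ S with t k ≤ t j, a k ≤ η + c * (t j - s) := by
      intro j hj
      rcases (hmax j hj).lt_or_eq with hlt | heq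
      · have := hB j (mem_insert_of_mem hj)
        rwa [filter_insert, if_neg (not_le.2 hlt)] at this
      · rw [heq, filter_true_of_mem hmax]
        linarith [ha i (mem_insert_self _ _)]
    obtain ⟨h1, h2⟩ := ih (fun j hj => ha j (mem_insert_of_mem hj)) key (fun j hj => ht j (mem_insert_of_mem hj)) (t i) hti hmax
    rw [sum_insert hi, sum_insert hi]
    have h3 := hstep (t i) M hti htM
    have h4 := hanti hti hM htM
    have h5 := intervalIntegral.integral_add_adjacent_intervals (hii s (t i) le_rfl hti)
      (hii (t i) M hti hM)
    constructor
    · rw [← h5]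
      nlinarith [mul_le_mul_of_nonneg_left h3 hc,
        mul_nonneg (sub_nonneg.2 hBi) (sub_nonneg.2 h4)]
    · nlinarith [mul_nonneg hc (sub_nonneg.2 htM)]

/-- The product `∏ (1 - 2 / p)` over the members of `P` below `z`. -/
noncomputable def sieveDensity (P : Finset ℕ) (z : ℝ) : ℝ :=
  ∏ p ∈ P.filter (fun p : ℕ => (p : ℝ) < z), (1 - 2 / (p : ℝ))

/-- The product `∏ (1 + 2 / p)` over the members of `P` below `z`. -/
noncomputable def sieveWeight (P : Finset ℕ) (z : ℝ) : ℝ :=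
  ∏ p ∈ P.filter (fun p : ℕ => (p : ℝ) < z), (1 + 2 / (p : ℝ))

open Classical in
/-- The `t < N` that are bad at every member of `B` and at no member of `P` below `z`. -/
noncomputable def siftedSet (N : ℕ) (bad : ℕ → ℕ → Prop) (P B : Finset ℕ) (z : ℝ) : Finset ℕ :=
  {t ∈ Finset.range N | (∀ q ∈ B, bad q t) ∧ ∀ p ∈ P, (p : ℝ) < z → ¬ bad p t}

open Classical in
theorem siftedSet_buchstab (N : ℕ) (bad : ℕ → ℕ → Prop) (P B : Finset ℕ) (z : ℝ) :
    (siftedSet N bad P B z).card + ∑ p ∈ P.filter (fun p : ℕ => (p : ℝ) < z), (siftedSet N bad P (insert p B) p).card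
      = ((Finset.range N).filter fun t => ∀ q ∈ B, bad q t).card := by
  rw [← Finset.card_biUnion, ← Finset.card_union_of_disjoint]
  · congr 1
    ext t
    simp only [siftedSet, Finset.mem_union, Finset.mem_biUnion, Finset.mem_filter,
      Finset.mem_range, Finset.mem_insert, forall_eq_or_imp]
    constructor
    · rintro (h | ⟨p, hp, h⟩)
      · exact ⟨h.1, h.2.1⟩
      · exact ⟨h.1, h.2.1.2⟩
    · rintro ⟨htN, htB⟩
      by_cases hg : ∀ p ∈ P, (p : ℝ) < z → ¬ bad p t
      · exact Or.inl ⟨htN, htB, hg⟩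
      · right
        have hne : (P.filter fun p : ℕ => (p : ℝ) < z ∧ bad p t).Nonempty := by
          push Not at hg
          obtain ⟨p, h1, h2, h3⟩ := hg
          exact ⟨p, by simp [h1, h2, h3]⟩
        obtain ⟨h1, h2, h3⟩ := Finset.mem_filter.1 (Finset.min'_mem _ hne)
        refine ⟨_, ⟨h1, h2⟩, htN, ⟨h3, htB⟩, fun p hp hlt hbad => ?_⟩
        have hmem : p ∈ P.filter fun p : ℕ => (p : ℝ) < z ∧ bad p t :=
          Finset.mem_filter.2 ⟨hp, hlt.trans h2, hbad⟩
        have := Finset.min'_le _ p hmem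
        exact absurd (Nat.cast_lt.1 hlt) (not_lt.2 this)
  · rw [Finset.disjoint_biUnion_right]
    intro p hp
    rw [Finset.mem_filter] at hp
    rw [Finset.disjoint_left]
    intro t h1 h2
    simp only [siftedSet, Finset.mem_filter, Finset.mem_insert, forall_eq_or_imp] at h1 h2
    exact h1.2.2 p hp.1 hp.2 h2.2.1.1
  · intro p hp q hq hpq
    rw [Function.onFun, Finset.disjoint_left]
    intro t h1 h2
    simp only [siftedSet, Finset.mem_filter, Finset.mem_insert, forall_eq_or_imp] at h1 h2
    simp only [Finset.coe_filter, Set.mem_ofPred_eq] at hp hq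
    rcases lt_or_gt_of_ne hpq with h | h
    · exact h2.2.2 p hp.1 (by exact_mod_cast h) h1.2.1.1
    · exact h1.2.2 q hq.1 (by exact_mod_cast h) h2.2.1.1

theorem sum_mul_sieveDensity (P : Finset ℕ) {u z : ℝ} (huz : u ≤ z) :
    ∑ p ∈ P.filter (fun p : ℕ => (p : ℝ) < z ∧ u ≤ p), 2 / (p : ℝ) * sieveDensity P p
      = sieveDensity P u - sieveDensity P z := by
  have h := Finset.prod_one_sub_ordered (P.filter fun p : ℕ => (p : ℝ) < z ∧ u ≤ p)
    (fun p => 2 / (p : ℝ))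
  have hmul : ∀ v : ℝ, u ≤ v → v ≤ z → sieveDensity P v = sieveDensity P u *
      ∏ p ∈ P.filter (fun p : ℕ => (p : ℝ) < v ∧ u ≤ p), (1 - 2 / (p : ℝ)) := by
    intro v huv _
    rw [sieveDensity, sieveDensity, ← Finset.prod_filter_mul_prod_filter_not _ (fun p : ℕ => (p : ℝ) < u),
      Finset.filter_filter, Finset.filter_filter]
    congr 1
    · refine Finset.prod_congr (Finset.filter_congr fun p _ => ?_) fun _ _ => rfl
      exact ⟨fun h => h.2, fun h => ⟨h.trans_le huv, h⟩⟩
    · refine Finset.prod_congr (Finset.filter_congr fun p _ => ?_) fun _ _ => rfl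
      rw [not_lt]
  rw [hmul z huz le_rfl, h, mul_sub, mul_one, sub_sub_cancel, Finset.mul_sum]
  refine Finset.sum_congr rfl fun p hp => ?_
  rw [Finset.mem_filter] at hp
  rw [hmul p hp.2.2 hp.2.1.le, Finset.filter_filter]
  have : ∀ x y w : ℝ, x * (y * w) = y * (x * w) := fun x y w => by ring
  rw [this]
  congr 2
  refine Finset.prod_congr (Finset.filter_congr fun q _ => ?_) fun _ _ => rfl
  constructor
  · rintro ⟨h1, h2⟩
    exact ⟨⟨h1.trans hp.2.1, h2⟩, by exact_mod_cast h1⟩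
  · rintro ⟨⟨h1, h2⟩, h3⟩
    exact ⟨by exact_mod_cast h3, h2⟩

theorem sum_mul_sieveWeight (P : Finset ℕ) (z : ℝ) :
    1 + ∑ p ∈ P.filter (fun p : ℕ => (p : ℝ) < z), 2 / (p : ℝ) * sieveWeight P p = sieveWeight P z := by
  rw [sieveWeight, Finset.prod_one_add_ordered]
  congr 1
  refine Finset.sum_congr rfl fun p hp => ?_
  rw [Finset.mem_filter] at hp
  rw [sieveWeight, Finset.filter_filter]
  congr 1
  refine Finset.prod_congr (Finset.filter_congr fun q _ => ?_) fun _ _ => rfl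
  constructor
  · intro h1
    exact ⟨h1.trans hp.2, by exact_mod_cast h1⟩
  · rintro ⟨_, h3⟩
    exact_mod_cast h3

/-- Functions `1 + U₁` and `1 - U₀` of `s = log D / log z` that bound the upper and the lower linear
sieve when the sifting density is known up to a factor `1 + η`. -/
structure IsLinearSieveMajorant (η : ℝ) (U₁ U₀ : ℝ → ℝ) : Prop where
  eta_nonneg : 0 ≤ η
  upper_antitone : AntitoneOn U₁ (Set.Ici 1)
  lower_antitone : AntitoneOn U₀ (Set.Ici 2)
  upper_nonneg : ∀ s, 1 ≤ s → 0 ≤ U₁ s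
  lower_nonneg : ∀ s, 2 ≤ s → 0 ≤ U₀ s
  lower_ge : ∀ s, 2 ≤ s → ∀ M, s - 1 ≤ M →
    η * U₁ (s - 1) + (1 + η) / s * ∫ u in (s - 1)..M, U₁ u ≤ U₀ s
  upper_ge : ∀ s, 3 ≤ s → ∀ M, s - 1 ≤ M →
    η * U₀ (s - 1) + (1 + η) / s * ∫ u in (s - 1)..M, U₀ u ≤ U₁ s
  upper_ge_of_le_three : ∀ s, 1 ≤ s → s ≤ 3 → ∀ M, 2 ≤ M →
    (1 + η) * (3 / s) * (1 + (η * U₀ 2 + (1 + η) / 3 * ∫ u in (2 : ℝ)..M, U₀ u)) ≤ 1 + U₁ s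

/-- The density of the sieve is that of a linear sieve up to a factor `1 + η`. -/
def HasLinearDensity (η : ℝ) (P : Finset ℕ) : Prop :=
  ∀ u v : ℝ, 1 < u → u ≤ v →
    sieveDensity P u ≤ (1 + η) * (Real.log v / Real.log u) * sieveDensity P v

theorem sieveDensity_pos {P : Finset ℕ} (hP : ∀ p ∈ P, 3 ≤ p) (z : ℝ) : 0 < sieveDensity P z := by
  refine Finset.prod_pos fun p hp => ?_
  have : (3 : ℝ) ≤ p := by exact_mod_cast hP p (Finset.mem_filter.1 hp).1
  rw [sub_pos, div_lt_one (by linarith)]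
  linarith

theorem sieveWeight_pos (P : Finset ℕ) (z : ℝ) : 0 < sieveWeight P z :=
  Finset.prod_pos fun p _ => by positivity

theorem sum_sieveDensity_mul_le {P : Finset ℕ} (hP : ∀ p ∈ P, 3 ≤ p) {η : ℝ} (hη : 0 ≤ η)
    (hV : HasLinearDensity η P) {z D s : ℝ} (hz : 1 < z) (hs : s = Real.log D / Real.log z)
    (hs0 : 0 < s) {h : ℝ → ℝ} (hanti : AntitoneOn h (Set.Ici (s - 1)))
    (hnn : ∀ u, s - 1 ≤ u → 0 ≤ h u) :
    ∃ M, s - 1 ≤ M ∧ ∑ p ∈ P.filter (fun p : ℕ => (p : ℝ) < z),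
      2 / (p : ℝ) * sieveDensity P p * h (Real.log (D / p) / Real.log p)
        ≤ sieveDensity P z * (η * h (s - 1) + (1 + η) / s * ∫ u in (s - 1)..M, h u) := by
  set S := P.filter (fun p : ℕ => (p : ℝ) < z) with hS
  have hlz : 0 < Real.log z := Real.log_pos hz
  have hD : Real.log D = s * Real.log z := by rw [hs]; field_simp
  have hDpos : 0 < Real.log D := by rw [hD]; positivity
  have hVz := sieveDensity_pos hP z
  have hp3 : ∀ p ∈ S, (3 : ℝ) ≤ p := fun p hp => by
    exact_mod_cast hP p (Finset.mem_filter.1 hp).1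
  have hpz : ∀ p ∈ S, (p : ℝ) < z := fun p hp => (Finset.mem_filter.1 hp).2
  have hlp : ∀ p ∈ S, 0 < Real.log p := fun p hp => Real.log_pos (by linarith [hp3 p hp])
  set t : ℕ → ℝ := fun p => Real.log D / Real.log p - 1 with ht
  obtain ⟨M₀, hM₀⟩ := (S.image t).bddAbove
  refine ⟨max (s - 1) M₀, le_max_left _ _, ?_⟩
  have key := sum_mul_le_of_partialSum_le S t
    (fun p => 2 / (p : ℝ) * sieveDensity P p / sieveDensity P z) (s := s - 1) (η := η)
    (c := (1 + η) / s) (h := h) (M := max (s - 1) M₀)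
    (fun p hp => by
      have := sieveDensity_pos hP (p : ℝ)
      positivity) hη (by positivity) hanti hnn ?_ ?_ (le_max_left _ _)
    (fun p hp => le_max_of_le_right (hM₀ (by
      simpa using Finset.mem_image_of_mem t hp)))
  · have heq : ∑ p ∈ S, 2 / (p : ℝ) * sieveDensity P p * h (Real.log (D / p) / Real.log p)
        = sieveDensity P z *
          ∑ p ∈ S, 2 / (p : ℝ) * sieveDensity P p / sieveDensity P z * h (t p) := by
      rw [Finset.mul_sum]
      refine Finset.sum_congr rfl fun p hp => ?_
      have h1 : Real.log (D / p) / Real.log p = t p := by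
        have := hlp p hp
        rw [ht, Real.log_div (by rintro rfl; simp at hDpos) (by linarith [hp3 p hp])]
        field_simp
      rw [h1]
      field_simp
    rw [heq]
    exact mul_le_mul_of_nonneg_left key hVz.le
  · intro q hq
    have hlq := hlp q hq
    have hfil : S.filter (fun j => t j ≤ t q)
        = P.filter (fun p : ℕ => (p : ℝ) < z ∧ (q : ℝ) ≤ p) := by
      rw [hS, Finset.filter_filter]
      refine Finset.filter_congr fun p hp => and_congr_right fun hpz' => ?_
      have hlp' := hlp p (Finset.mem_filter.2 ⟨hp, hpz'⟩)
      have h3 := hp3 p (Finset.mem_filter.2 ⟨hp, hpz'⟩)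
      rw [ht, sub_le_sub_iff_right, div_le_div_iff_of_pos_left hDpos hlp' hlq,
        Real.log_le_log_iff (by linarith [hp3 q hq]) (by linarith)]
    rw [hfil, ← Finset.sum_div, sum_mul_sieveDensity P (hpz q hq).le, div_le_iff₀ hVz]
    have h1 := hV q z (by linarith [hp3 q hq]) (hpz q hq).le
    have h2 : η + (1 + η) / s * (t q - (s - 1)) = (1 + η) * (Real.log z / Real.log q) - 1 := by
      rw [ht, hD]
      field_simp
      ring
    rw [h2]
    linarith
  · intro p hp
    rw [ht, sub_le_sub_iff_right, le_div_iff₀ (hlp p hp), hD]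
    exact mul_le_mul_of_nonneg_left
      (Real.log_le_log (by linarith [hp3 p hp]) (hpz p hp).le) hs0.le

section LinearSieve

variable {P : Finset ℕ} {η : ℝ} {U₁ U₀ : ℝ → ℝ} {N : ℕ} {bad : ℕ → ℕ → Prop}

open Classical in
/-- The fundamental recursion of the linear sieve, in both directions at once. -/
theorem siftedSet_card_bounds (hP : ∀ p ∈ P, 3 ≤ p) (hU : IsLinearSieveMajorant η U₁ U₀)
    (hV : HasLinearDensity η P)
    (hcount : ∀ B ⊆ P, |(((Finset.range N).filter fun t => ∀ q ∈ B, bad q t).card : ℝ)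
      - N * ∏ q ∈ B, 2 / (q : ℝ)| ≤ 2 ^ B.card) (n : ℕ) :
    ∀ z : ℝ, 1 < z → z ≤ n → ∀ B ⊆ P, (∀ q ∈ B, z ≤ q) →
      (∀ D : ℝ, z ^ 2 ≤ D →
        N * (∏ q ∈ B, 2 / (q : ℝ)) * (sieveDensity P z * (1 - U₀ (Real.log D / Real.log z)))
          - 2 ^ B.card * (D * sieveWeight P z) ≤ (siftedSet N bad P B z).card) ∧
      (∀ D : ℝ, z ≤ D → ((siftedSet N bad P B z).card : ℝ) ≤
        N * (∏ q ∈ B, 2 / (q : ℝ)) * (sieveDensity P z * (1 + U₁ (Real.log D / Real.log z)))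
          + 2 ^ B.card * (D * sieveWeight P z)) := by
  induction n with
  | zero =>
    intro z hz hz0
    norm_num at hz0
    linarith
  | succ n ih =>
    have hη := hU.eta_nonneg
    have hlogdiv : ∀ z D : ℝ, 1 < z → ∀ k : ℕ, z ^ k ≤ D → (k : ℝ) ≤ Real.log D / Real.log z := by
      intro z D hz k hk
      rw [le_div_iff₀ (Real.log_pos hz), ← Real.log_pow]
      exact Real.log_le_log (by positivity) hk
    have hg : ∀ B : Finset ℕ, 0 ≤ (N : ℝ) * ∏ q ∈ B, 2 / (q : ℝ) := fun B =>
      mul_nonneg (Nat.cast_nonneg _) (Finset.prod_nonneg fun q _ => by positivity)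
    -- the inductive hypothesis at a smaller prime
    have hprev : ∀ z : ℝ, z ≤ (n + 1 : ℕ) → ∀ B ⊆ P, (∀ q ∈ B, z ≤ q) →
        ∀ p ∈ P.filter (fun p : ℕ => (p : ℝ) < z), (3 : ℝ) ≤ p ∧ (p : ℝ) ≤ n ∧ insert p B ⊆ P ∧
          (∀ q ∈ insert p B, (p : ℝ) ≤ q) ∧
          (∏ q ∈ insert p B, 2 / (q : ℝ)) = 2 / (p : ℝ) * ∏ q ∈ B, 2 / (q : ℝ) ∧
          (insert p B).card = B.card + 1 := by
      intro z hzn B hBP hB p hp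
      obtain ⟨hpP, hpz⟩ := Finset.mem_filter.1 hp
      have hpB : p ∉ B := fun h => absurd (hB p h) (not_le.2 hpz)
      refine ⟨by exact_mod_cast hP p hpP, ?_, Finset.insert_subset hpP hBP, ?_,
        Finset.prod_insert hpB, Finset.card_insert_of_notMem hpB⟩
      · have : (p : ℝ) < (n + 1 : ℕ) := hpz.trans_le hzn
        exact_mod_cast Nat.lt_succ_iff.1 (by exact_mod_cast this)
      · intro q hq
        rcases Finset.mem_insert.1 hq with rfl | hq
        · exact le_rfl
        · exact hpz.le.trans (hB q hq)
    have hsum0 : ∀ z : ℝ, 1 < z →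
        ∑ p ∈ P.filter (fun p : ℕ => (p : ℝ) < z), 2 / (p : ℝ) * sieveDensity P p
          = 1 - sieveDensity P z := by
      intro z hz
      have h1 := sum_mul_sieveDensity P hz.le
      have h2 : sieveDensity P 1 = 1 := by
        rw [sieveDensity, Finset.filter_false_of_mem, Finset.prod_empty]
        intro p hp
        have : (3 : ℝ) ≤ p := by exact_mod_cast hP p hp
        linarith
      rw [h2] at h1
      rw [← h1]
      refine Finset.sum_congr (Finset.filter_congr fun p hp => ?_) fun _ _ => rfl
      have : (3 : ℝ) ≤ p := by exact_mod_cast hP p hp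
      exact ⟨fun h => ⟨h, by linarith⟩, fun h => h.1⟩
    have hlower : ∀ z : ℝ, 1 < z → z ≤ (n + 1 : ℕ) → ∀ B ⊆ P, (∀ q ∈ B, z ≤ q) →
        ∀ D : ℝ, z ^ 2 ≤ D →
        N * (∏ q ∈ B, 2 / (q : ℝ)) * (sieveDensity P z * (1 - U₀ (Real.log D / Real.log z)))
          - 2 ^ B.card * (D * sieveWeight P z) ≤ (siftedSet N bad P B z).card := by
      intro z hz hzn B hBP hB D hD
      have hb := siftedSet_buchstab N bad P B z
      have hc := (abs_le.1 (hcount B hBP)).1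
      have hs : 2 ≤ Real.log D / Real.log z := by exact_mod_cast hlogdiv z D hz 2 hD
      set s := Real.log D / Real.log z with hsdef
      obtain ⟨M, hM, hsum⟩ := sum_sieveDensity_mul_le hP hη hV hz hsdef (by linarith)
        (hU.upper_antitone.mono (Set.Ici_subset_Ici.2 (by linarith)))
        (fun u hu => hU.upper_nonneg u (by linarith))
      have hmaj := hU.lower_ge s hs M hM
      have hterm : ∑ p ∈ P.filter (fun p : ℕ => (p : ℝ) < z),
          ((siftedSet N bad P (insert p B) p).card : ℝ)
          ≤ N * (∏ q ∈ B, 2 / (q : ℝ)) * (∑ p ∈ P.filter (fun p : ℕ => (p : ℝ) < z),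
              2 / (p : ℝ) * sieveDensity P p
              + ∑ p ∈ P.filter (fun p : ℕ => (p : ℝ) < z),
              2 / (p : ℝ) * sieveDensity P p * U₁ (Real.log (D / p) / Real.log p))
            + 2 ^ B.card * (D * ∑ p ∈ P.filter (fun p : ℕ => (p : ℝ) < z),
              2 / (p : ℝ) * sieveWeight P p) := by
        rw [mul_add, Finset.mul_sum, Finset.mul_sum, Finset.mul_sum, Finset.mul_sum,
          ← Finset.sum_add_distrib, ← Finset.sum_add_distrib]
        refine Finset.sum_le_sum fun p hp => ?_
        obtain ⟨h3, hpn, h4, h5, h6, h7⟩ := hprev z hzn B hBP hB p hp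
        have hpz := (Finset.mem_filter.1 hp).2
        refine ((ih p (by linarith) hpn _ h4 h5).2 (D / p) ?_).trans (le_of_eq ?_)
        · rw [le_div_iff₀ (by linarith)]
          nlinarith
        · rw [h6, h7]
          ring
      have hsw := sum_mul_sieveWeight P z
      rw [hsum0 z hz] at hterm
      have hb' : ((siftedSet N bad P B z).card : ℝ) + ∑ p ∈ P.filter (fun p : ℕ => (p : ℝ) < z),
          ((siftedSet N bad P (insert p B) p).card : ℝ)
          = ((Finset.range N).filter fun t => ∀ q ∈ B, bad q t).card := by exact_mod_cast hb
      have hD1 : 1 ≤ D := le_trans (by nlinarith) hD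
      have e1 := mul_le_mul_of_nonneg_left
        (hsum.trans (mul_le_mul_of_nonneg_left hmaj (sieveDensity_pos hP z).le)) (hg B)
      have e2 : (2 : ℝ) ^ B.card * (1 + D * (sieveWeight P z - 1))
          ≤ 2 ^ B.card * (D * sieveWeight P z) :=
        mul_le_mul_of_nonneg_left (by linarith) (by positivity)
      rw [← hsw, add_sub_cancel_left, hsw] at e2
      linarith
    have hupper3 : ∀ z : ℝ, 1 < z → z ≤ (n + 1 : ℕ) → ∀ B ⊆ P, (∀ q ∈ B, z ≤ q) →
        ∀ D : ℝ, z ^ 3 ≤ D → ∃ M, Real.log D / Real.log z - 1 ≤ M ∧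
        ((siftedSet N bad P B z).card : ℝ) ≤
        N * (∏ q ∈ B, 2 / (q : ℝ)) * (sieveDensity P z * (1 + (η * U₀ (Real.log D / Real.log z - 1)
          + (1 + η) / (Real.log D / Real.log z)
            * ∫ u in (Real.log D / Real.log z - 1)..M, U₀ u)))
          + 2 ^ B.card * (D * sieveWeight P z) := by
      intro z hz hzn B hBP hB D hD
      have hb := siftedSet_buchstab N bad P B z
      have hc := (abs_le.1 (hcount B hBP)).2
      have hs : 3 ≤ Real.log D / Real.log z := by exact_mod_cast hlogdiv z D hz 3 hD
      set s := Real.log D / Real.log z with hsdef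
      obtain ⟨M, hM, hsum⟩ := sum_sieveDensity_mul_le hP hη hV hz hsdef (by linarith)
        (hU.lower_antitone.mono (Set.Ici_subset_Ici.2 (by linarith)))
        (fun u hu => hU.lower_nonneg u (by linarith))
      refine ⟨M, hM, ?_⟩
      have hterm : N * (∏ q ∈ B, 2 / (q : ℝ)) * (∑ p ∈ P.filter (fun p : ℕ => (p : ℝ) < z),
              2 / (p : ℝ) * sieveDensity P p
              - ∑ p ∈ P.filter (fun p : ℕ => (p : ℝ) < z),
              2 / (p : ℝ) * sieveDensity P p * U₀ (Real.log (D / p) / Real.log p))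
            - 2 ^ B.card * (D * ∑ p ∈ P.filter (fun p : ℕ => (p : ℝ) < z),
              2 / (p : ℝ) * sieveWeight P p)
          ≤ ∑ p ∈ P.filter (fun p : ℕ => (p : ℝ) < z),
          ((siftedSet N bad P (insert p B) p).card : ℝ) := by
        rw [mul_sub, Finset.mul_sum, Finset.mul_sum, Finset.mul_sum, Finset.mul_sum,
          ← Finset.sum_sub_distrib, ← Finset.sum_sub_distrib]
        refine Finset.sum_le_sum fun p hp => ?_
        obtain ⟨h3, hpn, h4, h5, h6, h7⟩ := hprev z hzn B hBP hB p hp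
        have hpz := (Finset.mem_filter.1 hp).2
        refine (le_of_eq ?_).trans ((ih p (by linarith) hpn _ h4 h5).1 (D / p) ?_)
        · rw [h6, h7]
          ring
        · rw [le_div_iff₀ (by linarith)]
          calc (p : ℝ) ^ 2 * p = (p : ℝ) ^ 3 := by ring
            _ ≤ z ^ 3 := by gcongr
            _ ≤ D := hD
      have hsw := sum_mul_sieveWeight P z
      rw [hsum0 z hz] at hterm
      have hb' : ((siftedSet N bad P B z).card : ℝ) + ∑ p ∈ P.filter (fun p : ℕ => (p : ℝ) < z),
          ((siftedSet N bad P (insert p B) p).card : ℝ)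
          = ((Finset.range N).filter fun t => ∀ q ∈ B, bad q t).card := by exact_mod_cast hb
      have hD1 : 1 ≤ D := le_trans (one_le_pow₀ hz.le) hD
      have e1 := mul_le_mul_of_nonneg_left hsum (hg B)
      have e2 : (2 : ℝ) ^ B.card * (1 + D * (sieveWeight P z - 1))
          ≤ 2 ^ B.card * (D * sieveWeight P z) :=
        mul_le_mul_of_nonneg_left (by linarith) (by positivity)
      rw [← hsw, add_sub_cancel_left, hsw] at e2
      linarith
    intro z hz hzn B hBP hB
    refine ⟨hlower z hz hzn B hBP hB, fun D hD => ?_⟩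
    rcases le_or_gt (z ^ 3) D with h3 | h3
    · obtain ⟨M, hM, h⟩ := hupper3 z hz hzn B hBP hB D h3
      have hs : 3 ≤ Real.log D / Real.log z := by exact_mod_cast hlogdiv z D hz 3 h3
      refine h.trans ?_
      gcongr
      · exact (sieveDensity_pos hP z).le
      · exact hU.upper_ge _ hs M hM
    · -- sift only by the primes up to the cube root of `D`
      have hD1 : 1 < D := hz.trans_le hD
      set y := D ^ (1 / 3 : ℝ) with hy
      have hy3 : y ^ 3 = D := by
        rw [hy, ← Real.rpow_natCast, ← Real.rpow_mul (by linarith)]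
        norm_num
      have hy1 : 1 < y := Real.one_lt_rpow hD1 (by norm_num)
      have hyz : y < z := lt_of_pow_lt_pow_left₀ 3 (by linarith) (by rwa [hy3])
      have hlz := Real.log_pos hz
      have hly := Real.log_pos hy1
      have hlD : Real.log D = 3 * Real.log y := by
        rw [← hy3, Real.log_pow]; norm_num
      obtain ⟨M, hM, h⟩ := hupper3 y hy1 (hyz.le.trans hzn) B hBP
        (fun q hq => hyz.le.trans (hB q hq)) D hy3.le
      have hs3 : Real.log D / Real.log y = 3 := by rw [hlD]; field_simp
      rw [hs3] at h hM
      rw [show (3 : ℝ) - 1 = 2 by norm_num] at h hM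
      have hmono : ((siftedSet N bad P B z).card : ℝ) ≤ (siftedSet N bad P B y).card := by
        refine Nat.cast_le.2 (Finset.card_le_card fun t ht => ?_)
        simp only [siftedSet, Finset.mem_filter] at ht ⊢
        exact ⟨ht.1, ht.2.1, fun p hp hpy => ht.2.2 p hp (hpy.trans hyz)⟩
      have hW : sieveWeight P y ≤ sieveWeight P z := by
        refine Finset.prod_le_prod_of_subset_of_one_le
          (fun p hp => ?_) (fun p _ => by positivity) (fun p _ _ => ?_)
        · rw [Finset.mem_filter] at hp ⊢
          exact ⟨hp.1, hp.2.trans hyz⟩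
        · have : (0 : ℝ) ≤ 2 / p := by positivity
          linarith
      have hs1 : 1 ≤ Real.log D / Real.log z := by
        exact_mod_cast hlogdiv z D hz 1 (by simpa using hD)
      have hs2 : Real.log D / Real.log z ≤ 3 := by
        rw [div_le_iff₀ hlz, ← Nat.cast_ofNat, ← Real.log_pow]
        exact Real.log_le_log (by linarith) h3.le
      have hmaj := hU.upper_ge_of_le_three _ hs1 hs2 M hM
      have hden := hV y z hy1 hyz.le
      have hratio : Real.log z / Real.log y = 3 / (Real.log D / Real.log z) := by
        rw [hlD]; field_simp
      rw [hratio] at hden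
      have hpos : 0 ≤ 1 + (η * U₀ 2 + (1 + η) / 3 * ∫ u in (2 : ℝ)..M, U₀ u) := by
        have h1 := hU.lower_nonneg 2 le_rfl
        have h2 : 0 ≤ ∫ u in (2 : ℝ)..M, U₀ u :=
          intervalIntegral.integral_nonneg hM fun u hu => hU.lower_nonneg u hu.1
        positivity
      refine (hmono.trans h).trans ?_
      have e1 : sieveDensity P y * (1 + (η * U₀ 2 + (1 + η) / 3 * ∫ u in (2 : ℝ)..M, U₀ u))
          ≤ sieveDensity P z * (1 + U₁ (Real.log D / Real.log z)) := by
        refine (mul_le_mul_of_nonneg_right hden hpos).trans ?_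
        refine le_trans (le_of_eq ?_) (mul_le_mul_of_nonneg_left hmaj (sieveDensity_pos hP z).le)
        ring
      have e2 := mul_le_mul_of_nonneg_left e1 (hg B)
      have e3 : (2 : ℝ) ^ B.card * (D * sieveWeight P y) ≤ 2 ^ B.card * (D * sieveWeight P z) := by
        gcongr
      linarith

open Classical in
/-- The lower bound of the linear sieve. -/
theorem linear_sieve_lower_bound (hP : ∀ p ∈ P, 3 ≤ p) (hU : IsLinearSieveMajorant η U₁ U₀)
    (hV : HasLinearDensity η P)
    (hcount : ∀ B ⊆ P, |(((Finset.range N).filter fun t => ∀ q ∈ B, bad q t).card : ℝ)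
      - N * ∏ q ∈ B, 2 / (q : ℝ)| ≤ 2 ^ B.card) {z D : ℝ} (hz : 1 < z) (hD : z ^ 2 ≤ D) :
    N * (sieveDensity P z * (1 - U₀ (Real.log D / Real.log z))) - D * sieveWeight P z
      ≤ (siftedSet N bad P ∅ z).card := by
  have := (siftedSet_card_bounds hP hU hV hcount ⌈z⌉₊ z hz (Nat.le_ceil z) ∅ (by simp)
    (by simp)).1 D hD
  simpa using this

end LinearSieve

section SieveMajorant

open MeasureTheory Set
open scoped ENNReal

/-- An explicit function dominating the upper sieve deviation. -/
noncomputable def upperEnvelope (s : ℝ) : ℝ :=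
  47 / 200 * if s ≤ 3 then 3 / s else Real.exp (-(3 / 2) * (s - 3))

/-- An explicit function dominating the lower sieve deviation. -/
noncomputable def lowerEnvelope (s : ℝ) : ℝ :=
  Real.exp (-(3 / 2) * (s - 2))

theorem lintegral_exp_Ioi (a d : ℝ) :
    ∫⁻ u in Ioi a, ENNReal.ofReal (Real.exp (-(3 / 2) * (u - d)))
      = ENNReal.ofReal (2 / 3 * Real.exp (-(3 / 2) * (a - d))) := by
  have hsplit : ∀ u : ℝ, Real.exp (-(3 / 2) * (u - d))
      = Real.exp (3 / 2 * d) * Real.exp (-(3 / 2) * u) := fun u => by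
    rw [← Real.exp_add]; congr 1; ring
  simp_rw [hsplit]
  rw [← ofReal_integral_eq_lintegral_ofReal, integral_const_mul, integral_exp_mul_Ioi (by norm_num)]
  · congr 1
    ring
  · exact (integrableOn_exp_mul_Ioi (by norm_num) a).const_mul _
  · exact Filter.Eventually.of_forall fun u => by positivity

theorem lowerEnvelope_pos (s : ℝ) : 0 < lowerEnvelope s := Real.exp_pos _

theorem upperEnvelope_pos {s : ℝ} (hs : 1 ≤ s) : 0 < upperEnvelope s := by
  rw [upperEnvelope]
  split_ifs <;> positivity

theorem lowerEnvelope_antitone : Antitone lowerEnvelope := by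
  intro a b hab
  exact Real.exp_le_exp.2 (by linarith)

theorem upperEnvelope_of_le {s : ℝ} (hs : s ≤ 3) : upperEnvelope s = 47 / 200 * (3 / s) := by
  rw [upperEnvelope, if_pos hs]

theorem upperEnvelope_of_ge {s : ℝ} (hs : 3 ≤ s) :
    upperEnvelope s = 47 / 200 * Real.exp (-(3 / 2) * (s - 3)) := by
  rcases hs.eq_or_lt with rfl | hs
  · rw [upperEnvelope, if_pos le_rfl]; norm_num
  · rw [upperEnvelope, if_neg (not_le.2 hs)]

theorem upperEnvelope_antitoneOn : AntitoneOn upperEnvelope (Ici 1) := by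
  have h1 : AntitoneOn upperEnvelope (Icc 1 3) := by
    intro a ha b hb hab
    rw [upperEnvelope_of_le ha.2, upperEnvelope_of_le hb.2]
    have := ha.1
    gcongr
  have h2 : AntitoneOn upperEnvelope (Ici 3) := by
    intro a ha b hb hab
    rw [upperEnvelope_of_ge ha, upperEnvelope_of_ge hb]
    gcongr ?_ * Real.exp ?_
    linarith
  intro a ha b hb hab
  rcases le_total b 3 with hb3 | hb3
  · exact h1 ⟨ha, hab.trans hb3⟩ ⟨hb, hb3⟩ hab
  · rcases le_total a 3 with ha3 | ha3
    · exact (h2 self_mem_Ici hb3 hb3).trans (h1 ⟨ha, ha3⟩ ⟨by norm_num, le_rfl⟩ ha3)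
    · exact h2 ha3 hb3 hab

theorem upperEnvelope_le_one {s : ℝ} (hs : 1 ≤ s) : upperEnvelope s ≤ 1 :=
  (upperEnvelope_antitoneOn self_mem_Ici hs hs).trans
    (by rw [upperEnvelope_of_le (by norm_num)]; norm_num)

theorem lowerEnvelope_le_one {s : ℝ} (hs : 2 ≤ s) : lowerEnvelope s ≤ 1 :=
  (lowerEnvelope_antitone hs).trans (by simp [lowerEnvelope])

theorem lintegral_lowerEnvelope_le {s : ℝ} (hs : 1 ≤ s) :
    ∫⁻ u in Ioi (max s 3 - 1), ENNReal.ofReal (lowerEnvelope u)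
      ≤ ENNReal.ofReal (24 / 25 * s * upperEnvelope s) := by
  simp only [lowerEnvelope]
  rw [lintegral_exp_Ioi]
  refine ENNReal.ofReal_le_ofReal ?_
  rcases le_total s 3 with h | h
  · rw [upperEnvelope_of_le h, max_eq_right h]
    have : (24 / 25 * s * (47 / 200 * (3 / s)) : ℝ) = 24 / 25 * (47 / 200 * 3) := by field_simp
    rw [this]
    norm_num
  · rw [upperEnvelope_of_ge h, max_eq_left h]
    have : s - 1 - 2 = s - 3 := by ring
    rw [this]
    nlinarith [Real.exp_pos (-(3 / 2) * (s - 3))]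

theorem exp_three_le : Real.exp 3 ≤ 20.1 := by
  have h1 := Real.exp_one_lt_d9
  have : Real.exp 3 = Real.exp 1 ^ 3 := by rw [← Real.exp_nat_mul]; norm_num
  rw [this]
  calc Real.exp 1 ^ 3 ≤ 2.7182818286 ^ 3 := by gcongr
    _ ≤ 20.1 := by norm_num

theorem le_mul_exp_of_mem_Icc {x : ℝ} (h0 : 0 ≤ x) (h2 : x ≤ 2) :
    2 / 3 * (2 - x) / (1 + x) + 4 / 27 ≤ 9 / 10 * (x + 2) * Real.exp (-(3 / 2) * x) := by
  have hw : (687 / 1000 : ℝ) ≤ Real.exp (-(3 / 8)) := by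
    refine le_of_pow_le_pow_left₀ (n := 8) (by norm_num) (Real.exp_pos _).le ?_
    rw [← Real.exp_nat_mul]
    have h1 := Real.exp_neg_one_gt_d9
    have h3 : Real.exp (((8 : ℕ) : ℝ) * -(3 / 8)) = Real.exp (-1) ^ 3 := by
      rw [← Real.exp_nat_mul]; norm_num
    rw [h3]
    calc (687 / 1000 : ℝ) ^ 8 ≤ 0.36787944116 ^ 3 := by norm_num
      _ ≤ Real.exp (-1) ^ 3 := by gcongr
  have htan : ∀ (k : ℕ) (E : ℝ), 0 ≤ E → E ≤ (687 / 1000) ^ k →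
      0 ≤ 1 - 3 / 2 * (x - k / 4) →
      E * (1 - 3 / 2 * (x - k / 4)) ≤ Real.exp (-(3 / 2) * x) := by
    intro k E hE hEk hx
    have h3 : Real.exp (-(3 / 2) * x)
        = Real.exp (-(3 / 8)) ^ k * Real.exp (-(3 / 2) * (x - k / 4)) := by
      rw [← Real.exp_nat_mul, ← Real.exp_add]
      congr 1
      ring
    rw [h3]
    refine mul_le_mul (hEk.trans (by gcongr)) ?_ hx (by positivity)
    linarith [Real.add_one_le_exp (-(3 / 2) * (x - k / 4))]
  have hfin : ∀ y : ℝ, y ≤ Real.exp (-(3 / 2) * x) →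
      2 / 3 * (2 - x) + 4 / 27 * (1 + x) ≤ 9 / 10 * (x + 2) * (1 + x) * y →
      2 / 3 * (2 - x) / (1 + x) + 4 / 27 ≤ 9 / 10 * (x + 2) * Real.exp (-(3 / 2) * x) := by
    intro y hy h
    have h4 : 2 / 3 * (2 - x) / (1 + x) + 4 / 27
        = (2 / 3 * (2 - x) + 4 / 27 * (1 + x)) / (1 + x) := by field_simp
    rw [h4, div_le_iff₀ (by linarith)]
    refine h.trans ?_
    have h5 : 0 ≤ 9 / 10 * (x + 2) * (1 + x) := by positivity
    linarith [mul_le_mul_of_nonneg_left hy h5]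
  rcases le_total x (1 / 2) with ha | ha
  · refine hfin _ (htan 1 (687 / 1000) (by norm_num) (by norm_num) (by norm_num; linarith)) ?_
    norm_num
    nlinarith [mul_nonneg h0 (sub_nonneg.2 ha), mul_nonneg h0 (mul_nonneg h0 (sub_nonneg.2 ha))]
  rcases le_total x 1 with hb | hb
  · refine hfin _ (htan 3 (324 / 1000) (by norm_num) (by norm_num) (by norm_num; linarith)) ?_
    norm_num
    nlinarith [mul_nonneg (sub_nonneg.2 ha) (sub_nonneg.2 hb),
      mul_nonneg h0 (mul_nonneg (sub_nonneg.2 ha) (sub_nonneg.2 hb))]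
  rcases le_total x (3 / 2) with hc | hc
  · refine hfin _ (htan 5 (153 / 1000) (by norm_num) (by norm_num) (by norm_num; linarith)) ?_
    norm_num
    nlinarith [mul_nonneg (sub_nonneg.2 hb) (sub_nonneg.2 hc),
      mul_nonneg h0 (mul_nonneg (sub_nonneg.2 hb) (sub_nonneg.2 hc))]
  · refine hfin _ (htan 7 (722 / 10000) (by norm_num) (by norm_num) (by norm_num; linarith)) ?_
    norm_num
    nlinarith [mul_nonneg (sub_nonneg.2 hc) (sub_nonneg.2 h2),
      mul_nonneg h0 (mul_nonneg (sub_nonneg.2 hc) (sub_nonneg.2 h2))]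

theorem lintegral_upperEnvelope_le {s : ℝ} (hs : 2 ≤ s) :
    ∫⁻ u in Ioi (s - 1), ENNReal.ofReal (upperEnvelope u)
      ≤ ENNReal.ofReal (24 / 25 * s * lowerEnvelope s) := by
  have htail : ∀ a, 3 ≤ a → ∫⁻ u in Ioi a, ENNReal.ofReal (upperEnvelope u)
      = ENNReal.ofReal (47 / 200 * (2 / 3 * Real.exp (-(3 / 2) * (a - 3)))) := by
    intro a ha
    rw [ENNReal.ofReal_mul (by norm_num), ← lintegral_exp_Ioi, ← lintegral_const_mul' _ _ (by simp)]
    refine setLIntegral_congr_fun measurableSet_Ioi fun u hu => ?_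
    rw [← ENNReal.ofReal_mul (by norm_num), upperEnvelope_of_ge (ha.trans (le_of_lt hu))]
  rcases le_total 4 s with h | h
  · rw [htail _ (by linarith)]
    refine ENNReal.ofReal_le_ofReal ?_
    have : Real.exp (-(3 / 2) * (s - 1 - 3)) = Real.exp 3 * lowerEnvelope s := by
      rw [lowerEnvelope, ← Real.exp_add]; congr 1; ring
    rw [this]
    have h1 := exp_three_le
    nlinarith [lowerEnvelope_pos s, mul_le_mul_of_nonneg_right h1 (lowerEnvelope_pos s).le]
  · rw [← Ioc_union_Ioi_eq_Ioi (show s - 1 ≤ 3 by linarith), lintegral_union measurableSet_Ioi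
      (by rw [Set.disjoint_left]; intro x hx hx'; exact not_lt.2 hx.2 hx'), htail 3 le_rfl]
    have h1 : ∫⁻ u in Ioc (s - 1) 3, ENNReal.ofReal (upperEnvelope u)
        ≤ ENNReal.ofReal (47 / 200 * (3 / (s - 1)) * (4 - s)) := by
      calc _ ≤ ∫⁻ u in Ioc (s - 1) 3, ENNReal.ofReal (47 / 200 * (3 / (s - 1))) := by
            refine setLIntegral_mono' measurableSet_Ioc fun u hu => ENNReal.ofReal_le_ofReal ?_
            rw [upperEnvelope_of_le hu.2]
            have := hu.1.le
            gcongr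
            linarith
        _ = _ := by
            have : (0 : ℝ) ≤ 47 / 200 * (3 / (s - 1)) :=
              mul_nonneg (by norm_num) (div_nonneg (by norm_num) (by linarith))
            rw [setLIntegral_const, Real.volume_Ioc, ENNReal.ofReal_mul this]
            congr 2
            ring
    refine (add_le_add_left h1 _).trans ?_
    rw [← ENNReal.ofReal_add (mul_nonneg (mul_nonneg (by norm_num)
      (div_nonneg (by norm_num) (by linarith))) (by linarith)) (by positivity)]
    refine ENNReal.ofReal_le_ofReal ?_
    have h2 := le_mul_exp_of_mem_Icc (x := s - 2) (by linarith) (by linarith)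
    have h3 : 1 + (s - 2) = s - 1 := by ring
    have h4 : 2 - (s - 2) = 4 - s := by ring
    rw [h3, h4] at h2
    rw [lowerEnvelope]
    have h5 : 47 / 200 * (3 / (s - 1)) * (4 - s) + 47 / 200 * (2 / 3 * Real.exp (-(3 / 2) * (3 - 3)))
        = 47 / 200 * 9 / 2 * (2 / 3 * (4 - s) / (s - 1) + 4 / 27) := by
      have : s - 1 ≠ 0 := by linarith
      norm_num
      field_simp
      ring
    rw [h5]
    have h6 : (0 : ℝ) ≤ s * Real.exp (-(3 / 2) * (s - 2)) := by positivity
    nlinarith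

/-- The integral operator whose fixed point is the pair of deviations of the linear sieve. -/
noncomputable def sieveOperator :
    ((ℝ → ℝ≥0∞) × (ℝ → ℝ≥0∞)) →o ((ℝ → ℝ≥0∞) × (ℝ → ℝ≥0∞)) where
  toFun f :=
    (fun s => (ENNReal.ofReal (3 - s) + ∫⁻ u in Ioi (max s 3 - 1), f.2 u) / ENNReal.ofReal s,
      fun s => (∫⁻ u in Ioi (s - 1), f.1 u) / ENNReal.ofReal s)
  monotone' f g hfg := by
    refine ⟨fun s => ?_, fun s => ?_⟩
    · exact ENNReal.div_le_div_right (add_le_add le_rfl (lintegral_mono fun u => hfg.2 u)) _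
    · exact ENNReal.div_le_div_right (lintegral_mono fun u => hfg.1 u) _

theorem antitone_sieveOperator_fst (f : (ℝ → ℝ≥0∞) × (ℝ → ℝ≥0∞)) :
    Antitone (sieveOperator f).1 := fun a b hab =>
  ENNReal.div_le_div (add_le_add (ENNReal.ofReal_le_ofReal (by linarith))
    (lintegral_mono_set (Ioi_subset_Ioi (sub_le_sub_right (max_le_max_right 3 hab) 1))))
    (ENNReal.ofReal_le_ofReal hab)

theorem antitone_sieveOperator_snd (f : (ℝ → ℝ≥0∞) × (ℝ → ℝ≥0∞)) :
    Antitone (sieveOperator f).2 := fun a b hab =>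
  ENNReal.div_le_div (lintegral_mono_set (Ioi_subset_Ioi (by linarith)))
    (ENNReal.ofReal_le_ofReal hab)

theorem lintegral_lintegral_Ioi_sub_one {f : ℝ → ℝ≥0∞} (hf : Measurable f) (a : ℝ) :
    ∫⁻ x in Ioi a, ∫⁻ v in Ioi (x - 1), f v
      = ∫⁻ v in Ioi (a - 1), ENNReal.ofReal (v - (a - 1)) * f v := by
  have h1 : ∀ x, ∫⁻ v in Ioi (x - 1), f v
      = ∫⁻ v, {p : ℝ × ℝ | p.1 < p.2 + 1}.indicator (fun p => f p.2) (x, v) := by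
    intro x
    rw [← lintegral_indicator measurableSet_Ioi]
    refine lintegral_congr fun v => ?_
    simp only [indicator_apply, mem_Ioi, Set.mem_ofPred_eq, sub_lt_iff_lt_add]
  simp_rw [h1]
  have hS : MeasurableSet {p : ℝ × ℝ | p.1 < p.2 + 1} :=
    measurableSet_lt measurable_fst (measurable_snd.add_const 1)
  rw [lintegral_lintegral_swap
    (f := fun x v => {p : ℝ × ℝ | p.1 < p.2 + 1}.indicator (fun p => f p.2) (x, v))
    (((hf.comp measurable_snd).indicator hS).aemeasurable)]
  have h2 : ∀ v, ∫⁻ x in Ioi a, {p : ℝ × ℝ | p.1 < p.2 + 1}.indicator (fun p => f p.2) (x, v)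
      = ENNReal.ofReal (v - (a - 1)) * f v := by
    intro v
    have h3 : ∀ x, {p : ℝ × ℝ | p.1 < p.2 + 1}.indicator (fun p => f p.2) (x, v)
        = (Iio (v + 1)).indicator (fun _ => f v) x := fun x => by
      simp only [indicator_apply, mem_Iio, Set.mem_ofPred_eq]
    simp_rw [h3]
    rw [lintegral_indicator measurableSet_Iio, Measure.restrict_restrict measurableSet_Iio,
      setLIntegral_const, inter_comm, Ioi_inter_Iio, Real.volume_Ioo, mul_comm]
    congr 2
    ring
  simp_rw [h2]
  rw [← lintegral_indicator measurableSet_Ioi]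
  refine lintegral_congr fun v => ?_
  rw [indicator_apply]
  split_ifs with h
  · rfl
  · rw [ENNReal.ofReal_of_nonpos (by rw [mem_Ioi, not_lt] at h; linarith), zero_mul]

/-- The deviations of the upper and the lower linear sieve from the main term. -/
theorem exists_sieve_deviation : ∃ T₁ T₀ : ℝ → ℝ≥0∞, Antitone T₁ ∧ Antitone T₀ ∧
    (∀ s, 1 ≤ s → ENNReal.ofReal s * T₁ s
      = ENNReal.ofReal (3 - s) + ∫⁻ u in Ioi (max s 3 - 1), T₀ u) ∧
    (∀ s, 2 ≤ s → ENNReal.ofReal s * T₀ s = ∫⁻ u in Ioi (s - 1), T₁ u) ∧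
    (∀ s, 1 ≤ s → T₁ s ≤ ENNReal.ofReal (100 * upperEnvelope s)) ∧
    (∀ s, 2 ≤ s → T₀ s ≤ ENNReal.ofReal (100 * lowerEnvelope s)) ∧
    ∫⁻ u in Ioi 1, T₁ u = 2 := by
  set T := sieveOperator.lfp with hT
  have hfix : sieveOperator T = T := sieveOperator.map_lfp
  have ha1 : Antitone T.1 := hfix ▸ antitone_sieveOperator_fst T
  have ha0 : Antitone T.2 := hfix ▸ antitone_sieveOperator_snd T
  have he1 : ∀ s, 1 ≤ s → ENNReal.ofReal s * T.1 s
      = ENNReal.ofReal (3 - s) + ∫⁻ u in Ioi (max s 3 - 1), T.2 u := by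
    intro s hs
    conv_lhs => rw [← hfix]
    exact ENNReal.mul_div_cancel (by simp; linarith) (by simp)
  have he0 : ∀ s, 2 ≤ s → ENNReal.ofReal s * T.2 s = ∫⁻ u in Ioi (s - 1), T.1 u := by
    intro s hs
    conv_lhs => rw [← hfix]
    exact ENNReal.mul_div_cancel (by simp; linarith) (by simp)
  have hle : T ≤ (fun s => if 1 ≤ s then ENNReal.ofReal (100 * upperEnvelope s) else ⊤,
      fun s => if 2 ≤ s then ENNReal.ofReal (100 * lowerEnvelope s) else ⊤) := by
    refine sieveOperator.lfp_le ⟨fun s => ?_, fun s => ?_⟩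
    · dsimp only
      split_ifs with hs
      swap
      · exact le_top
      refine ENNReal.div_le_of_le_mul ?_
      have h1 : ∫⁻ u in Ioi (max s 3 - 1),
          (if 2 ≤ u then ENNReal.ofReal (100 * lowerEnvelope u) else ⊤)
          = ENNReal.ofReal 100 * ∫⁻ u in Ioi (max s 3 - 1), ENNReal.ofReal (lowerEnvelope u) := by
        rw [← lintegral_const_mul' _ _ (by simp)]
        refine setLIntegral_congr_fun measurableSet_Ioi fun u hu => ?_
        have : 2 ≤ u := by
          have h3 : max s 3 - 1 < u := hu
          linarith [le_max_right s 3]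
        rw [if_pos this, ENNReal.ofReal_mul (by norm_num)]
      refine (add_le_add le_rfl (h1.le.trans (mul_le_mul_right
        (lintegral_lowerEnvelope_le hs) _))).trans ?_
      have hpos := upperEnvelope_pos hs
      rw [← ENNReal.ofReal_mul (by norm_num), ← ENNReal.ofReal_mul (by positivity)]
      rcases le_total s 3 with h3 | h3
      · rw [← ENNReal.ofReal_add (by linarith) (by positivity)]
        refine ENNReal.ofReal_le_ofReal ?_
        have : s * upperEnvelope s = 47 / 200 * 3 := by
          rw [upperEnvelope_of_le h3]; field_simp
        nlinarith
      · rw [ENNReal.ofReal_of_nonpos (by linarith), zero_add]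
        refine ENNReal.ofReal_le_ofReal ?_
        nlinarith [mul_pos (show 0 < s by linarith) hpos]
    · dsimp only
      split_ifs with hs
      swap
      · exact le_top
      refine ENNReal.div_le_of_le_mul ?_
      have h1 : ∫⁻ u in Ioi (s - 1),
          (if 1 ≤ u then ENNReal.ofReal (100 * upperEnvelope u) else ⊤)
          = ENNReal.ofReal 100 * ∫⁻ u in Ioi (s - 1), ENNReal.ofReal (upperEnvelope u) := by
        rw [← lintegral_const_mul' _ _ (by simp)]
        refine setLIntegral_congr_fun measurableSet_Ioi fun u hu => ?_
        have : 1 ≤ u := by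
          have h3 : s - 1 < u := hu
          linarith
        rw [if_pos this, ENNReal.ofReal_mul (by norm_num)]
      refine (h1.le.trans (mul_le_mul_right (lintegral_upperEnvelope_le hs) _)).trans ?_
      have hpos := lowerEnvelope_pos s
      rw [← ENNReal.ofReal_mul (by norm_num), ← ENNReal.ofReal_mul (by positivity)]
      refine ENNReal.ofReal_le_ofReal ?_
      nlinarith [mul_pos (show 0 < s by linarith) hpos]
  have hb1 : ∀ s, 1 ≤ s → T.1 s ≤ ENNReal.ofReal (100 * upperEnvelope s) := fun s hs => by
    have := hle.1 s
    dsimp only at this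
    rwa [if_pos hs] at this
  have hb0 : ∀ s, 2 ≤ s → T.2 s ≤ ENNReal.ofReal (100 * lowerEnvelope s) := fun s hs => by
    have := hle.2 s
    dsimp only at this
    rwa [if_pos hs] at this
  refine ⟨T.1, T.2, ha1, ha0, he1, he0, hb1, hb0, ?_⟩
  have hm1 : Measurable T.1 := ha1.measurable
  have hm0 : Measurable T.2 := ha0.measurable
  -- test both equations against the identity function
  have hA : ∫⁻ x in Ioi 2, ENNReal.ofReal x * T.2 x
      = ∫⁻ v in Ioi 1, ENNReal.ofReal (v - 1) * T.1 v := by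
    have := lintegral_lintegral_Ioi_sub_one hm1 2
    norm_num at this
    rw [← this]
    exact setLIntegral_congr_fun measurableSet_Ioi fun x hx => he0 x (le_of_lt hx)
  have hB : ∫⁻ x in Ioi 1, ENNReal.ofReal x * T.1 x
      = (∫⁻ v in Ioi 1, ENNReal.ofReal (v - 1) * T.1 v) + ∫⁻ u in Ioi 1, T.1 u := by
    rw [← lintegral_add_right _ hm1]
    refine setLIntegral_congr_fun measurableSet_Ioi fun x hx => ?_
    have hx1 : (1 : ℝ) < x := hx
    have : ENNReal.ofReal x = ENNReal.ofReal (x - 1) + 1 := by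
      rw [← ENNReal.ofReal_one, ← ENNReal.ofReal_add (by linarith) (by norm_num)]
      congr 1
      ring
    rw [this, add_mul, one_mul]
  have hC : ∫⁻ x in Ioi 2, ENNReal.ofReal x * T.2 x
      = (∫⁻ v in Ioi 2, ENNReal.ofReal (v - 2) * T.2 v) + 2 * ∫⁻ u in Ioi 2, T.2 u := by
    rw [← lintegral_const_mul _ hm0, ← lintegral_add_right _ (hm0.const_mul _)]
    refine setLIntegral_congr_fun measurableSet_Ioi fun x hx => ?_
    have hx1 : (2 : ℝ) < x := hx
    have : ENNReal.ofReal x = ENNReal.ofReal (x - 2) + 2 := by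
      rw [show (2 : ℝ≥0∞) = ENNReal.ofReal 2 by simp,
        ← ENNReal.ofReal_add (by linarith) (by norm_num)]
      congr 1
      ring
    rw [this, add_mul]
  have hD : ∫⁻ x in Ioi 1, ENNReal.ofReal x * T.1 x = 2 + 2 * (∫⁻ u in Ioi 2, T.2 u)
      + ∫⁻ v in Ioi 2, ENNReal.ofReal (v - 2) * T.2 v := by
    rw [← Ioc_union_Ioi_eq_Ioi (show (1 : ℝ) ≤ 3 by norm_num), lintegral_union measurableSet_Ioi
      (by rw [Set.disjoint_left]; intro x hx hx'; exact not_lt.2 hx.2 hx')]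
    congr 1
    · have : ∫⁻ x in Ioc 1 3, ENNReal.ofReal x * T.1 x
          = ∫⁻ x in Ioc (1 : ℝ) 3, (ENNReal.ofReal (3 - x) + ∫⁻ u in Ioi 2, T.2 u) := by
        refine setLIntegral_congr_fun measurableSet_Ioc fun x hx => ?_
        rw [he1 x hx.1.le, max_eq_right hx.2]
        norm_num
      rw [this, lintegral_add_right _ measurable_const, setLIntegral_const, Real.volume_Ioc]
      congr 1
      · rw [← ofReal_integral_eq_lintegral_ofReal, ← intervalIntegral.integral_of_le (by norm_num)]
        · rw [intervalIntegral.integral_sub (by simp) (by simp)]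
          norm_num
        · exact (intervalIntegrable_iff_integrableOn_Ioc_of_le (by norm_num)).1
            ((continuous_const.sub continuous_id).intervalIntegrable _ _)
        · refine (ae_restrict_iff' measurableSet_Ioc).2 (Filter.Eventually.of_forall fun x hx => ?_)
          exact sub_nonneg.2 hx.2
      · norm_num [mul_comm]
    · have := lintegral_lintegral_Ioi_sub_one hm0 3
      norm_num at this
      rw [← this]
      refine setLIntegral_congr_fun measurableSet_Ioi fun x hx => ?_
      have hx1 : (3 : ℝ) < x := hx
      rw [he1 x (by linarith), max_eq_left hx1.le, ENNReal.ofReal_of_nonpos (by linarith), zero_add]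
  have hfin : ∫⁻ x in Ioi 2, ENNReal.ofReal x * T.2 x ≠ ⊤ := by
    refine ne_top_of_le_ne_top (b := ENNReal.ofReal 200 *
      ∫⁻ u in Ioi (2 : ℝ), ENNReal.ofReal (Real.exp (-1 * u) * Real.exp 2)) ?_ ?_
    · refine ENNReal.mul_ne_top (by simp) ?_
      have hi : IntegrableOn (fun u : ℝ => Real.exp (-1 * u) * Real.exp 2) (Ioi 2) :=
        (integrableOn_exp_mul_Ioi (by norm_num) 2).mul_const _
      rw [← ofReal_integral_eq_lintegral_ofReal hi
        (Filter.Eventually.of_forall fun u => by positivity)]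
      simp
    · rw [← lintegral_const_mul' _ _ (by simp)]
      refine setLIntegral_mono' measurableSet_Ioi fun x hx => ?_
      have hx1 : (2 : ℝ) < x := hx
      refine (mul_le_mul_right (hb0 x hx1.le) _).trans ?_
      rw [← ENNReal.ofReal_mul (by linarith), ← ENNReal.ofReal_mul (by norm_num)]
      refine ENNReal.ofReal_le_ofReal ?_
      have h1 : Real.exp (-1 * x) * Real.exp 2
          = Real.exp (1 / 2 * (x - 2)) * lowerEnvelope x := by
        rw [lowerEnvelope, ← Real.exp_add, ← Real.exp_add]
        congr 1
        ring
      rw [h1]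
      have h2 := Real.add_one_le_exp (1 / 2 * (x - 2))
      nlinarith [mul_le_mul_of_nonneg_right h2 (lowerEnvelope_pos x).le]
  rw [hA] at hC hfin
  have : (∫⁻ v in Ioi 1, ENNReal.ofReal (v - 1) * T.1 v) + ∫⁻ u in Ioi 1, T.1 u
      = (∫⁻ v in Ioi 1, ENNReal.ofReal (v - 1) * T.1 v) + 2 := by
    rw [← hB, hD, hC]
    ring
  exact (ENNReal.add_right_inj hfin).1 this

theorem intervalIntegral_le_of_lintegral_le {U : ℝ → ℝ} {g : ℝ → ℝ≥0∞} {a M K : ℝ} (hK : 0 ≤ K)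
    (haM : a ≤ M) (hU : ∀ u, a < u → ENNReal.ofReal ‖U u‖ ≤ g u)
    (hg : ∫⁻ u in Ioi a, g u ≤ ENNReal.ofReal K) : ∫ u in a..M, U u ≤ K := by
  rw [intervalIntegral.integral_of_le haM]
  refine (Real.le_norm_self _).trans ((norm_integral_le_lintegral_norm _).trans ?_)
  refine ENNReal.toReal_le_of_le_ofReal hK (le_trans ?_ hg)
  exact (setLIntegral_mono' measurableSet_Ioc fun u hu => hU u hu.1).trans
    (lintegral_mono_set Ioc_subset_Ioi_self)

theorem upperEnvelope_sub_one_le {s : ℝ} (hs : 2 ≤ s) :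
    upperEnvelope (s - 1) ≤ 21 * lowerEnvelope s := by
  have h3 := exp_three_le
  have hpos := lowerEnvelope_pos s
  rcases le_total s 4 with h | h
  · have h1 := upperEnvelope_le_one (s := s - 1) (by linarith)
    have h2 : Real.exp (-3) ≤ lowerEnvelope s := Real.exp_le_exp.2 (by linarith)
    have h4 : Real.exp 3 * Real.exp (-3) = 1 := by rw [← Real.exp_add]; simp
    nlinarith [Real.exp_pos (-3)]
  · rw [upperEnvelope_of_ge (by linarith)]
    have : Real.exp (-(3 / 2) * (s - 1 - 3)) = Real.exp 3 * lowerEnvelope s := by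
      rw [lowerEnvelope, ← Real.exp_add]; congr 1; ring
    rw [this]
    nlinarith

theorem lowerEnvelope_sub_one_le {s : ℝ} (hs : 3 ≤ s) :
    lowerEnvelope (s - 1) ≤ 5 * upperEnvelope s := by
  rw [upperEnvelope_of_ge hs, lowerEnvelope, show s - 1 - 2 = s - 3 by ring]
  linarith [Real.exp_pos (-(3 / 2) * (s - 3))]

theorem exists_isLinearSieveMajorant {ε : ℝ} (hε : 0 < ε) :
    ∃ η : ℝ, 0 < η ∧ ∃ δ : ℝ, 0 < δ ∧ ∃ U₁ U₀ : ℝ → ℝ, IsLinearSieveMajorant η U₁ U₀ ∧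
      U₀ (2 + ε) ≤ 1 - δ := by
  obtain ⟨T₁, T₀, ha1, ha0, he1, he0, hb1, hb0, htot⟩ := exists_sieve_deviation
  obtain ⟨θ, hθ, hθ1, hθε⟩ : ∃ θ : ℝ, 0 < θ ∧ θ ≤ 1 ∧ 2 / (2 + ε) + 2 * θ ≤ 1 := by
    refine ⟨ε / (2 * (2 + ε)), by positivity, ?_, le_of_eq ?_⟩
    · rw [div_le_one (by positivity)]; linarith
    · field_simp
  have hup : ∀ s, 1 ≤ s → 0 ≤ upperEnvelope s := fun s hs => (upperEnvelope_pos hs).le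
  have hlo : ∀ s, 0 ≤ lowerEnvelope s := fun s => (lowerEnvelope_pos s).le
  have ht1 : ∀ s, 1 ≤ s → T₁ s ≠ ⊤ := fun s hs => ne_top_of_le_ne_top ENNReal.ofReal_ne_top (hb1 s hs)
  have ht0 : ∀ s, 2 ≤ s → T₀ s ≠ ⊤ := fun s hs => ne_top_of_le_ne_top ENNReal.ofReal_ne_top (hb0 s hs)
  have hr1 : ∀ s, 1 ≤ s → (T₁ s).toReal ≤ 100 * upperEnvelope s := fun s hs =>
    ENNReal.toReal_le_of_le_ofReal (mul_nonneg (by norm_num) (hup s hs)) (hb1 s hs)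
  have hr0 : ∀ s, 2 ≤ s → (T₀ s).toReal ≤ 100 * lowerEnvelope s := fun s hs =>
    ENNReal.toReal_le_of_le_ofReal (mul_nonneg (by norm_num) (hlo s)) (hb0 s hs)
  have hint1 : ∀ s, 2 ≤ s → ∀ M, s - 1 ≤ M →
      ∫ u in (s - 1)..M, ((T₁ u).toReal + θ * upperEnvelope u)
        ≤ s * (T₀ s).toReal + θ * (24 / 25 * s * lowerEnvelope s) := by
    intro s hs M hM
    have hs0 : 0 ≤ s := by linarith
    have h1 := hlo s
    refine intervalIntegral_le_of_lintegral_le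
      (g := fun u => T₁ u + ENNReal.ofReal θ * ENNReal.ofReal (upperEnvelope u))
      (by positivity) hM (fun u hu => ?_) ?_
    · have h2 := hup u (by linarith)
      rw [Real.norm_of_nonneg (by positivity), ENNReal.ofReal_add (by positivity) (by positivity),
        ENNReal.ofReal_toReal (ht1 u (by linarith)), ENNReal.ofReal_mul hθ.le]
    · rw [lintegral_add_left ha1.measurable, ← he0 s hs, lintegral_const_mul' _ _ (by simp),
        ENNReal.ofReal_add (by positivity) (by positivity), ENNReal.ofReal_mul hs0,
        ENNReal.ofReal_toReal (ht0 s hs), ENNReal.ofReal_mul hθ.le]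
      gcongr
      exact lintegral_upperEnvelope_le hs
  have hint0 : ∀ s, 3 ≤ s → ∀ M, s - 1 ≤ M →
      ∫ u in (s - 1)..M, ((T₀ u).toReal + θ * lowerEnvelope u)
        ≤ s * (T₁ s).toReal + θ * (24 / 25 * s * upperEnvelope s) := by
    intro s hs M hM
    have hs0 : 0 ≤ s := by linarith
    have h1 := hup s (by linarith)
    have h3 := he1 s (by linarith)
    have h4 := lintegral_lowerEnvelope_le (s := s) (by linarith)
    rw [max_eq_left hs] at h3 h4
    rw [ENNReal.ofReal_of_nonpos (show 3 - s ≤ 0 by linarith), zero_add] at h3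
    refine intervalIntegral_le_of_lintegral_le
      (g := fun u => T₀ u + ENNReal.ofReal θ * ENNReal.ofReal (lowerEnvelope u))
      (by positivity) hM (fun u hu => ?_) ?_
    · have h2 := hlo u
      rw [Real.norm_of_nonneg (by positivity), ENNReal.ofReal_add (by positivity) (by positivity),
        ENNReal.ofReal_toReal (ht0 u (by linarith)), ENNReal.ofReal_mul hθ.le]
    · rw [lintegral_add_left ha0.measurable, ← h3, lintegral_const_mul' _ _ (by simp),
        ENNReal.ofReal_add (by positivity) (by positivity), ENNReal.ofReal_mul hs0,
        ENNReal.ofReal_toReal (ht1 s (by linarith)), ENNReal.ofReal_mul hθ.le]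
      gcongr
  set η := θ / 1000000 with hη
  have hη0 : 0 < η := by positivity
  have hupper : ∀ s, 3 ≤ s → ∀ M, s - 1 ≤ M →
      η * ((T₀ (s - 1)).toReal + θ * lowerEnvelope (s - 1)) + (1 + η) / s *
        ∫ u in (s - 1)..M, ((T₀ u).toReal + θ * lowerEnvelope u)
        ≤ (T₁ s).toReal + 49 / 50 * (θ * upperEnvelope s) := by
    intro s hs M hM
    have h1 := hint0 s hs M hM
    have h2 := hr0 (s - 1) (by linarith)
    have h3 := lowerEnvelope_sub_one_le hs
    have h4 := hr1 s (by linarith)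
    have h5 := hup s (by linarith)
    have h6 : (1 + η) / s * ∫ u in (s - 1)..M, ((T₀ u).toReal + θ * lowerEnvelope u)
        ≤ (1 + η) * ((T₁ s).toReal + θ * (24 / 25 * upperEnvelope s)) := by
      refine (mul_le_mul_of_nonneg_left h1 (by positivity)).trans (le_of_eq ?_)
      field_simp
    have h7 : (T₀ (s - 1)).toReal + θ * lowerEnvelope (s - 1) ≤ 505 * upperEnvelope s := by
      nlinarith [hlo (s - 1)]
    have h8 := mul_le_mul_of_nonneg_left h7 hη0.le
    have h9 : (T₁ s).toReal + θ * (24 / 25 * upperEnvelope s) ≤ 101 * upperEnvelope s := by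
      nlinarith
    have h10 := mul_le_mul_of_nonneg_left h9 hη0.le
    have h11 : 0 ≤ θ * upperEnvelope s := by positivity
    have h12 : η * upperEnvelope s = θ * upperEnvelope s / 1000000 := by rw [hη]; ring
    linarith
  refine ⟨η, hη0, θ, hθ, fun s => (T₁ s).toReal + θ * upperEnvelope s,
    fun s => (T₀ s).toReal + θ * lowerEnvelope s, ⟨hη0.le, ?_, ?_, ?_, ?_, ?_, ?_, ?_⟩, ?_⟩
  · intro a ha b hb hab
    exact add_le_add (ENNReal.toReal_mono (ht1 a ha) (ha1 hab))
      (mul_le_mul_of_nonneg_left (upperEnvelope_antitoneOn ha hb hab) hθ.le)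
  · intro a ha b hb hab
    exact add_le_add (ENNReal.toReal_mono (ht0 a ha) (ha0 hab))
      (mul_le_mul_of_nonneg_left (lowerEnvelope_antitone hab) hθ.le)
  · intro s hs
    have := hup s hs
    positivity
  · intro s hs
    have := hlo s
    positivity
  · intro s hs M hM
    have h1 := hint1 s hs M hM
    have h2 := hr1 (s - 1) (by linarith)
    have h3 := upperEnvelope_sub_one_le hs
    have h4 := hr0 s (by linarith)
    have h5 := hlo s
    have h6 : (1 + η) / s * ∫ u in (s - 1)..M, ((T₁ u).toReal + θ * upperEnvelope u)
        ≤ (1 + η) * ((T₀ s).toReal + θ * (24 / 25 * lowerEnvelope s)) := by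
      refine (mul_le_mul_of_nonneg_left h1 (by positivity)).trans (le_of_eq ?_)
      field_simp
    have h7 : (T₁ (s - 1)).toReal + θ * upperEnvelope (s - 1) ≤ 2121 * lowerEnvelope s := by
      nlinarith [hup (s - 1) (by linarith)]
    have h8 := mul_le_mul_of_nonneg_left h7 hη0.le
    have h9 : (T₀ s).toReal + θ * (24 / 25 * lowerEnvelope s) ≤ 101 * lowerEnvelope s := by
      nlinarith
    have h10 := mul_le_mul_of_nonneg_left h9 hη0.le
    have h11 : 0 ≤ θ * lowerEnvelope s := by positivity
    have h12 : η * lowerEnvelope s = θ * lowerEnvelope s / 1000000 := by rw [hη]; ring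
    linarith
  · intro s hs M hM
    have h1 := hupper s hs M hM
    have h2 : 0 ≤ θ * upperEnvelope s := mul_nonneg hθ.le (hup s (by linarith))
    linarith
  · intro s hs hs3 M hM
    have h1 := hupper 3 le_rfl M (by linarith)
    rw [show (3 : ℝ) - 1 = 2 by norm_num] at h1
    have h2 : (3 : ℝ) * (1 + (T₁ 3).toReal) = s * (1 + (T₁ s).toReal) := by
      have e1 := congr_arg ENNReal.toReal (he1 s hs)
      have e3 := congr_arg ENNReal.toReal (he1 3 (by norm_num))
      have hne : ∫⁻ u in Ioi (3 - 1), T₀ u ≠ ⊤ := by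
        intro h
        have h3 := he1 3 (by norm_num)
        rw [max_self, h] at h3
        exact ENNReal.mul_ne_top (by simp) (ht1 3 (by norm_num)) (h3.trans (by simp))
      rw [max_eq_right hs3, ENNReal.toReal_mul, ENNReal.toReal_ofReal (by linarith),
        ENNReal.toReal_add (by simp) hne, ENNReal.toReal_ofReal (by linarith)] at e1
      rw [max_self, ENNReal.toReal_mul, ENNReal.toReal_ofReal (by linarith),
        ENNReal.toReal_add (by simp) hne, ENNReal.toReal_ofReal (by linarith)] at e3
      linarith
    have h3 : (3 : ℝ) * upperEnvelope 3 = s * upperEnvelope s := by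
      rw [upperEnvelope_of_le hs3, upperEnvelope_of_le le_rfl]
      field_simp
    have h4 : upperEnvelope 3 = 47 / 200 := by rw [upperEnvelope_of_le le_rfl]; norm_num
    have h5 := hr1 3 (by norm_num)
    rw [h4] at h1 h5
    set A := η * ((T₀ 2).toReal + θ * lowerEnvelope 2) + (1 + η) / 3 *
      ∫ u in (2 : ℝ)..M, ((T₀ u).toReal + θ * lowerEnvelope u) with hA
    have h6 : (1 + η) * (1 + A) ≤ 1 + (T₁ 3).toReal + θ * upperEnvelope 3 := by
      rw [h4]
      have h7 : 1 + A ≤ 102 := by nlinarith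
      have h8 := mul_le_mul_of_nonneg_left h7 hη0.le
      linarith
    calc (1 + η) * (3 / s) * (1 + A) = 3 / s * ((1 + η) * (1 + A)) := by ring
      _ ≤ 3 / s * (1 + (T₁ 3).toReal + θ * upperEnvelope 3) := by gcongr
      _ = (3 * (1 + (T₁ 3).toReal) + θ * (3 * upperEnvelope 3)) / s := by ring
      _ = 1 + ((T₁ s).toReal + θ * upperEnvelope s) := by
        rw [h2, h3]
        field_simp
        ring
  · have h1 : (2 + ε) * (T₀ (2 + ε)).toReal ≤ 2 := by
      have h2 : ENNReal.ofReal (2 + ε) * T₀ (2 + ε) ≤ 2 := by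
        rw [he0 _ (by linarith), ← htot]
        exact lintegral_mono_set (Ioi_subset_Ioi (by linarith))
      have h3 := ENNReal.toReal_mono (by simp) h2
      rwa [ENNReal.toReal_mul, ENNReal.toReal_ofReal (by linarith), ENNReal.toReal_ofNat] at h3
    have h2 : (T₀ (2 + ε)).toReal ≤ 2 / (2 + ε) := by
      rw [le_div_iff₀ (by linarith)]
      linarith
    have h3 := lowerEnvelope_le_one (s := 2 + ε) (by linarith)
    nlinarith

end SieveMajorant

section Density

theorem exp_neg_le_one_sub_two_div {p : ℕ} (hp : 4 ≤ p) :
    Real.exp (-(2 / (p : ℝ) + 8 * ((p : ℝ) ^ 2)⁻¹)) ≤ 1 - 2 / (p : ℝ) := by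
  have h4 : (4 : ℝ) ≤ p := by exact_mod_cast hp
  have hp0 : (0 : ℝ) < p := by linarith
  have hpos : (0 : ℝ) < 1 - 2 / (p : ℝ) := by
    rw [sub_pos, div_lt_one hp0]; linarith
  rw [← Real.le_log_iff_exp_le hpos]
  refine le_trans ?_ (Real.one_sub_inv_le_log_of_pos hpos)
  have h1 : 1 - (1 - 2 / (p : ℝ))⁻¹ = -(2 / ((p : ℝ) - 2)) := by
    have h2 : (p : ℝ) - 2 ≠ 0 := by linarith
    have h3 : 1 - 2 / (p : ℝ) = (p - 2) / p := by field_simp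
    rw [h3, inv_div]
    field_simp
    ring
  rw [h1, neg_le_neg_iff, div_le_iff₀ (by linarith)]
  field_simp
  nlinarith

/-- A Mertens type upper bound for a set of primes makes it a sieving set of dimension one, as soon
as the small primes are dropped. -/
theorem exists_hasLinearDensity {S : Set ℕ} {K : ℝ} (hK : 0 ≤ K)
    (hM : ∀ P : Finset ℕ, (∀ p ∈ P, p ∈ S) → ∀ u x : ℝ, 1 ≤ u → u ≤ x →
      (∀ p ∈ P, u ≤ p ∧ (p : ℝ) ≤ x) →
      ∑ p ∈ P, 2 / (p : ℝ) * Real.log p ≤ Real.log x - Real.log u + K)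
    {η : ℝ} (hη : 0 < η) :
    ∃ w : ℕ, 4 ≤ w ∧ ∀ P : Finset ℕ, (∀ p ∈ P, p ∈ S ∧ w ≤ p) → HasLinearDensity η P := by
  have hlim : Filter.Tendsto (fun w : ℕ => K / Real.log w + 16 / (w : ℝ)) Filter.atTop
      (nhds (0 + 0)) :=
    ((Real.tendsto_log_atTop.comp tendsto_natCast_atTop_atTop).const_div_atTop K).add
      (tendsto_natCast_atTop_atTop.const_div_atTop 16)
  rw [add_zero] at hlim
  obtain ⟨w, hw, hw4⟩ := ((hlim.eventually_lt_const (Real.log_pos (show 1 < 1 + η by linarith))).and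
    (Filter.eventually_ge_atTop 4)).exists
  refine ⟨w, hw4, fun P hP u v hu huv => ?_⟩
  have hw4' : (4 : ℝ) ≤ w := by exact_mod_cast hw4
  have hlu := Real.log_pos hu
  have hluv := Real.log_le_log (by linarith) huv
  have hlw : 0 < Real.log w := Real.log_pos (by linarith)
  have hpos := sieveDensity_pos (P := P) (fun p hp => by have := (hP p hp).2; omega) v
  set Q := P.filter (fun p : ℕ => (p : ℝ) < v ∧ u ≤ p) with hQ
  have hfac : sieveDensity P v = sieveDensity P u * ∏ p ∈ Q, (1 - 2 / (p : ℝ)) := by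
    rw [sieveDensity, sieveDensity,
      ← Finset.prod_filter_mul_prod_filter_not _ (fun p : ℕ => (p : ℝ) < u),
      Finset.filter_filter, Finset.filter_filter]
    congr 1
    · refine Finset.prod_congr (Finset.filter_congr fun p _ => ?_) fun _ _ => rfl
      exact ⟨fun h => h.2, fun h => ⟨h.trans_le huv, h⟩⟩
    · refine Finset.prod_congr (Finset.filter_congr fun p _ => ?_) fun _ _ => rfl
      rw [not_lt]
  have hposu := sieveDensity_pos (P := P) (fun p hp => by have := (hP p hp).2; omega) u
  rcases lt_or_ge v w with hvw | hvw
  · have hQe : Q = ∅ := by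
      refine Finset.filter_eq_empty_iff.2 fun p hp h => ?_
      have : (w : ℝ) ≤ p := by exact_mod_cast (hP p hp).2
      linarith [h.1]
    rw [hQe, Finset.prod_empty, mul_one] at hfac
    rw [hfac]
    have h1 : 1 ≤ Real.log v / Real.log u := by rwa [le_div_iff₀ hlu, one_mul]
    exact le_mul_of_one_le_left hposu.le (by nlinarith)
  set u' : ℝ := max u w with hu'
  have huu' : u ≤ u' := le_max_left _ _
  have hwu' : (w : ℝ) ≤ u' := le_max_right _ _
  have hu'v : u' ≤ v := max_le huv hvw
  have hlu' : Real.log u ≤ Real.log u' := Real.log_le_log (by linarith) huu'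
  have hlwu' : Real.log w ≤ Real.log u' := Real.log_le_log (by linarith) hwu'
  have hlu'0 : 0 < Real.log u' := by linarith
  have hlu'v : Real.log u' ≤ Real.log v := Real.log_le_log (by linarith) hu'v
  have hQmem : ∀ p ∈ Q, p ∈ S ∧ w ≤ p ∧ u' ≤ p ∧ (p : ℝ) < v := by
    intro p hp
    obtain ⟨h1, h2, h3⟩ := Finset.mem_filter.1 hp
    exact ⟨(hP p h1).1, (hP p h1).2, max_le h3 (by exact_mod_cast (hP p h1).2), h2⟩
  have hlogp : ∀ p ∈ Q, Real.log u' ≤ Real.log p := fun p hp =>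
    Real.log_le_log (by linarith) (hQmem p hp).2.2.1
  have hsum : ∑ p ∈ Q, 2 / (p : ℝ) ≤ K / Real.log u' + Real.log (Real.log v / Real.log u') := by
    have key := sum_mul_le_of_partialSum_le Q (fun p : ℕ => Real.log p)
      (fun p : ℕ => 2 / (p : ℝ) * Real.log p) (s := Real.log u') (η := K) (c := 1)
      (h := fun t => t⁻¹) (M := Real.log v)
      (fun p hp => mul_nonneg (by positivity) (hlu'0.le.trans (hlogp p hp))) hK zero_le_one
      (fun a ha b hb hab => inv_anti₀ (hlu'0.trans_le ha) hab)
      (fun t ht => inv_nonneg.2 (hlu'0.le.trans ht)) ?_ hlogp hlu'v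
      (fun p hp => Real.log_le_log (by linarith [(hQmem p hp).2.2.1]) (hQmem p hp).2.2.2.le)
    · rw [integral_inv_of_pos hlu'0 (hlu'0.trans_le hlu'v), one_mul, ← div_eq_mul_inv] at key
      refine le_trans (le_of_eq (Finset.sum_congr rfl fun p hp => ?_)) key
      have := hlogp p hp
      rw [mul_assoc, mul_inv_cancel₀ (by linarith), mul_one]
    · intro i hi
      have h := hM (Q.filter fun j : ℕ => Real.log j ≤ Real.log i)
        (fun p hp => (hQmem p (Finset.mem_filter.1 hp).1).1) u' i (by linarith)
        (hQmem i hi).2.2.1 (fun p hp => ?_)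
      · linarith
      · obtain ⟨h1, h2⟩ := Finset.mem_filter.1 hp
        have h3 := (hQmem p h1).2.2.1
        have h4 := (hQmem i hi).2.2.1
        exact ⟨h3, (Real.log_le_log_iff (by linarith) (by linarith)).1 h2⟩
  have hsq : ∑ p ∈ Q, ((p : ℝ) ^ 2)⁻¹ ≤ 2 / (w : ℝ) := by
    have h1 : Q ⊆ Finset.Ioo (w - 1) (⌈v⌉₊) := fun p hp => by
      obtain ⟨_, h2, _, h3⟩ := hQmem p hp
      rw [Finset.mem_Ioo]
      exact ⟨by omega, Nat.lt_ceil.2 h3⟩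
    refine (Finset.sum_le_sum_of_subset_of_nonneg h1 fun _ _ _ => by positivity).trans ?_
    refine (sum_Ioo_inv_sq_le _ _).trans (le_of_eq ?_)
    rw [Nat.cast_sub (by omega)]
    norm_num
  have hprod : Real.exp (-(∑ p ∈ Q, 2 / (p : ℝ) + 8 * ∑ p ∈ Q, ((p : ℝ) ^ 2)⁻¹))
      ≤ ∏ p ∈ Q, (1 - 2 / (p : ℝ)) := by
    rw [Finset.mul_sum, ← Finset.sum_add_distrib, ← Finset.sum_neg_distrib, Real.exp_sum]
    exact Finset.prod_le_prod (fun _ _ => (Real.exp_pos _).le) fun p hp =>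
      exp_neg_le_one_sub_two_div (hw4.trans (hQmem p hp).2.1)
  have hexp : Real.exp (∑ p ∈ Q, 2 / (p : ℝ) + 8 * ∑ p ∈ Q, ((p : ℝ) ^ 2)⁻¹)
      ≤ (1 + η) * (Real.log v / Real.log u) := by
    have h1 : K / Real.log u' ≤ K / Real.log w := by gcongr
    have h2 : 8 * (2 / (w : ℝ)) = 16 / w := by ring
    have hvv : 0 < Real.log v / Real.log u' := div_pos (by linarith) hlu'0
    calc _ ≤ Real.exp (Real.log (1 + η) + Real.log (Real.log v / Real.log u')) :=
          Real.exp_le_exp.2 (by linarith)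
      _ = (1 + η) * (Real.log v / Real.log u') := by
          rw [Real.exp_add, Real.exp_log (by linarith), Real.exp_log hvv]
      _ ≤ _ := by
          have : 0 ≤ Real.log v := by linarith
          gcongr
  rw [hfac]
  have h3 : 1 ≤ (1 + η) * (Real.log v / Real.log u) * ∏ p ∈ Q, (1 - 2 / (p : ℝ)) := by
    refine le_trans (le_of_eq ?_) (mul_le_mul hexp hprod (Real.exp_pos _).le
      ((Real.exp_pos _).le.trans hexp))
    rw [← Real.exp_add, add_neg_cancel, Real.exp_zero]
  calc sieveDensity P u = sieveDensity P u * 1 := (mul_one _).symm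
    _ ≤ sieveDensity P u * ((1 + η) * (Real.log v / Real.log u) * ∏ p ∈ Q, (1 - 2 / (p : ℝ))) :=
        mul_le_mul_of_nonneg_left h3 hposu.le
    _ = _ := by ring

end Density

section Mertens

open ArithmeticFunction

theorem sum_vonMangoldt_Ioc_le (N : ℕ) :
    ∑ n ∈ Finset.Ioc 0 N, vonMangoldt n ≤ (Real.log 4 + 4) * N := by
  have := Chebyshev.psi_le_const_mul_self (x := N) N.cast_nonneg
  rwa [Chebyshev.psi, Nat.floor_natCast] at this

theorem sum_vonMangoldt_mul_natDiv (N : ℕ) :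
    ∑ n ∈ Finset.Ioc 0 N, vonMangoldt n * ((N / n : ℕ) : ℝ) = Real.log N.factorial := by
  rw [← sum_Ioc_mul_zeta_eq_sum, vonMangoldt_mul_zeta]
  induction N with
  | zero => simp
  | succ N ih =>
    rw [← Finset.insert_Ioc_right_eq_Ioc_add_one (by omega), Finset.sum_insert (by simp), ih,
      Nat.factorial_succ, Nat.cast_mul, Real.log_mul (by positivity) (by positivity)]
    rfl

/-- Mertens' first theorem, upper bound. -/
theorem sum_vonMangoldt_div_le {N : ℕ} (hN : N ≠ 0) :
    ∑ n ∈ Finset.Ioc 0 N, vonMangoldt n / n ≤ Real.log N + (Real.log 4 + 4) := by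
  have hN' : (0 : ℝ) < N := by positivity
  have h1 : ∑ n ∈ Finset.Ioc 0 N, (vonMangoldt n / n * N - vonMangoldt n) ≤
      ∑ n ∈ Finset.Ioc 0 N, vonMangoldt n * ((N / n : ℕ) : ℝ) := by
    refine Finset.sum_le_sum fun n hn => ?_
    have hn0 : (0 : ℝ) < n := by exact_mod_cast (Finset.mem_Ioc.1 hn).1
    have h2 : (N : ℝ) / n - 1 ≤ ((N / n : ℕ) : ℝ) := by
      rw [← Nat.floor_div_eq_div (K := ℝ)]
      exact (Nat.sub_one_lt_floor _).le
    have := mul_le_mul_of_nonneg_left h2 (vonMangoldt_nonneg (n := n))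
    rw [div_mul_eq_mul_div, mul_div_assoc]
    linarith
  have h3 : Real.log N.factorial ≤ N * Real.log N := by
    rw [← Real.log_pow]
    exact Real.log_le_log (by positivity) (by exact_mod_cast Nat.factorial_le_pow N)
  rw [Finset.sum_sub_distrib, ← Finset.sum_mul, sum_vonMangoldt_mul_natDiv] at h1
  have h4 := sum_vonMangoldt_Ioc_le N
  refine le_of_mul_le_mul_right ?_ hN'
  linarith

/-- Mertens' first theorem, lower bound. -/
theorem log_sub_one_le_sum_vonMangoldt_div (N : ℕ) :
    Real.log N - 1 ≤ ∑ n ∈ Finset.Ioc 0 N, vonMangoldt n / n := by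
  rcases eq_or_ne N 0 with rfl | hN
  · simp
  have hN' : (0 : ℝ) < N := by positivity
  have h1 : ∑ n ∈ Finset.Ioc 0 N, vonMangoldt n * ((N / n : ℕ) : ℝ) ≤
      ∑ n ∈ Finset.Ioc 0 N, vonMangoldt n / n * N := by
    refine Finset.sum_le_sum fun n _ => ?_
    rw [div_mul_eq_mul_div, mul_div_assoc]
    exact mul_le_mul_of_nonneg_left Nat.cast_div_le vonMangoldt_nonneg
  rw [← Finset.sum_mul, sum_vonMangoldt_mul_natDiv] at h1
  have h2 := Stirling.le_log_factorial_stirling hN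
  have h3 : 0 ≤ Real.log N := Real.log_natCast_nonneg N
  have h4 : 0 ≤ Real.log (2 * Real.pi) := Real.log_nonneg (by linarith [Real.pi_gt_three])
  refine le_of_mul_le_mul_right ?_ hN'
  linarith

theorem norm_sum_mul_le_of_antitone {a : ℕ → ℂ} {B : ℝ}
    (ha : ∀ n, ‖∑ i ∈ Finset.range n, a i‖ ≤ B) {b : ℕ → ℝ} (hb : Antitone b)
    (hb0 : ∀ n, 0 ≤ b n) (n : ℕ) : ‖∑ i ∈ Finset.range n, a i * b i‖ ≤ B * b 0 := by
  have h1 : ∑ i ∈ Finset.range n, a i * b i = (∑ i ∈ Finset.range n, a i) * b n +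
      ∑ j ∈ Finset.range n, (∑ i ∈ Finset.range (j + 1), a i) * ((b j - b (j + 1) : ℝ) : ℂ) := by
    induction n with
    | zero => simp
    | succ n ih =>
      rw [Finset.sum_range_succ, ih, Finset.sum_range_succ _ n, Finset.sum_range_succ _ n,
        Finset.sum_range_succ a n]
      push_cast
      ring
  rw [h1]
  have h2 : B * b 0 = B * b n + ∑ j ∈ Finset.range n, B * (b j - b (j + 1)) := by
    rw [← Finset.mul_sum, Finset.sum_range_sub']
    ring
  rw [h2]
  refine (norm_add_le _ _).trans (add_le_add ?_ ((norm_sum_le _ _).trans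
    (Finset.sum_le_sum fun j _ => ?_)))
  · rw [norm_mul, Complex.norm_real, Real.norm_of_nonneg (hb0 n)]
    exact mul_le_mul_of_nonneg_right (ha n) (hb0 n)
  · have := hb (Nat.le_succ j)
    rw [norm_mul, Complex.norm_real, Real.norm_of_nonneg (by simpa using this)]
    exact mul_le_mul_of_nonneg_right (ha _) (by simpa using this)

theorem sum_character_log_div_eq {q : ℕ} (χ : DirichletCharacter ℂ q) (N : ℕ) :
    ∑ n ∈ Finset.Ioc 0 N, χ n * ((Real.log n / n : ℝ) : ℂ) =
      ∑ d ∈ Finset.Ioc 0 N, χ d * ((vonMangoldt d / d : ℝ) : ℂ) *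
        ∑ m ∈ Finset.Ioc 0 (N / d), χ m * ((1 / m : ℝ) : ℂ) := by
  let f : ArithmeticFunction ℂ := ⟨fun n => χ n * ((vonMangoldt n / n : ℝ) : ℂ), by simp⟩
  let g : ArithmeticFunction ℂ := ⟨fun n => χ n * ((1 / n : ℝ) : ℂ), by simp⟩
  change _ = ∑ d ∈ Finset.Ioc 0 N, f d * ∑ m ∈ Finset.Ioc 0 (N / d), g m
  rw [← sum_Ioc_mul_eq_sum_sum]
  refine Finset.sum_congr rfl fun n hn => ?_
  have hn0 : n ≠ 0 := by have := (Finset.mem_Ioc.1 hn).1; omega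
  have h1 : ∀ x ∈ n.divisorsAntidiagonal, f x.1 * g x.2 =
      χ n * ((vonMangoldt x.1 / n : ℝ) : ℂ) := by
    intro x hx
    have hx' := (Nat.mem_divisorsAntidiagonal.1 hx).1
    change χ x.1 * ((vonMangoldt x.1 / x.1 : ℝ) : ℂ) * (χ x.2 * ((1 / x.2 : ℝ) : ℂ)) = _
    rw [← hx']
    push_cast
    rw [map_mul]
    ring
  rw [mul_apply, Finset.sum_congr rfl h1, ← Finset.mul_sum, ← vonMangoldt_sum,
    Nat.sum_divisorsAntidiagonal (fun i _ => ((vonMangoldt i / n : ℝ) : ℂ)), Finset.sum_div]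
  push_cast
  rfl

variable {q : ℕ} [NeZero q] {χ : DirichletCharacter ℂ q}

theorem norm_sum_range_character_le (hχ : χ ≠ 1) (n : ℕ) :
    ‖∑ i ∈ Finset.range n, χ i‖ ≤ q := by
  have hq : ∑ i ∈ Finset.range q, χ i = 0 := by
    rw [← MulChar.sum_eq_zero_of_ne_one hχ]
    refine Finset.sum_bij (fun i _ => (i : ZMod q)) (by simp) (fun i hi j hj h => ?_)
      (fun a _ => ⟨a.val, by simpa using ZMod.val_lt a, by simp⟩) (fun _ _ => rfl)
    rw [ZMod.natCast_eq_natCast_iff, Nat.ModEq, Nat.mod_eq_of_lt (Finset.mem_range.1 hi),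
      Nat.mod_eq_of_lt (Finset.mem_range.1 hj)] at h
    exact h
  induction n using Nat.strong_induction_on with
  | _ n ih =>
    rcases lt_or_ge n q with h | h
    · refine (norm_sum_le _ _).trans ((Finset.sum_le_sum (g := fun _ => (1 : ℝ)) fun (i : ℕ) _ =>
        DirichletCharacter.norm_le_one χ (i : ZMod q)).trans ?_)
      simpa using h.le
    · obtain ⟨m, rfl⟩ := Nat.exists_eq_add_of_le h
      rw [Finset.sum_range_add, hq, zero_add]
      simpa using ih m (by have := NeZero.pos q; omega)

theorem norm_sum_Ioc_character_mul_le (hχ : χ ≠ 1) {b : ℕ → ℝ} {M : ℕ}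
    (hb : AntitoneOn b (Set.Ioi M)) (hb0 : ∀ n, 0 ≤ b n) (N : ℕ) :
    ‖∑ n ∈ Finset.Ioc M N, χ n * b n‖ ≤ 2 * q * b (M + 1) := by
  have h1 : ∀ n, ‖∑ i ∈ Finset.range n, χ ((M + 1 + i : ℕ) : ZMod q)‖ ≤ 2 * q := by
    intro n
    have h2 := Finset.sum_range_add (fun i : ℕ => χ (i : ZMod q)) (M + 1) n
    rw [← sub_eq_iff_eq_add'] at h2
    rw [← h2]
    refine (norm_sub_le _ _).trans ?_
    linarith [norm_sum_range_character_le hχ (M + 1 + n), norm_sum_range_character_le hχ (M + 1)]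
  have h3 : ∑ n ∈ Finset.Ioc M N, χ n * b n =
      ∑ i ∈ Finset.range (N - M), χ ((M + 1 + i : ℕ) : ZMod q) * b (M + 1 + i) := by
    rw [← Finset.Ico_add_one_add_one_eq_Ioc, Finset.sum_Ico_eq_sum_range]
    congr 2
    omega
  rw [h3]
  exact norm_sum_mul_le_of_antitone (b := fun i => b (M + 1 + i)) h1
    (fun i j hij => hb (Set.mem_Ioi.2 (by omega)) (Set.mem_Ioi.2 (by omega)) (by omega))
    (fun _ => hb0 _) _

theorem norm_LFunction_one_sub_sum_le (hχ : χ ≠ 1) (N : ℕ) :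
    ‖DirichletCharacter.LFunction χ 1 - ∑ n ∈ Finset.Ioc 0 N, χ n * ((1 / n : ℝ) : ℂ)‖ ≤
      2 * q * (1 / ((N : ℝ) + 1)) := by
  have hs : ∀ s : ℝ, 1 < s → ‖DirichletCharacter.LFunction χ s -
      ∑ n ∈ Finset.Ioc 0 N, χ n * (((n : ℝ) ^ (-s) : ℝ) : ℂ)‖ ≤
      2 * q * ((N : ℝ) + 1) ^ (-s) := by
    intro s hs
    have hsum := (DirichletCharacter.LSeriesSummable_of_one_lt_re χ (s := s) (by simpa)).hasSum
    rw [← LSeries, ← DirichletCharacter.LFunction_eq_LSeries χ (by simpa)] at hsum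
    have hterm : ∀ M : ℕ, ∑ n ∈ Finset.range (M + 1), LSeries.term (fun n => χ n) s n =
        ∑ n ∈ Finset.Ioc 0 M, χ n * (((n : ℝ) ^ (-s) : ℝ) : ℂ) := by
      intro M
      rw [Finset.sum_range_succ', LSeries.term_zero, add_zero,
        ← Finset.Ico_add_one_add_one_eq_Ioc, Finset.sum_Ico_eq_sum_range]
      refine Finset.sum_congr (by simp) fun i _ => ?_
      rw [LSeries.term_of_ne_zero (by omega), div_eq_mul_inv, ← Complex.cpow_neg,
        Complex.ofReal_cpow (by positivity), add_comm i]
      push_cast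
      rfl
    have hlim := (Filter.tendsto_add_atTop_iff_nat 1).2 hsum.tendsto_sum_nat
    simp only [hterm] at hlim
    refine le_of_tendsto ((hlim.sub_const _).norm) ?_
    filter_upwards [Filter.eventually_ge_atTop N] with M hM
    rw [← Finset.sum_Ioc_consecutive _ (Nat.zero_le N) hM, add_sub_cancel_left]
    have := norm_sum_Ioc_character_mul_le hχ (b := fun n => (n : ℝ) ^ (-s)) (M := N) ?_
      (fun n => by positivity) M
    · simpa using this
    · intro i hi j _ hij
      have hi' : 0 < i := (Nat.zero_le N).trans_lt hi
      exact Real.rpow_le_rpow_of_nonpos (by exact_mod_cast hi') (by exact_mod_cast hij)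
        (by linarith)
  have hL : Filter.Tendsto (fun s : ℝ => DirichletCharacter.LFunction χ s) (nhdsWithin 1 (Set.Ioi 1))
      (nhds (DirichletCharacter.LFunction χ 1)) := by
    have := ((DirichletCharacter.differentiable_LFunction hχ).continuous.comp
      Complex.continuous_ofReal).tendsto 1
    simpa [Function.comp_def] using this.mono_left nhdsWithin_le_nhds
  have hpow : ∀ a : ℝ, 0 < a → Filter.Tendsto (fun s : ℝ => a ^ (-s)) (nhdsWithin 1 (Set.Ioi 1))
      (nhds (1 / a)) := by
    intro a ha
    have : Continuous fun s : ℝ => a ^ (-s) := by fun_prop (disch := positivity)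
    simpa [Real.rpow_neg_one] using (this.tendsto 1).mono_left nhdsWithin_le_nhds
  have hsum : Filter.Tendsto (fun s : ℝ => ∑ n ∈ Finset.Ioc 0 N, χ n * (((n : ℝ) ^ (-s) : ℝ) : ℂ))
      (nhdsWithin 1 (Set.Ioi 1)) (nhds (∑ n ∈ Finset.Ioc 0 N, χ n * ((1 / n : ℝ) : ℂ))) :=
    tendsto_finsetSum _ fun n hn => ((Complex.continuous_ofReal.tendsto _).comp
      (hpow n (by exact_mod_cast (Finset.mem_Ioc.1 hn).1))).const_mul _
  refine le_of_tendsto_of_tendsto (hL.sub hsum).norm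
    ((hpow ((N : ℝ) + 1) (by positivity)).const_mul _) ?_
  filter_upwards [self_mem_nhdsWithin] with s h using hs s h

theorem exists_norm_sum_character_log_div_le (hχ : χ ≠ 1) :
    ∃ K : ℝ, ∀ N : ℕ, ‖∑ n ∈ Finset.Ioc 0 N, χ n * ((Real.log n / n : ℝ) : ℂ)‖ ≤ K := by
  refine ⟨∑ n ∈ Finset.Ioc (0 : ℕ) 2, ‖χ n * ((Real.log n / n : ℝ) : ℂ)‖ +
    2 * q * (Real.log ((2 + 1 : ℕ) : ℝ) / ((2 + 1 : ℕ) : ℝ)), fun N => ?_⟩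
  have h0 : 0 ≤ 2 * q * (Real.log ((2 + 1 : ℕ) : ℝ) / ((2 + 1 : ℕ) : ℝ)) := by positivity
  rcases le_or_gt N 2 with hN | hN
  · refine (norm_sum_le _ _).trans ?_
    have := Finset.sum_le_sum_of_subset_of_nonneg (Finset.Ioc_subset_Ioc_right (a := 0) hN)
      (f := fun n : ℕ => ‖χ n * ((Real.log n / n : ℝ) : ℂ)‖) fun _ _ _ => norm_nonneg _
    linarith
  · rw [← Finset.sum_Ioc_consecutive _ (Nat.zero_le 2) hN.le]
    refine (norm_add_le _ _).trans (add_le_add (norm_sum_le _ _)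
      (norm_sum_Ioc_character_mul_le hχ (b := fun n => Real.log n / n) (M := 2) ?_
        (fun n => by positivity) N))
    intro i hi j hj hij
    have he : ∀ n : ℕ, 2 < n → (n : ℝ) ∈ {x : ℝ | Real.exp 1 ≤ x} := fun n hn => by
      have : (3 : ℝ) ≤ n := by exact_mod_cast Nat.succ_le_of_lt hn
      exact (Real.exp_one_lt_d9.le.trans (by norm_num)).trans this
    exact Real.log_div_self_antitoneOn (he i hi) (he j hj) (by exact_mod_cast hij)

/-- Mertens' theorem for a nontrivial Dirichlet character. -/
theorem exists_norm_sum_character_vonMangoldt_div_le (hχ : χ ≠ 1) :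
    ∃ K : ℝ, ∀ N : ℕ, ‖∑ n ∈ Finset.Ioc 0 N, χ n * ((vonMangoldt n / n : ℝ) : ℂ)‖ ≤ K := by
  obtain ⟨K, hK⟩ := exists_norm_sum_character_log_div_le hχ
  set L := DirichletCharacter.LFunction χ 1 with hL
  have hL0 : 0 < ‖L‖ := norm_pos_iff.2 (DirichletCharacter.LFunction_apply_one_ne_zero hχ)
  refine ⟨(K + 2 * q * (Real.log 4 + 4)) / ‖L‖, fun N => ?_⟩
  rw [le_div_iff₀ hL0, ← norm_mul]
  rcases Nat.eq_zero_or_pos N with rfl | hN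
  · have := (norm_nonneg _).trans (hK 0)
    simp only [Finset.Ioc_self, Finset.sum_empty, zero_mul, norm_zero]
    positivity
  have hN' : (0 : ℝ) < N := by exact_mod_cast hN
  have h1 : (∑ n ∈ Finset.Ioc 0 N, χ n * ((vonMangoldt n / n : ℝ) : ℂ)) * L =
      ∑ n ∈ Finset.Ioc 0 N, χ n * ((Real.log n / n : ℝ) : ℂ) +
      ∑ d ∈ Finset.Ioc 0 N, χ d * ((vonMangoldt d / d : ℝ) : ℂ) *
        (L - ∑ m ∈ Finset.Ioc 0 (N / d), χ m * ((1 / m : ℝ) : ℂ)) := by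
    rw [sum_character_log_div_eq χ, ← Finset.sum_add_distrib, Finset.sum_mul]
    exact Finset.sum_congr rfl fun _ _ => by ring
  rw [h1]
  refine (norm_add_le _ _).trans (add_le_add (hK N) ((norm_sum_le _ _).trans ?_))
  have h2 : ∀ d ∈ Finset.Ioc 0 N, ‖χ d * ((vonMangoldt d / d : ℝ) : ℂ) *
      (L - ∑ m ∈ Finset.Ioc 0 (N / d), χ m * ((1 / m : ℝ) : ℂ))‖ ≤
      2 * q / N * vonMangoldt d := by
    intro d hd
    have hd0 : (0 : ℝ) < d := by exact_mod_cast (Finset.mem_Ioc.1 hd).1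
    have hΛ := vonMangoldt_nonneg (n := d)
    have h3 : 1 / (((N / d : ℕ) : ℝ) + 1) ≤ d / N := by
      rw [← one_div_div (N : ℝ) d]
      refine one_div_le_one_div_of_le (by positivity) ?_
      rw [← Nat.floor_div_eq_div (K := ℝ)]
      exact (Nat.lt_floor_add_one _).le
    rw [norm_mul, norm_mul, Complex.norm_real, Real.norm_of_nonneg (div_nonneg hΛ hd0.le)]
    calc ‖χ d‖ * (vonMangoldt d / d) *
          ‖L - ∑ m ∈ Finset.Ioc 0 (N / d), χ m * ((1 / m : ℝ) : ℂ)‖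
        ≤ 1 * (vonMangoldt d / d) * (2 * q * (d / N)) := by
          gcongr
          · exact χ.norm_le_one d
          · exact (norm_LFunction_one_sub_sum_le hχ _).trans (by gcongr)
      _ = 2 * q / N * vonMangoldt d := by field_simp
  refine (Finset.sum_le_sum h2).trans ?_
  rw [← Finset.mul_sum]
  calc 2 * q / N * ∑ n ∈ Finset.Ioc 0 N, vonMangoldt n
      ≤ 2 * q / N * ((Real.log 4 + 4) * N) := by
        gcongr
        exact sum_vonMangoldt_Ioc_le N
    _ = _ := by field_simp

theorem exists_sum_two_div_mul_log_le (hχ : χ ≠ 1) {S : Set ℕ}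
    (hS : ∀ p ∈ S, p.Prime ∧ χ p = 1) :
    ∃ K : ℝ, 0 ≤ K ∧ ∀ P : Finset ℕ, (∀ p ∈ P, p ∈ S) → ∀ u x : ℝ, 1 ≤ u → u ≤ x →
      (∀ p ∈ P, u ≤ p ∧ (p : ℝ) ≤ x) →
      ∑ p ∈ P, 2 / (p : ℝ) * Real.log p ≤ Real.log x - Real.log u + K := by
  obtain ⟨K, hK⟩ := exists_norm_sum_character_vonMangoldt_div_le hχ
  have hK0 : 0 ≤ K := (norm_nonneg _).trans (hK 0)
  have hl2 : 0 < Real.log 2 := Real.log_pos one_lt_two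
  have hl4 : 0 < Real.log 4 := Real.log_pos (by norm_num)
  refine ⟨Real.log 4 + 4 + 1 + Real.log 2 + 2 * K, by positivity,
    fun P hP u x hu hux hPux => ?_⟩
  set A := ⌈u⌉₊ - 1 with hA
  set B := ⌊x⌋₊ with hB
  have hceil : 1 ≤ ⌈u⌉₊ := Nat.one_le_ceil_iff.2 (by linarith)
  have hB1 : 1 ≤ B := Nat.le_floor (by simpa using hu.trans hux)
  have hAB : A ≤ B := by
    have := (Nat.ceil_le_floor_add_one u).trans (Nat.succ_le_succ (Nat.floor_le_floor hux))
    omega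
  have hsub : P ⊆ Finset.Ioc A B := fun p hp => by
    have h1 := Nat.ceil_le.2 (hPux p hp).1
    have h2 := Nat.le_floor (hPux p hp).2
    rw [Finset.mem_Ioc]
    omega
  have hlogB : Real.log B ≤ Real.log x :=
    Real.log_le_log (by exact_mod_cast hB1) (Nat.floor_le (by linarith))
  have hlogA : Real.log u ≤ Real.log A + Real.log 2 := by
    have huA : u ≤ A + 1 := by
      have := Nat.le_ceil u
      rw [hA, Nat.cast_sub hceil]
      push_cast
      linarith
    rcases Nat.eq_zero_or_pos A with h0 | h0
    · rw [h0, Nat.cast_zero] at huA ⊢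
      rw [Real.log_zero, zero_add]
      have := Real.log_le_log (by linarith) (show u ≤ 2 by linarith)
      exact this
    · have h0' : (1 : ℝ) ≤ A := by exact_mod_cast h0
      rw [← Real.log_mul (by positivity) two_ne_zero]
      exact Real.log_le_log (by linarith) (by linarith)
  have hre : ∀ N : ℕ, |∑ n ∈ Finset.Ioc 0 N, (χ n).re * (vonMangoldt n / n)| ≤ K := by
    intro N
    refine le_trans ?_ (hK N)
    refine le_trans (le_of_eq ?_) (Complex.abs_re_le_norm _)
    rw [Complex.re_sum]
    congr 1
    exact Finset.sum_congr rfl fun n _ => (Complex.re_mul_ofReal _ _).symm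
  have hnn : ∀ n : ℕ, 0 ≤ (1 + (χ n).re) * (vonMangoldt n / n) := fun n => by
    have h1 := (abs_le.1 ((Complex.abs_re_le_norm (χ n)).trans (χ.norm_le_one n))).1
    exact mul_nonneg (by linarith) (div_nonneg vonMangoldt_nonneg n.cast_nonneg)
  have hsplit : ∀ f : ℕ → ℝ, ∑ n ∈ Finset.Ioc A B, f n =
      ∑ n ∈ Finset.Ioc 0 B, f n - ∑ n ∈ Finset.Ioc 0 A, f n := fun f => by
    rw [← Finset.sum_Ioc_consecutive f (Nat.zero_le A) hAB, add_sub_cancel_left]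
  calc ∑ p ∈ P, 2 / (p : ℝ) * Real.log p
      = ∑ p ∈ P, (1 + (χ p).re) * (vonMangoldt p / p) := by
        refine Finset.sum_congr rfl fun p hp => ?_
        rw [(hS p (hP p hp)).2, vonMangoldt_apply_prime (hS p (hP p hp)).1, Complex.one_re]
        ring
    _ ≤ ∑ n ∈ Finset.Ioc A B, (1 + (χ n).re) * (vonMangoldt n / n) :=
        Finset.sum_le_sum_of_subset_of_nonneg hsub fun n _ _ => hnn n
    _ = (∑ n ∈ Finset.Ioc 0 B, vonMangoldt n / n - ∑ n ∈ Finset.Ioc 0 A, vonMangoldt n / n) +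
        (∑ n ∈ Finset.Ioc 0 B, (χ n).re * (vonMangoldt n / n) -
          ∑ n ∈ Finset.Ioc 0 A, (χ n).re * (vonMangoldt n / n)) := by
        rw [← hsplit, ← hsplit, ← Finset.sum_add_distrib]
        exact Finset.sum_congr rfl fun _ _ => by ring
    _ ≤ _ := by
        have h1 := sum_vonMangoldt_div_le (N := B) (by omega)
        have h2 := log_sub_one_le_sum_vonMangoldt_div A
        have h3 := (abs_le.1 (hre B)).2
        have h4 := (abs_le.1 (hre A)).1
        linarith

end Mertens

section Kronecker

open NumberTheorySymbols

theorem exists_odd_jacobiSym_eq_neg_one {d : ℤ} (hd : Squarefree d) (hd1 : d ≠ 1) :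
    ∃ n : ℕ, Odd n ∧ jacobiSym d n = -1 := by
  by_cases h : ∃ q : ℕ, q.Prime ∧ q ≠ 2 ∧ (q : ℤ) ∣ d
  · obtain ⟨q, hq, hq2, m, rfl⟩ := h
    have : Fact q.Prime := ⟨hq⟩
    have hqodd : Odd q := hq.odd_of_ne_two hq2
    have hqm : ¬ (q : ℤ) ∣ m := fun h => by
      have := hd q (mul_dvd_mul_left _ h)
      rw [Int.isUnit_iff_natAbs_eq, Int.natAbs_natCast] at this
      exact hq.one_lt.ne' this
    obtain ⟨a, ha⟩ := FiniteField.exists_nonsquare (F := ZMod q)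
      (by rwa [ZMod.ringChar_zmod_n])
    have hcop : Nat.Coprime q (4 * m.natAbs) := by
      refine (Nat.Prime.coprime_iff_not_dvd hq).2 fun h => ?_
      rcases hq.dvd_mul.1 h with h | h
      · exact hq2 ((Nat.prime_dvd_prime_iff_eq hq Nat.prime_two).1
          (hq.dvd_of_dvd_pow (show q ∣ 2 ^ 2 from h)))
      · exact hqm (Int.natCast_dvd.2 h)
    obtain ⟨n, hn1, hn2⟩ := Nat.chineseRemainder hcop a.val 1
    have hn4 : n % 4 = 1 := by
      have : n ≡ 1 [MOD 4] := hn2.of_mul_right _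
      exact this
    have hnodd : Odd n := Nat.odd_iff.2 (by omega)
    refine ⟨n, hnodd, ?_⟩
    have h1 : jacobiSym m n = 1 := by
      rw [jacobiSym.mod_right m hnodd, show n % (4 * m.natAbs) = 1 % (4 * m.natAbs) from hn2,
        ← jacobiSym.mod_right m odd_one, jacobiSym.one_right]
    have h2 : jacobiSym (q : ℤ) n = -1 := by
      rw [jacobiSym.quadratic_reciprocity_one_mod_four' hqodd hn4,
        ZMod.nonsquare_iff_jacobiSym_eq_neg_one, Int.cast_natCast,
        (ZMod.natCast_eq_natCast_iff _ _ _).2 hn1, ZMod.natCast_zmod_val]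
      exact ha
    rw [jacobiSym.mul_left, h1, h2, mul_one]
  · push Not at h
    have h2 : d.natAbs ∣ 2 := by
      have hsq : Squarefree d.natAbs := Int.squarefree_natAbs.2 hd
      rw [← Nat.prod_primeFactors_of_squarefree hsq]
      have hsub : d.natAbs.primeFactors ⊆ {2} := fun p hp => by
        rw [Nat.mem_primeFactors] at hp
        rw [Finset.mem_singleton]
        by_contra h2
        exact h p hp.1 h2 (Int.natCast_dvd.2 hp.2.1)
      simpa using Finset.prod_dvd_prod_of_subset _ _ (fun p : ℕ => p) hsub
    rcases (Nat.dvd_prime Nat.prime_two).1 h2 with h2 | h2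
    · obtain rfl : d = -1 := by omega
      exact ⟨3, by decide, by rw [jacobiSym.at_neg_one (by decide)]; decide⟩
    · rcases Int.natAbs_eq_iff.1 h2 with rfl | rfl
      · exact ⟨5, by decide, by
          rw [show ((2 : ℕ) : ℤ) = 2 from rfl, jacobiSym.at_two (by decide)]; decide⟩
      · exact ⟨5, by decide, by
          rw [show -((2 : ℕ) : ℤ) = -2 from rfl, jacobiSym.at_neg_two (by decide)]; decide⟩

/-- The Kronecker symbol of a squarefree integer as a Dirichlet character. -/
theorem exists_dirichletCharacter_eq_jacobiSym {d : ℤ} (hd : d ≠ 0) :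
    ∃ χ : DirichletCharacter ℂ (4 * d.natAbs), ∀ n : ℕ, Odd n → χ n = jacobiSym d n := by
  classical
  have hm : NeZero (4 * d.natAbs) := ⟨by positivity⟩
  set m := 4 * d.natAbs with hmdef
  let f : ℕ → ℤ := fun n => if Odd n then jacobiSym d n else 0
  have hodd : ∀ n, Odd (n % m) ↔ Odd n := fun n => by
    rw [Nat.odd_iff, Nat.odd_iff, Nat.mod_mod_of_dvd _ ⟨2 * d.natAbs, by rw [hmdef]; ring⟩]
  have hmod : ∀ n, f (n % m) = f n := fun n => by
    by_cases h : Odd n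
    · simp only [f, hodd, h, if_true]
      exact (jacobiSym.mod_right d h).symm
    · simp only [f, hodd, h, if_false]
  have hmul : ∀ a b, f (a * b) = f a * f b := fun a b => by
    by_cases ha : Odd a
    · by_cases hb : Odd b
      · simp only [f, ha, hb, ha.mul hb, if_true]
        exact jacobiSym.mul_right' d ha.pos.ne' hb.pos.ne'
      · simp [f, ha, hb, Nat.odd_mul]
    · simp [f, ha, Nat.odd_mul]
  let χ : DirichletCharacter ℂ m :=
    { toFun := fun a => (f a.val : ℂ)
      map_one' := by
        have : (1 : ZMod m).val = 1 % m := by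
          rw [← Nat.cast_one, ZMod.val_natCast]
        rw [this, hmod]
        simp [f]
      map_mul' := fun a b => by
        rw [ZMod.val_mul, hmod, hmul, Int.cast_mul]
      map_nonunit' := fun a ha => by
        by_cases h : Odd a.val
        · simp only [f, h, if_true, Int.cast_eq_zero]
          rw [jacobiSym.eq_zero_iff]
          refine ⟨h.pos.ne', fun hg => ha ?_⟩
          rw [← ZMod.natCast_zmod_val a, ZMod.isUnit_iff_coprime]
          refine Nat.Coprime.mul_right ?_ (Nat.Coprime.symm hg)
          exact (Nat.coprime_two_right.2 h).pow_right 2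
        · simp [f, h] }
  refine ⟨χ, fun n hn => ?_⟩
  change (f (ZMod.val (n : ZMod m)) : ℂ) = _
  rw [ZMod.val_natCast, hmod]
  simp [f, hn]

/-- The odd primes modulo which a given nonsquare is a nonzero square are at most half of all primes,
in the sense of Mertens. -/
theorem exists_sum_two_div_mul_log_le_of_not_isSquare {d : ℤ} (hd : ¬ IsSquare d) :
    ∃ K : ℝ, 0 ≤ K ∧ ∀ P : Finset ℕ,
      (∀ p ∈ P, p ∈ {p : ℕ | p.Prime ∧ p ≠ 2 ∧ ¬ (p : ℤ) ∣ d ∧ IsSquare (d : ZMod p)}) →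
      ∀ u x : ℝ, 1 ≤ u → u ≤ x → (∀ p ∈ P, u ≤ p ∧ (p : ℝ) ≤ x) →
      ∑ p ∈ P, 2 / (p : ℝ) * Real.log p ≤ Real.log x - Real.log u + K := by
  have hd0 : d ≠ 0 := by rintro rfl; exact hd IsSquare.zero
  obtain ⟨a, b, hab, ha⟩ := Nat.sq_mul_squarefree d.natAbs
  set r : ℤ := d.sign * a with hr
  have hdr : d = b ^ 2 * r := by
    conv_lhs => rw [← Int.sign_mul_natAbs d, ← hab]
    rw [hr]
    push_cast
    ring
  have hrabs : r.natAbs = a := by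
    rw [hr, Int.natAbs_mul, Int.natAbs_sign_of_ne_zero hd0, one_mul, Int.natAbs_natCast]
  have hrsq : Squarefree r := Int.squarefree_natAbs.1 (hrabs ▸ ha)
  have hr1 : r ≠ 1 := fun h => hd ⟨b, by rw [hdr, h]; ring⟩
  have hr0 : r ≠ 0 := hrsq.ne_zero
  obtain ⟨χ, hχ⟩ := exists_dirichletCharacter_eq_jacobiSym hr0
  have : NeZero (4 * r.natAbs) := ⟨by positivity⟩
  have hχ1 : χ ≠ 1 := by
    rintro rfl
    obtain ⟨n, hn, hJ⟩ := exists_odd_jacobiSym_eq_neg_one hrsq hr1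
    have h := hχ n hn
    rw [hJ] at h
    by_cases hu : IsUnit (n : ZMod (4 * r.natAbs))
    · rw [MulChar.one_apply hu] at h
      norm_num at h
    · rw [MulChar.map_nonunit _ hu] at h
      norm_num at h
  refine exists_sum_two_div_mul_log_le hχ1 fun p hp => ⟨hp.1, ?_⟩
  obtain ⟨hp, hp2, hpd, hsq⟩ := hp
  have : Fact p.Prime := ⟨hp⟩
  have hd' : ((d : ℤ) : ZMod p) ≠ 0 := by rwa [Ne, ZMod.intCast_zmod_eq_zero_iff_dvd]
  have h1 := (legendreSym.eq_one_iff p hd').2 hsq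
  have hb : ((b : ℤ) : ZMod p) ≠ 0 := fun h => hd' (by
    rw [hdr, Int.cast_mul, Int.cast_pow, h]; ring)
  rw [hdr, legendreSym.mul, legendreSym.sq_one' p hb, one_mul,
    jacobiSym.legendreSym.to_jacobiSym] at h1
  rw [hχ p (hp.odd_of_ne_two hp2), h1, Int.cast_one]

end Kronecker

section QuadraticField

variable {K : Type*} [Field K] [NumberField K]

theorem exists_basis_one_of_finrank_eq_two (h : Module.finrank ℚ K = 2) :
    ∃ b : Module.Basis (Fin 2) ℤ (𝓞 K), b 0 = 1 := by
  let e := Module.finBasisOfFinrankEq ℤ (𝓞 K) ((RingOfIntegers.rank K).trans h)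
  have h1 : (1 : 𝓞 K) = e.repr 1 0 • e 0 + e.repr 1 1 • e 1 := by
    have := e.sum_repr 1
    rw [Fin.sum_univ_two] at this
    exact this.symm
  set x := e.repr 1 0 with hx
  set y := e.repr 1 1 with hy
  have hcop : IsCoprime x y := by
    rw [Int.isCoprime_iff_gcd_eq_one]
    obtain ⟨x', hx'⟩ := Int.gcd_dvd_left x y
    obtain ⟨y', hy'⟩ := Int.gcd_dvd_right x y
    set g := Int.gcd x y
    have h2 : (1 : 𝓞 K) = algebraMap ℤ (𝓞 K) g * (x' • e 0 + y' • e 1) := by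
      rw [← Algebra.smul_def, smul_add, smul_smul, smul_smul, ← hx', ← hy', ← h1]
    have h3 := congrArg (Algebra.norm ℤ) h2
    rw [map_one, map_mul, Algebra.norm_algebraMap, RingOfIntegers.rank, h] at h3
    have h4 : IsUnit ((g : ℤ) ^ 2) := IsUnit.of_mul_eq_one _ h3.symm
    have h5 := (isUnit_pow_iff two_ne_zero).1 h4
    rwa [Int.isUnit_iff_natAbs_eq, Int.natAbs_natCast] at h5
  obtain ⟨v, u, huv⟩ := hcop
  have hdet : e.det ![1, (-u) • e 0 + v • e 1] = 1 := by
    rw [Module.Basis.det_apply, Matrix.det_fin_two]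
    simp only [Module.Basis.toMatrix_apply, Matrix.cons_val_zero, Matrix.cons_val_one, map_add,
      map_smul, Module.Basis.repr_self, Finsupp.add_apply, Finsupp.smul_apply, ← hx, ← hy]
    simp
    linarith
  obtain ⟨hli, hsp⟩ := (Module.Basis.is_basis_iff_det e).2 (hdet ▸ isUnit_one)
  exact ⟨Module.Basis.mk hli hsp.ge, by simp⟩

/-- The ring of integers of a quadratic field is `ℤ[ω]` with `ω ^ 2 = s ω + m`, and the discriminant
is `s ^ 2 + 4 m`. -/
theorem exists_quadratic_generator (h : Module.finrank ℚ K = 2) :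
    ∃ (ω : 𝓞 K) (s m : ℤ), ω ^ 2 = s * ω + m ∧ discr K = s ^ 2 + 4 * m ∧
      (∀ x : 𝓞 K, ∃ a b : ℤ, x = a + b * ω) ∧ ∀ a b : ℤ, (a : 𝓞 K) + b * ω = 0 → a = 0 ∧ b = 0 := by
  obtain ⟨b, hb⟩ := exists_basis_one_of_finrank_eq_two h
  have hspan : ∀ x : 𝓞 K, x = b.repr x 0 + b.repr x 1 * b 1 := fun x => by
    have := b.sum_repr x
    rw [Fin.sum_univ_two, hb, zsmul_eq_mul, zsmul_eq_mul, mul_one] at this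
    exact this.symm
  have hrepr : ∀ x y : ℤ, b.repr ((x : 𝓞 K) + y * b 1) 0 = x ∧
      b.repr ((x : 𝓞 K) + y * b 1) 1 = y := fun x y => by
    have : (x : 𝓞 K) + y * b 1 = x • b 0 + y • b 1 := by
      rw [hb, zsmul_eq_mul, zsmul_eq_mul, mul_one]
    rw [this, map_add, map_smul, map_smul, b.repr_self, b.repr_self]
    constructor <;> simp
  have hω : b 1 ^ 2 = (b.repr (b 1 ^ 2) 1 : 𝓞 K) * b 1 + b.repr (b 1 ^ 2) 0 := by
    rw [add_comm]
    exact hspan _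
  generalize b.repr (b 1 ^ 2) 1 = s at hω
  generalize b.repr (b 1 ^ 2) 0 = m at hω
  refine ⟨b 1, s, m, hω, ?_, fun x => ⟨_, _, hspan x⟩, fun x y hxy => ?_⟩
  · have htr : ∀ x y : ℤ, Algebra.trace ℤ (𝓞 K) ((x : 𝓞 K) + y * b 1) = 2 * x + y * s := by
      intro x y
      rw [Algebra.trace_eq_matrix_trace b, Matrix.trace_fin_two, Algebra.leftMulMatrix_eq_repr_mul,
        Algebra.leftMulMatrix_eq_repr_mul, hb, mul_one, (hrepr x y).1]
      have : ((x : 𝓞 K) + y * b 1) * b 1 = ((y * m : ℤ) : 𝓞 K) + ((x + y * s : ℤ) : 𝓞 K) * b 1 := by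
        rw [add_mul, mul_assoc, ← pow_two, hω]
        push_cast
        ring
      rw [this, (hrepr _ _).2]
      ring
    rw [← discr_eq_discr K b, Algebra.discr_def, Matrix.det_fin_two]
    simp only [Algebra.traceMatrix_apply, Algebra.traceForm_apply, hb]
    have h1 := htr 1 0
    have h2 := htr 0 1
    have h3 := htr m s
    rw [← pow_two (b 1), hω, add_comm ((s : 𝓞 K) * b 1), h3]
    simp only [Int.cast_one, Int.cast_zero, zero_mul, add_zero, zero_add, one_mul, mul_one] at h1 h2 ⊢
    rw [h1, h2]
    ring
  · have := hrepr x y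
    rw [hxy] at this
    simp at this
    exact ⟨this.1.symm, this.2.symm⟩

theorem absNorm_eq_of_mul_eq_span (h : Module.finrank ℚ K = 2) {p : ℕ} (hp : p.Prime)
    {P Q : Ideal (𝓞 K)} (hP : P ≠ ⊤) (hQ : Q ≠ ⊤) (hPQ : Ideal.span {(p : 𝓞 K)} = P * Q) :
    Ideal.absNorm P = p ∧ Ideal.absNorm Q = p := by
  have h1 : Ideal.absNorm P * Ideal.absNorm Q = p ^ 2 := by
    rw [← map_mul, ← hPQ, Ideal.absNorm_span_singleton,
      show (p : 𝓞 K) = algebraMap ℤ (𝓞 K) p by simp, Algebra.norm_algebraMap,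
      RingOfIntegers.rank, h, Int.natAbs_pow, Int.natAbs_natCast]
  refine (Nat.Prime.mul_eq_prime_sq_iff hp ?_ ?_).1 h1
  · rwa [Ne, Ideal.absNorm_eq_one_iff]
  · rwa [Ne, Ideal.absNorm_eq_one_iff]

theorem intCast_mem_iff_dvd_of_absNorm_eq {p : ℕ} (hp : p.Prime) {P : Ideal (𝓞 K)}
    (hP : Ideal.absNorm P = p) (a : ℤ) : (a : 𝓞 K) ∈ P ↔ (p : ℤ) ∣ a := by
  have hpP : (p : 𝓞 K) ∈ P := hP ▸ P.absNorm_mem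
  refine ⟨fun ha => ?_, ?_⟩
  · by_contra hpa
    have hcop : IsCoprime (p : ℤ) a := (Nat.prime_iff_prime_int.1 hp).coprime_iff_not_dvd.2 hpa
    obtain ⟨u, v, huv⟩ := hcop
    have h1 : (1 : 𝓞 K) ∈ P := by
      have : (1 : 𝓞 K) = u * p + v * a := by exact_mod_cast congrArg (Int.cast : ℤ → 𝓞 K) huv.symm
      rw [this]
      exact P.add_mem (P.mul_mem_left _ hpP) (P.mul_mem_left _ ha)
    rw [Ideal.absNorm_eq_one_iff.2 ((Ideal.eq_top_iff_one P).2 h1)] at hP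
    exact hp.one_lt.ne hP
  · rintro ⟨c, rfl⟩
    push_cast
    exact P.mul_mem_right _ hpP

theorem exists_sub_intCast_mem_of_absNorm_eq {p : ℕ} (hp : p.Prime) {P : Ideal (𝓞 K)}
    (hP : Ideal.absNorm P = p) (x : 𝓞 K) : ∃ a : ℤ, x - a ∈ P := by
  have : Fact p.Prime := ⟨hp⟩
  have hcard : Nat.card (𝓞 K ⧸ P) = p := by
    rw [← hP, Ideal.absNorm_apply, Submodule.cardQuot_apply]
  have : Finite (𝓞 K ⧸ P) := Nat.finite_of_card_ne_zero (hcard ▸ hp.ne_zero)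
  have hpP : (p : 𝓞 K) ∈ P := hP ▸ P.absNorm_mem
  have hinj : Function.Injective fun a : Fin p => ((a : ℕ) : 𝓞 K ⧸ P) := by
    intro a b hab
    have h1 : (((a : ℤ) - b : ℤ) : 𝓞 K) ∈ P := by
      rw [← Ideal.Quotient.eq_zero_iff_mem]
      push_cast
      rw [map_sub, map_natCast, map_natCast, sub_eq_zero]
      exact hab
    rw [intCast_mem_iff_dvd_of_absNorm_eq hp hP] at h1
    have h3 : (a : ℤ) ≡ b [ZMOD p] := ((Int.modEq_iff_dvd).2 h1).symm
    exact Fin.ext ((Int.natCast_modEq_iff.1 h3).eq_of_lt_of_lt a.2 b.2)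
  obtain ⟨y, hy⟩ := (hinj.bijective_of_nat_card_le (by rw [hcard, Nat.card_fin])).2
    (Ideal.Quotient.mk P x)
  refine ⟨((y : ℕ) : ℤ), Ideal.Quotient.eq.1 ?_⟩
  rw [← hy]
  simp

theorem not_isSquare_discr (h : Module.finrank ℚ K = 2) : ¬ IsSquare (discr K) := by
  rintro ⟨c, hc⟩
  obtain ⟨ω, s, m, hω, hdisc, -, hli⟩ := exists_quadratic_generator h
  have hcast : (c : 𝓞 K) * c = s ^ 2 + 4 * m := by exact_mod_cast hc.symm.trans hdisc
  have h1 : (((-s - c : ℤ) : 𝓞 K) + (2 : ℤ) * ω) * (((-s + c : ℤ) : 𝓞 K) + (2 : ℤ) * ω) = 0 := by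
    push_cast
    linear_combination 4 * hω - hcast
  rcases mul_eq_zero.1 h1 with h2 | h2 <;> exact absurd (hli _ _ h2).2 two_ne_zero

/-- An odd prime that splits in a quadratic field does not divide the discriminant, which is a
square modulo that prime. -/
theorem isSquare_discr_of_mul_eq_span (h : Module.finrank ℚ K = 2) {p : ℕ} (hp : p.Prime)
    (hp2 : p ≠ 2) {P Q : Ideal (𝓞 K)} (hne : P ≠ Q) (hP : P.IsPrime) (hQ : Q.IsPrime)
    (hPQ : Ideal.span {(p : 𝓞 K)} = P * Q) :
    ¬ (p : ℤ) ∣ discr K ∧ IsSquare (discr K : ZMod p) := by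
  obtain ⟨hPp, hQp⟩ := absNorm_eq_of_mul_eq_span h hp hP.ne_top hQ.ne_top hPQ
  obtain ⟨ω, s, m, hω, hdisc, hgen, hli⟩ := exists_quadratic_generator h
  have hδ : (2 * ω - s) ^ 2 = (discr K : 𝓞 K) := by
    rw [hdisc]
    push_cast
    linear_combination 4 * hω
  constructor
  · intro hdvd
    have hmem : ∀ I : Ideal (𝓞 K), I.IsPrime → Ideal.absNorm I = p → 2 * ω - s ∈ I := by
      intro I hI hIp
      refine hI.mem_of_pow_mem 2 ?_
      rw [hδ]
      exact (intCast_mem_iff_dvd_of_absNorm_eq hp hIp _).2 hdvd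
    have hbot : ∀ I : Ideal (𝓞 K), Ideal.absNorm I = p → I ≠ ⊥ := by
      rintro I hI rfl
      rw [Ideal.absNorm_bot] at hI
      exact hp.ne_zero hI.symm
    have hcop : IsCoprime P Q := Ideal.isCoprime_iff_sup_eq.2
      ((hP.isMaximal (hbot P hPp)).coprime_of_ne (hQ.isMaximal (hbot Q hQp)) hne)
    have h1 : 2 * ω - s ∈ Ideal.span {(p : 𝓞 K)} := by
      rw [hPQ, Ideal.mul_eq_inf_of_isCoprime hcop]
      exact ⟨hmem P hP hPp, hmem Q hQ hQp⟩
    obtain ⟨y, hy⟩ := Ideal.mem_span_singleton'.1 h1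
    obtain ⟨a, b, rfl⟩ := hgen y
    have h2 := (hli (a * p + s) (b * p - 2) (by push_cast; linear_combination hy)).2
    have h3 : (p : ℤ) ∣ 2 := ⟨b, by linarith⟩
    exact hp2 ((Nat.prime_dvd_prime_iff_eq hp Nat.prime_two).1 (by exact_mod_cast h3))
  · obtain ⟨a, ha⟩ := exists_sub_intCast_mem_of_absNorm_eq hp hPp ω
    have h1 : ((a ^ 2 - s * a - m : ℤ) : 𝓞 K) ∈ P := by
      have : ((a ^ 2 - s * a - m : ℤ) : 𝓞 K) = (s - ω - a) * (ω - a) := by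
        push_cast
        linear_combination hω
      rw [this]
      exact P.mul_mem_left _ ha
    rw [intCast_mem_iff_dvd_of_absNorm_eq hp hPp, ← ZMod.intCast_zmod_eq_zero_iff_dvd] at h1
    · refine ⟨2 * a - s, ?_⟩
      rw [hdisc]
      push_cast at h1 ⊢
      linear_combination -4 * h1

/-- An odd prime not dividing the discriminant of a quadratic field splits if the discriminant
is a square modulo it. -/
theorem exists_mul_eq_span_of_isSquare_discr (h : Module.finrank ℚ K = 2) {p : ℕ} (hp : p.Prime)
    (hp2 : p ≠ 2) (hd : ¬ (p : ℤ) ∣ discr K) (hsq : IsSquare (discr K : ZMod p)) :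
    ∃ P Q : Ideal (𝓞 K), P ≠ Q ∧ P.IsPrime ∧ Q.IsPrime ∧ Ideal.span {(p : 𝓞 K)} = P * Q := by
  obtain ⟨ω, s, m, hω, hdisc, hgen, hli⟩ := exists_quadratic_generator h
  have : Fact p.Prime := ⟨hp⟩
  obtain ⟨c', hc'⟩ := hsq
  obtain ⟨c, rfl⟩ := ZMod.intCast_surjective c'
  have h1 : (p : ℤ) ∣ discr K - c * c := by
    rw [← ZMod.intCast_zmod_eq_zero_iff_dvd]
    push_cast
    rw [hc', sub_self]
  obtain ⟨d, hdd⟩ := h1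
  have hpc : ¬ (p : ℤ) ∣ 2 * c := by
    intro hpc
    rcases (Nat.prime_iff_prime_int.1 hp).dvd_or_dvd hpc with h2 | h2
    · exact hp2 ((Nat.prime_dvd_prime_iff_eq hp Nat.prime_two).1 (by exact_mod_cast h2))
    · apply hd
      rw [show discr K = c * c + p * d by linarith]
      exact dvd_add (h2.mul_right _) (dvd_mul_right _ _)
  obtain ⟨u, v, huv⟩ := (Nat.prime_iff_prime_int.1 hp).coprime_iff_not_dvd.2 hpc
  have huv' : (u : 𝓞 K) * p + v * (2 * c) = 1 := by exact_mod_cast congrArg (Int.cast : ℤ → 𝓞 K) huv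
  set δ : 𝓞 K := 2 * ω - s with hδ'
  have hδ : δ ^ 2 = c * c + p * d := by
    have : (discr K : 𝓞 K) = c * c + p * d := by
      exact_mod_cast congrArg (Int.cast : ℤ → 𝓞 K) (show discr K = c * c + p * d by linarith)
    rw [← this, hdisc, hδ']
    push_cast
    linear_combination 4 * hω
  set P : Ideal (𝓞 K) := Ideal.span {(p : 𝓞 K), δ - c} with hPdef
  set Q : Ideal (𝓞 K) := Ideal.span {(p : 𝓞 K), δ + c} with hQdef
  have hpP : (p : 𝓞 K) ∈ P := Ideal.subset_span (by simp)
  have hpQ : (p : 𝓞 K) ∈ Q := Ideal.subset_span (by simp)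
  have hcP : δ - c ∈ P := Ideal.subset_span (by simp)
  have hcQ : δ + c ∈ Q := Ideal.subset_span (by simp)
  have hPQ : Ideal.span {(p : 𝓞 K)} = P * Q := by
    apply le_antisymm
    · rw [Ideal.span_singleton_le_iff_mem]
      have : (p : 𝓞 K) = u * (p * p) + v * (p * (δ + c) - (δ - c) * p) := by
        linear_combination -p * huv'
      rw [this]
      exact add_mem (Ideal.mul_mem_left _ _ (Ideal.mul_mem_mul hpP hpQ))
        (Ideal.mul_mem_left _ _ (sub_mem (Ideal.mul_mem_mul hpP hcQ) (Ideal.mul_mem_mul hcP hpQ)))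
    · rw [hPdef, hQdef, Ideal.span_pair_mul_span_pair, Ideal.span_le]
      rintro x (rfl | rfl | rfl | rfl)
      · exact Ideal.mem_span_singleton'.2 ⟨p, rfl⟩
      · exact Ideal.mem_span_singleton'.2 ⟨δ + c, by ring⟩
      · exact Ideal.mem_span_singleton'.2 ⟨δ - c, by ring⟩
      · exact Ideal.mem_span_singleton'.2 ⟨d, by linear_combination -hδ⟩
  have hnot : ∀ e : ℤ, δ + e ∉ Ideal.span {(p : 𝓞 K)} := by
    intro e he
    obtain ⟨y, hy⟩ := Ideal.mem_span_singleton'.1 he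
    obtain ⟨a, b, rfl⟩ := hgen y
    have h2 := (hli (a * p + s - e) (b * p - 2) (by push_cast; linear_combination hy)).2
    have h3 : (p : ℤ) ∣ 2 := ⟨b, by linarith⟩
    exact hp2 ((Nat.prime_dvd_prime_iff_eq hp Nat.prime_two).1 (by exact_mod_cast h3))
  have hPtop : P ≠ ⊤ := by
    intro hP
    rw [hP, Ideal.top_mul] at hPQ
    exact hnot c (hPQ ▸ hcQ)
  have hQtop : Q ≠ ⊤ := by
    intro hQ
    rw [hQ, Ideal.mul_top] at hPQ
    refine hnot (-c) (hPQ ▸ ?_)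
    rw [Int.cast_neg, ← sub_eq_add_neg]
    exact hcP
  obtain ⟨hPp, hQp⟩ := absNorm_eq_of_mul_eq_span h hp hPtop hQtop hPQ
  refine ⟨P, Q, fun hPQ' => ?_, Ideal.isPrime_of_irreducible_absNorm (by rwa [hPp]),
    Ideal.isPrime_of_irreducible_absNorm (by rwa [hQp]), hPQ⟩
  refine hPtop ((Ideal.eq_top_iff_one _).2 ?_)
  rw [show (1 : 𝓞 K) = u * p + v * ((δ + c) - (δ - c)) by linear_combination -huv']
  exact add_mem (Ideal.mul_mem_left _ _ hpP)
    (Ideal.mul_mem_left _ _ (sub_mem (hPQ' ▸ hcQ) hcP))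

end QuadraticField

/-- A nonzero integer is a square modulo infinitely many odd primes not dividing it. -/
theorem infinite_setOf_prime_isSquare {d : ℤ} (hd : d ≠ 0) :
    {p : ℕ | p.Prime ∧ p ≠ 2 ∧ ¬ (p : ℤ) ∣ d ∧ IsSquare (d : ZMod p)}.Infinite := by
  rw [Set.infinite_iff_exists_gt]
  intro N
  set y : ℤ := (((N + 2).factorial : ℕ) : ℤ) with hy
  have hy2 : 2 ≤ y := by
    rw [hy]
    exact_mod_cast (Nat.le_add_left 2 N).trans (Nat.self_le_factorial _)
  have h1 : (4 * d * y ^ 2 - 1).natAbs ≠ 1 := by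
    intro h1
    have h2 : |d| ≥ 1 := Int.one_le_abs hd
    rcases Int.natAbs_eq_iff.1 h1 with h3 | h3
    · have : (4 * d * y ^ 2) = 2 := by push_cast at h3; linarith
      have : (4 : ℤ) ∣ 2 := ⟨d * y ^ 2, by linarith⟩
      norm_num at this
    · have : d * y ^ 2 = 0 := by push_cast at h3; linarith
      rcases mul_eq_zero.1 this with h4 | h4
      · exact hd h4
      · have := pow_eq_zero_iff (two_ne_zero) |>.1 h4
        omega
  obtain ⟨p, hp, hpd⟩ := Nat.exists_prime_and_dvd h1
  have hpd' : (p : ℤ) ∣ 4 * d * y ^ 2 - 1 := Int.natCast_dvd.2 hpd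
  have hunit : ∀ e : ℤ, (p : ℤ) ∣ e → e ∣ 4 * d * y ^ 2 → False := by
    intro e h2 h3
    have := (dvd_sub_right (h2.trans h3)).1 hpd'
    exact (Nat.prime_iff_prime_int.1 hp).not_dvd_one this
  have : Fact p.Prime := ⟨hp⟩
  refine ⟨p, ⟨hp, ?_, fun h2 => hunit d h2 ⟨4 * y ^ 2, by ring⟩, ?_⟩, ?_⟩
  · rintro rfl
    exact hunit 2 (by norm_num) ⟨2 * d * y ^ 2, by ring⟩
  · have h2 : (4 * d * y ^ 2 - 1 : ZMod p) = 0 := by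
      have := (ZMod.intCast_zmod_eq_zero_iff_dvd _ p).2 hpd'
      push_cast at this
      exact this
    have h3 : (2 * y : ZMod p) ≠ 0 := by
      intro h3
      rw [show (4 * d * y ^ 2 - 1 : ZMod p) = d * (2 * y) ^ 2 - 1 by ring, h3] at h2
      simp at h2
    refine ⟨(2 * y : ZMod p)⁻¹, ?_⟩
    have h4 := inv_mul_cancel₀ h3
    set i := (2 * y : ZMod p)⁻¹
    linear_combination i ^ 2 * h2 - d * (i * (2 * y) + 1) * h4
  · by_contra! h2
    refine hunit y ?_ ⟨4 * d * y, by ring⟩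
    rw [hy]
    exact_mod_cast (hp.dvd_factorial).2 (h2.trans (Nat.le_add_right _ _))

section Residues

open Finset in
theorem abs_card_filter_modEq_sub_div_le (N : ℕ) {m : ℕ} (hm : 0 < m) (r : ℕ) :
    |(((range N).filter fun t => t ≡ r [MOD m]).card : ℝ) - N / m| ≤ 1 := by
  have hm' : (0 : ℝ) < m := Nat.cast_pos.2 hm
  have hcount : (((range N).filter fun t => t ≡ r [MOD m]).card : ℝ)
      = ((⌈((N : ℚ) - (r % m : ℕ)) / m⌉ : ℤ) : ℝ) := by
    rw [← Nat.count_eq_card_filter_range, ← Nat.count_modEq_card_eq_ceil N hm r]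
    simp
  have h1 := Int.le_ceil (((N : ℚ) - (r % m : ℕ)) / m)
  have h2 := Int.ceil_lt_add_one (((N : ℚ) - (r % m : ℕ)) / m)
  have h3 : ((N : ℝ) - (r % m : ℕ)) / m ≤ ((⌈((N : ℚ) - (r % m : ℕ)) / m⌉ : ℤ) : ℝ) := by
    exact_mod_cast (Rat.cast_le (K := ℝ)).2 h1
  have h4 : ((⌈((N : ℚ) - (r % m : ℕ)) / m⌉ : ℤ) : ℝ) < ((N : ℝ) - (r % m : ℕ)) / m + 1 := by
    exact_mod_cast (Rat.cast_lt (K := ℝ)).2 h2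
  have h5 : ((r % m : ℕ) : ℝ) / m ≤ 1 := by
    rw [div_le_one hm']
    exact_mod_cast (Nat.mod_lt r hm).le
  have h6 : (0 : ℝ) ≤ ((r % m : ℕ) : ℝ) / m := by positivity
  have h7 := sub_div (N : ℝ) ((r % m : ℕ) : ℝ) m
  rw [hcount, abs_le]
  constructor <;> linarith

open Classical Finset in
/-- Conditions excluding two residue classes modulo each of several primes: the number of solutions
in an interval of a progression agrees with its expected value up to `2` to the number of primes. -/
theorem abs_card_filter_two_classes_sub_le (N : ℕ) {bad : ℕ → ℕ → Prop} (B : Finset ℕ)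
    (hB : ∀ q ∈ B, q.Prime ∧ ∃ r s : ℕ, ¬ r ≡ s [MOD q] ∧
      ∀ t, bad q t ↔ t ≡ r [MOD q] ∨ t ≡ s [MOD q]) :
    ∀ m r : ℕ, 0 < m → (∀ q ∈ B, m.Coprime q) →
      |(((range N).filter fun t => t ≡ r [MOD m] ∧ ∀ q ∈ B, bad q t).card : ℝ)
        - N / m * ∏ q ∈ B, 2 / (q : ℝ)| ≤ 2 ^ B.card := by
  induction B using Finset.induction_on with
  | empty =>
    intro m r hm _
    simpa using abs_card_filter_modEq_sub_div_le N hm r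
  | insert q B hq ih =>
    intro m r hm hmB
    have ih := ih fun q' hq' => hB q' (mem_insert_of_mem hq')
    obtain ⟨hqp, r₁, r₂, hr, hbad⟩ := hB q (mem_insert_self _ _)
    have hmq := hmB q (mem_insert_self _ _)
    have hcop : ∀ q' ∈ B, (m * q).Coprime q' := fun q' hq' =>
      (hmB q' (mem_insert_of_mem hq')).mul_left ((Nat.coprime_primes hqp
        (hB q' (mem_insert_of_mem hq')).1).2 fun h => hq (h ▸ hq'))
    obtain ⟨u₁, hu₁, hu₁'⟩ := Nat.chineseRemainder hmq r r₁
    obtain ⟨u₂, hu₂, hu₂'⟩ := Nat.chineseRemainder hmq r r₂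
    have key : ∀ (u s : ℕ), u ≡ r [MOD m] → u ≡ s [MOD q] → ∀ t,
        t ≡ u [MOD m * q] ↔ t ≡ r [MOD m] ∧ t ≡ s [MOD q] := by
      intro u s h1 h2 t
      rw [← Nat.modEq_and_modEq_iff_modEq_mul hmq]
      exact and_congr ⟨fun h => h.trans h1, fun h => h.trans h1.symm⟩
        ⟨fun h => h.trans h2, fun h => h.trans h2.symm⟩
    have hsplit : ((range N).filter fun t => t ≡ r [MOD m] ∧ ∀ q' ∈ insert q B, bad q' t)
        = ((range N).filter fun t => t ≡ u₁ [MOD m * q] ∧ ∀ q' ∈ B, bad q' t) ∪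
          ((range N).filter fun t => t ≡ u₂ [MOD m * q] ∧ ∀ q' ∈ B, bad q' t) := by
      ext t
      simp only [mem_filter, mem_union, forall_mem_insert, hbad, key u₁ r₁ hu₁ hu₁',
        key u₂ r₂ hu₂ hu₂']
      tauto
    have hdisj : Disjoint
        ((range N).filter fun t => t ≡ u₁ [MOD m * q] ∧ ∀ q' ∈ B, bad q' t)
        ((range N).filter fun t => t ≡ u₂ [MOD m * q] ∧ ∀ q' ∈ B, bad q' t) := by
      rw [disjoint_left]
      intro t h1 h2
      simp only [mem_filter, key u₁ r₁ hu₁ hu₁', key u₂ r₂ hu₂ hu₂'] at h1 h2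
      exact hr (h1.2.1.2.symm.trans h2.2.1.2)
    have e₁ := ih (m * q) u₁ (Nat.mul_pos hm hqp.pos) hcop
    have e₂ := ih (m * q) u₂ (Nat.mul_pos hm hqp.pos) hcop
    rw [hsplit, card_union_of_disjoint hdisj, prod_insert hq, card_insert_of_notMem hq, pow_succ]
    push_cast at e₁ e₂ ⊢
    rw [show (N : ℝ) / m * (2 / q * ∏ q ∈ B, 2 / (q : ℝ))
      = 2 * (N / (m * q) * ∏ q ∈ B, 2 / (q : ℝ)) by field_simp]
    rw [abs_le] at e₁ e₂ ⊢
    constructor <;> linarith [e₁.1, e₁.2, e₂.1, e₂.2]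

/-- If `d` is a nonzero square modulo an odd prime `q`, then `(x₀ + m t) ^ 2 ≡ d` holds for `t` in
exactly two residue classes modulo `q`. -/
theorem exists_two_classes_of_isSquare {d : ℤ} {q : ℕ} (hq : q.Prime) (hq2 : q ≠ 2)
    (hd : ¬ (q : ℤ) ∣ d) (hsq : IsSquare (d : ZMod q)) {m : ℕ} (hm : m.Coprime q) (x₀ : ℕ) :
    ∃ r s : ℕ, ¬ r ≡ s [MOD q] ∧ ∀ t : ℕ, ((x₀ + m * t : ℕ) : ℤ) ^ 2 ≡ d [ZMOD q] ↔
      t ≡ r [MOD q] ∨ t ≡ s [MOD q] := by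
  have : Fact q.Prime := ⟨hq⟩
  obtain ⟨b, hb⟩ := hsq
  have hd0 : (d : ZMod q) ≠ 0 := by rwa [Ne, ZMod.intCast_zmod_eq_zero_iff_dvd]
  have hb0 : b ≠ 0 := by
    rintro rfl
    exact hd0 (by simpa using hb)
  have hm0 : (m : ZMod q) ≠ 0 := by
    rw [Ne, ZMod.natCast_eq_zero_iff, ← hq.coprime_iff_not_dvd]
    exact hm.symm
  have h20 : (2 : ZMod q) ≠ 0 := by
    have : ((2 : ℕ) : ZMod q) ≠ 0 := by
      rw [Ne, ZMod.natCast_eq_zero_iff, Nat.prime_dvd_prime_iff_eq hq Nat.prime_two]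
      exact hq2
    exact_mod_cast this
  refine ⟨((b - x₀) / m).val, ((-b - x₀) / m).val, ?_, fun t => ?_⟩
  · rw [← ZMod.natCast_eq_natCast_iff, ZMod.natCast_zmod_val, ZMod.natCast_zmod_val,
      div_left_inj' hm0]
    intro h
    have : 2 * b = 0 := by linear_combination h
    exact (mul_ne_zero h20 hb0) this
  · rw [← ZMod.natCast_eq_natCast_iff, ← ZMod.natCast_eq_natCast_iff, ZMod.natCast_zmod_val,
      ZMod.natCast_zmod_val, ← ZMod.intCast_eq_intCast_iff, eq_div_iff hm0, eq_div_iff hm0]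
    push_cast
    rw [hb, ← pow_two, sq_eq_sq_iff_eq_or_eq_neg]
    exact or_congr ⟨fun h => by linear_combination h, fun h => by linear_combination h⟩
      ⟨fun h => by linear_combination h, fun h => by linear_combination h⟩

theorem exists_sq_modEq_add_self {d : ℤ} {p : ℕ} (hp : p.Prime) (hp2 : p ≠ 2)
    (hd : ¬ (p : ℤ) ∣ d) (hsq : IsSquare (d : ZMod p)) :
    ∃ a : ℕ, (a : ℤ) ^ 2 ≡ d + p [ZMOD (p : ℤ) ^ 2] := by
  have : Fact p.Prime := ⟨hp⟩
  obtain ⟨b', hb'⟩ := hsq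
  obtain ⟨b, rfl⟩ := ZMod.natCast_zmod_surjective b'
  have h1 : (p : ℤ) ∣ b * b - d := by
    rw [← ZMod.intCast_zmod_eq_zero_iff_dvd]
    push_cast
    rw [hb', sub_self]
  obtain ⟨e, he⟩ := h1
  have hpc : ¬ (p : ℤ) ∣ 2 * b := by
    intro hpc
    rcases (Nat.prime_iff_prime_int.1 hp).dvd_or_dvd hpc with h2 | h2
    · exact hp2 ((Nat.prime_dvd_prime_iff_eq hp Nat.prime_two).1 (by exact_mod_cast h2))
    · apply hd
      rw [show d = b * b - p * e by linarith]
      exact dvd_sub (h2.mul_right _) (dvd_mul_right _ _)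
  obtain ⟨u, v, huv⟩ := (Nat.prime_iff_prime_int.1 hp).coprime_iff_not_dvd.2 hpc
  obtain ⟨k, hk⟩ : ∃ k : ℕ, (k : ℤ) ≡ v * (1 - e) [ZMOD p] :=
    ⟨((v * (1 - e)) % p).toNat, by
      rw [Int.toNat_of_nonneg (Int.emod_nonneg _ (by exact_mod_cast hp.ne_zero))]
      exact Int.mod_modEq _ _⟩
  obtain ⟨l, hl⟩ := hk.dvd
  refine ⟨b + p * k, (Int.modEq_iff_dvd.2 ⟨k ^ 2 - u * (1 - e) - 2 * b * l, ?_⟩).symm⟩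
  push_cast
  linear_combination he + p * (1 - e) * huv - 2 * b * p * hl

end Residues

section SieveResidues

open Filter

theorem eventually_mul_log_sq_lt_rpow (C : ℝ) {ε : ℝ} (hε : 0 < ε) :
    ∀ᶠ z : ℝ in atTop, C * Real.log z ^ 2 < z ^ ε := by
  have h1 := (isLittleO_log_rpow_atTop (half_pos hε)).tendsto_div_nhds_zero
  have h2 := (h1.pow 2).const_mul C
  rw [zero_pow two_ne_zero, mul_zero] at h2
  filter_upwards [h2.eventually (gt_mem_nhds zero_lt_one), eventually_gt_atTop 0] with z hz hz0
  have h3 : (z ^ (ε / 2)) ^ 2 = z ^ ε := by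
    rw [← Real.rpow_natCast, ← Real.rpow_mul hz0.le]
    norm_num
  rw [div_pow, h3, ← mul_div_assoc, div_lt_one (Real.rpow_pos_of_pos hz0 _)] at hz
  exact hz

theorem sieveDensity_mul_sieveWeight_le_one {P : Finset ℕ} (hP : ∀ p ∈ P, 3 ≤ p) (z : ℝ) :
    sieveDensity P z * sieveWeight P z ≤ 1 := by
  rw [sieveDensity, sieveWeight, ← Finset.prod_mul_distrib]
  refine Finset.prod_le_one (fun p hp => ?_) fun p hp => ?_
  all_goals
    have h3 : (3 : ℝ) ≤ p := by exact_mod_cast hP p (Finset.mem_filter.1 hp).1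
    have h4 : 2 / (p : ℝ) ≤ 1 := (div_le_one (by linarith)).2 (by linarith)
    have h5 : 0 ≤ 2 / (p : ℝ) := by positivity
    nlinarith

theorem HasLinearDensity.log_two_le {P : Finset ℕ} {η : ℝ} (hV : HasLinearDensity η P)
    (hP : ∀ p ∈ P, 3 ≤ p) {z : ℝ} (hz : 2 ≤ z) :
    Real.log 2 ≤ (1 + η) * Real.log z * sieveDensity P z := by
  have h1 : sieveDensity P 2 = 1 := by
    rw [sieveDensity, Finset.filter_false_of_mem, Finset.prod_empty]
    intro p hp
    have : (3 : ℝ) ≤ p := by exact_mod_cast hP p hp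
    linarith
  have h2 := hV 2 z one_lt_two hz
  have h3 : 0 < Real.log 2 := Real.log_pos one_lt_two
  rw [h1, show (1 + η) * (Real.log z / Real.log 2) * sieveDensity P z
    = ((1 + η) * Real.log z * sieveDensity P z) / Real.log 2 by ring, le_div_iff₀ h3, one_mul] at h2
  exact h2

open Classical in
/-- For sieving by two residue classes modulo primes of density `1/2`, an interval of length
`z ^ (2 + ε)` contains an unsifted element once the sieving level `z` is large. -/
theorem exists_siftedSet_nonempty {S : Set ℕ} (hS : ∀ p ∈ S, 3 ≤ p) {K : ℝ} (hK : 0 ≤ K)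
    (hM : ∀ P : Finset ℕ, (∀ p ∈ P, p ∈ S) → ∀ u x : ℝ, 1 ≤ u → u ≤ x →
      (∀ p ∈ P, u ≤ p ∧ (p : ℝ) ≤ x) →
      ∑ p ∈ P, 2 / (p : ℝ) * Real.log p ≤ Real.log x - Real.log u + K) {ε : ℝ} (hε : 0 < ε) :
    ∃ w : ℕ, ∀ P : Finset ℕ, (∀ p ∈ P, p ∈ S ∧ w ≤ p) → ∀ (N : ℕ) (bad : ℕ → ℕ → Prop),
      (∀ B ⊆ P, |(((Finset.range N).filter fun t => ∀ q ∈ B, bad q t).card : ℝ)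
        - N * ∏ q ∈ B, 2 / (q : ℝ)| ≤ 2 ^ B.card) →
      ∀ z : ℝ, w ≤ z → z ^ (2 + ε) ≤ N → (siftedSet N bad P ∅ z).Nonempty := by
  obtain ⟨η, hη, δ, hδ, U₁, U₀, hU, hU₀⟩ := exists_isLinearSieveMajorant (half_pos hε)
  obtain ⟨w₀, -, hw₀⟩ := exists_hasLinearDensity hK hM hη
  have hlog2 : 0 < Real.log 2 := Real.log_pos one_lt_two
  obtain ⟨Z, hZ⟩ := eventually_atTop.1
    (eventually_mul_log_sq_lt_rpow (((1 + η) / Real.log 2) ^ 2 / δ) (half_pos hε))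
  refine ⟨max 2 (max w₀ ⌈Z⌉₊), fun P hP N bad hcount z hz hN => ?_⟩
  simp only [max_le_iff, Nat.cast_max, Nat.cast_ofNat] at hP hz
  have hP3 : ∀ p ∈ P, 3 ≤ p := fun p hp => hS p (hP p hp).1
  have hV := hw₀ P fun p hp => ⟨(hP p hp).1, (hP p hp).2.2.1⟩
  have hz2 : 2 ≤ z := hz.1
  have hz0 : 0 < z := by linarith
  have hlogz : 0 < Real.log z := Real.log_pos (by linarith)
  set D := z ^ (2 + ε / 2) with hDdef
  have hD0 : 0 < D := Real.rpow_pos_of_pos hz0 _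
  have hD : z ^ 2 ≤ D := by
    rw [← Real.rpow_two]
    exact Real.rpow_le_rpow_of_exponent_le (by linarith) (by linarith)
  have hlogD : Real.log D / Real.log z = 2 + ε / 2 := by
    rw [hDdef, Real.log_rpow hz0, mul_div_assoc, div_self hlogz.ne', mul_one]
  have hsieve := linear_sieve_lower_bound hP3 hU hV hcount (by linarith) hD
  rw [hlogD] at hsieve
  have hVpos := sieveDensity_pos hP3 z
  have hWpos := sieveWeight_pos P z
  have hVW := sieveDensity_mul_sieveWeight_le_one hP3 z
  have hVlow := hV.log_two_le hP3 hz2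
  have hZz := hZ z ((Nat.le_ceil Z).trans hz.2.2)
  set V := sieveDensity P z
  set W := sieveWeight P z
  set L := Real.log z
  have hDN : z ^ (ε / 2) * D ≤ N := by
    rw [hDdef, ← Real.rpow_add hz0]
    convert hN using 2
    ring
  have h1 : 1 ≤ ((1 + η) / Real.log 2) ^ 2 * L ^ 2 * V ^ 2 := by
    rw [← mul_pow, ← mul_pow]
    refine one_le_pow₀ ?_
    rw [show (1 + η) / Real.log 2 * L * V = (1 + η) * L * V / Real.log 2 by ring,
      one_le_div hlog2]
    exact hVlow
  have h2 : 1 < δ * V ^ 2 * z ^ (ε / 2) := by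
    refine h1.trans_lt ?_
    have := mul_lt_mul_of_pos_left hZz (mul_pos hδ (pow_pos hVpos 2))
    refine lt_of_eq_of_lt ?_ this
    field_simp
  have h3 : D < N * δ * V ^ 2 := by
    calc D < δ * V ^ 2 * z ^ (ε / 2) * D := by nlinarith
      _ = δ * V ^ 2 * (z ^ (ε / 2) * D) := by ring
      _ ≤ δ * V ^ 2 * N := by gcongr
      _ = N * δ * V ^ 2 := by ring
  have h4 : 0 < N * (V * (1 - U₀ (2 + ε / 2))) - D * W := by
    have h5 : N * (V * δ) ≤ N * (V * (1 - U₀ (2 + ε / 2))) := by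
      gcongr
      linarith
    have h6 : D * W * V < N * (V * δ) * V := by nlinarith
    have h7 := lt_of_mul_lt_mul_right h6 hVpos.le
    linarith
  rw [← Finset.card_pos]
  exact_mod_cast h4.trans_le hsieve

/-- Given finitely many odd primes up to `M` modulo which `d` is a nonzero square, for each member
`p` there is a small `x` with `x ^ 2 ≡ d + p` modulo `p ^ 2` such that `x ^ 2 ≢ d` modulo all
other members. -/
theorem exists_sieve_residue_of_not_isSquare {d : ℤ} (hd : ¬ IsSquare d) {ε : ℝ} (hε : 0 < ε) :
    ∃ c : ℝ, 0 < c ∧ ∀ (T : Finset ℕ) (M : ℕ),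
      (∀ q ∈ T, (q.Prime ∧ q ≠ 2 ∧ ¬ (q : ℤ) ∣ d ∧ IsSquare (d : ZMod q)) ∧ q ≤ M) →
      ∀ p ∈ T, ∃ x : ℕ, (x : ℝ) ≤ c * (M : ℝ) ^ (4 + ε) ∧ (x : ℤ) ^ 2 ≡ d + p [ZMOD (p : ℤ) ^ 2] ∧
        ∀ q ∈ T, q ≠ p → ¬ (x : ℤ) ^ 2 ≡ d [ZMOD q] := by
  obtain ⟨K, hK, hM⟩ := exists_sum_two_div_mul_log_le_of_not_isSquare hd
  obtain ⟨w, hw⟩ := exists_siftedSet_nonempty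
    (fun p hp => by
      obtain ⟨h1, h2, -⟩ := hp
      have := h1.two_le
      omega) hK hM hε
  refine ⟨(w + 1) ^ w * (2 ^ (2 + ε) + 1), by positivity, fun T M hT p hp => ?_⟩
  obtain ⟨⟨hpp, hp2, hpd, hpsq⟩, hpM⟩ := hT p hp
  have hM1 : (1 : ℝ) ≤ M := by exact_mod_cast hpp.one_lt.le.trans hpM
  set Q := ∏ q ∈ T.filter (fun q => q ≠ p ∧ q < w), q with hQ
  have hcopQ : ∀ q : ℕ, q.Prime → (q ∈ T → q ≠ p → q < w → False) → q ∈ T → q ≠ p → Q.Coprime q :=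
    fun q hq hqw hqT hqp => Nat.Coprime.prod_left fun q' hq' => by
      obtain ⟨h1, h2, h3⟩ := Finset.mem_filter.1 hq'
      exact (Nat.coprime_primes (hT q' h1).1.1 hq).2 fun h => hqw hqT hqp (h ▸ h3)
  have hcopp : (p ^ 2).Coprime Q := Nat.Coprime.pow_left 2 <| Nat.Coprime.prod_right fun q hq => by
    obtain ⟨h1, h2, h3⟩ := Finset.mem_filter.1 hq
    exact (Nat.coprime_primes hpp (hT q h1).1.1).2 h2.symm
  have hQ0 : 0 < Q := Finset.prod_pos fun q hq => (hT q (Finset.mem_filter.1 hq).1).1.1.pos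
  have hQle : Q ≤ (w + 1) ^ w := by
    refine (Finset.prod_le_pow_card _ _ (w + 1) fun q hq => ?_).trans
      (Nat.pow_le_pow_right w.succ_pos ?_)
    · exact (Finset.mem_filter.1 hq).2.2.le.trans w.le_succ
    · refine (Finset.card_le_card fun q hq => ?_).trans (Finset.card_range w).le
      exact Finset.mem_range.2 (Finset.mem_filter.1 hq).2.2
  obtain ⟨a, ha⟩ := exists_sq_modEq_add_self hpp hp2 hpd hpsq
  obtain ⟨x₀, hx₀p, hx₀Q, hx₀⟩ : ∃ x₀ : ℕ, x₀ ≡ a [MOD p ^ 2] ∧ x₀ ≡ 0 [MOD Q] ∧ x₀ < p ^ 2 * Q :=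
    ⟨Nat.chineseRemainder hcopp a 0, (Nat.chineseRemainder hcopp a 0).2.1,
      (Nat.chineseRemainder hcopp a 0).2.2,
      Nat.chineseRemainder_lt_mul hcopp a 0 (pow_pos hpp.pos 2).ne' hQ0.ne'⟩
  obtain ⟨t, ht, htbad⟩ : ∃ t : ℕ, (t : ℝ) ≤ (2 * M) ^ (2 + ε) ∧
      ∀ q ∈ T.filter (fun q => q ≠ p ∧ w ≤ q),
        ¬ ((x₀ + p ^ 2 * Q * t : ℕ) : ℤ) ^ 2 ≡ d [ZMOD q] := by
    rcases (T.filter (fun q => q ≠ p ∧ w ≤ q)).eq_empty_or_nonempty with hempty | ⟨q, hq⟩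
    · exact ⟨0, by rw [Nat.cast_zero]; positivity, by simp [hempty]⟩
    have hwM : w ≤ M := (Finset.mem_filter.1 hq).2.2.trans (hT q (Finset.mem_filter.1 hq).1).2
    obtain ⟨bad, hbad⟩ : ∃ bad : ℕ → ℕ → Prop, ∀ q t, bad q t ↔
        ((x₀ + p ^ 2 * Q * t : ℕ) : ℤ) ^ 2 ≡ d [ZMOD q] := ⟨_, fun _ _ => Iff.rfl⟩
    obtain ⟨t, ht⟩ := hw (T.filter fun q => q ≠ p ∧ w ≤ q)
      (fun q hq => ⟨(hT q (Finset.mem_filter.1 hq).1).1, (Finset.mem_filter.1 hq).2.2⟩)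
      ⌈((M : ℝ) + 1) ^ (2 + ε)⌉₊ bad
      (fun B hB => by
        have := abs_card_filter_two_classes_sub_le ⌈((M : ℝ) + 1) ^ (2 + ε)⌉₊ (bad := bad) B
          (fun q hq => by
            obtain ⟨h1, h2, h3⟩ := Finset.mem_filter.1 (hB hq)
            obtain ⟨h4, h5, h6, h7⟩ := (hT q h1).1
            simp only [hbad]
            refine ⟨h4, exists_two_classes_of_isSquare h4 h5 h6 h7 (Nat.Coprime.mul_left ?_ ?_) x₀⟩
            · exact Nat.Coprime.pow_left 2 ((Nat.coprime_primes hpp h4).2 h2.symm)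
            · exact hcopQ q h4 (fun _ _ => h3.not_gt) h1 h2)
          1 0 one_pos (fun q _ => Nat.coprime_one_left q)
        rw [Nat.cast_one, div_one] at this
        convert this using 6
        simp [Nat.modEq_one])
      ((M : ℝ) + 1) (by exact_mod_cast hwM.trans M.le_succ) (Nat.le_ceil _)
    simp only [siftedSet, Finset.mem_filter, hbad] at ht
    obtain ⟨h1, -, h2⟩ := ht
    refine ⟨t, ?_, fun q hq => h2 q (Finset.mem_filter.1 hq) ?_⟩
    · refine (Nat.lt_ceil.1 (Finset.mem_range.1 h1)).le.trans ?_
      exact Real.rpow_le_rpow (by positivity) (by linarith) (by positivity)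
    · have : (q : ℝ) ≤ M := by exact_mod_cast (hT q (Finset.mem_filter.1 hq).1).2
      linarith
  refine ⟨x₀ + p ^ 2 * Q * t, ?_, ?_, fun q hq hqp => ?_⟩
  · have h1 : x₀ + p ^ 2 * Q * t ≤ p ^ 2 * Q * (t + 1) := by
      rw [mul_add, mul_one, add_comm]
      exact Nat.add_le_add_left hx₀.le _
    have h2 : ((p ^ 2 * Q * (t + 1) : ℕ) : ℝ) ≤ M ^ 2 * (w + 1) ^ w * ((2 * M) ^ (2 + ε) + 1) := by
      push_cast
      gcongr
      exact_mod_cast hQle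
    have h3 : (1 : ℝ) ≤ (M : ℝ) ^ (2 + ε) := Real.one_le_rpow hM1 (by positivity)
    calc ((x₀ + p ^ 2 * Q * t : ℕ) : ℝ) ≤ ((p ^ 2 * Q * (t + 1) : ℕ) : ℝ) := by exact_mod_cast h1
      _ ≤ M ^ 2 * (w + 1) ^ w * ((2 * M) ^ (2 + ε) + 1) := h2
      _ ≤ M ^ 2 * (w + 1) ^ w * (2 ^ (2 + ε) * M ^ (2 + ε) + M ^ (2 + ε)) := by
        rw [Real.mul_rpow zero_le_two (by positivity)]
        gcongr
      _ = (w + 1) ^ w * (2 ^ (2 + ε) + 1) * (M : ℝ) ^ (4 + ε) := by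
        rw [show 4 + ε = 2 + (2 + ε) by ring, Real.rpow_add (by linarith) 2 (2 + ε), Real.rpow_two]
        ring
  · refine Int.ModEq.trans ?_ ha
    refine Int.ModEq.pow 2 ?_
    have h1 : x₀ + p ^ 2 * Q * t ≡ a [MOD p ^ 2] := by
      rw [mul_assoc]
      exact (Nat.modEq_iff_dvd' (Nat.le_add_right _ _)).2 (by simp) |>.symm.trans hx₀p
    exact_mod_cast Int.natCast_modEq_iff.2 h1
  · by_cases hqw : q < w
    · intro h
      have hqQ : q ∣ Q := Finset.dvd_prod_of_mem (fun q => q) (Finset.mem_filter.2 ⟨hq, hqp, hqw⟩)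
      have h1 : q ∣ x₀ + p ^ 2 * Q * t := dvd_add
        (hqQ.trans (Nat.modEq_zero_iff_dvd.1 hx₀Q)) ((hqQ.mul_left _).mul_right _)
      apply (hT q hq).1.2.2.1
      rw [← Int.modEq_zero_iff_dvd]
      refine h.symm.trans (Int.modEq_zero_iff_dvd.2 ?_)
      exact dvd_pow (Int.natCast_dvd_natCast.2 h1) two_ne_zero
    · exact htbad q (Finset.mem_filter.2 ⟨hq, hqp, not_lt.1 hqw⟩)

end SieveResidues

/-- Let `k ⊂ ℂ` be an imaginary quadratic field of discriminant `Δ_k` and `ε > 0`.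
There is a constant `c > 0` such that for every `n ≥ 1`, writing
`p₁ < … < pₙ` for the first `n` odd rational primes split in `k`, for each `i` there is
a nonnegative integer `x_i ≤ c·pₙ^(4+ε)` with `x_i² ≡ Δ_k + p_i (mod p_i²)` and
`x_i² ≢ Δ_k (mod p_j)` for all `j ≠ i`. -/
theorem exists_sieve_residues
    (k : IntermediateField ℚ ℂ) [NumberField ↥k]
    (hquad : Module.finrank ℚ ↥k = 2)
    (himag : ¬ (k : Set ℂ) ⊆ Set.range (Complex.ofReal))
    (ε : ℝ) (hε : 0 < ε) :
    ∃ c : ℝ, 0 < c ∧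
      ∀ n : ℕ, 1 ≤ n →
        {q : ℕ | q.Prime ∧ q ≠ 2 ∧ RatPrimeSplitsIn k q}.Infinite ∧
        ∀ i : ℕ, i < n →
          -- `p j` denotes the `(j+1)`-st odd prime split in `k`
          (fun p : ℕ → ℕ =>
            ∃ x : ℕ,
              (x : ℝ) ≤ c * (p (n - 1) : ℝ) ^ ((4 : ℝ) + ε) ∧
              (x : ℤ) ^ 2 ≡ NumberField.discr ↥k + (p i : ℤ) [ZMOD ((p i : ℤ)) ^ 2] ∧
              ∀ j : ℕ, j < n → j ≠ i →
                ¬ ((x : ℤ) ^ 2 ≡ NumberField.discr ↥k [ZMOD (p j : ℤ)]))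
          (fun j => Nat.nth (fun q => q.Prime ∧ q ≠ 2 ∧ RatPrimeSplitsIn k q) j) := by
  set d := NumberField.discr ↥k with hd
  have hsplit : ∀ q : ℕ, (q.Prime ∧ q ≠ 2 ∧ RatPrimeSplitsIn k q) ↔
      (q.Prime ∧ q ≠ 2 ∧ ¬ (q : ℤ) ∣ d ∧ IsSquare (d : ZMod q)) := by
    intro q
    constructor
    · rintro ⟨hq, hq2, P, Q, hne, hP, hQ, hPQ⟩
      exact ⟨hq, hq2, isSquare_discr_of_mul_eq_span hquad hq hq2 hne hP hQ hPQ⟩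
    · rintro ⟨hq, hq2, hqd, hsq⟩
      exact ⟨hq, hq2, exists_mul_eq_span_of_isSquare_discr hquad hq hq2 hqd hsq⟩
  have hinf : {q : ℕ | q.Prime ∧ q ≠ 2 ∧ RatPrimeSplitsIn k q}.Infinite := by
    simp only [hsplit]
    exact infinite_setOf_prime_isSquare (NumberField.discr_ne_zero ↥k)
  obtain ⟨c, hc, hmain⟩ := exists_sieve_residue_of_not_isSquare (not_isSquare_discr hquad) hε
  refine ⟨c, hc, fun n hn => ⟨hinf, fun i hi => ?_⟩⟩
  have hmono := Nat.nth_strictMono hinf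
  obtain ⟨x, hx, hxi, hxj⟩ := hmain
    ((Finset.range n).image (Nat.nth fun q => q.Prime ∧ q ≠ 2 ∧ RatPrimeSplitsIn k q))
    (Nat.nth (fun q => q.Prime ∧ q ≠ 2 ∧ RatPrimeSplitsIn k q) (n - 1))
    (by
      simp only [Finset.mem_image, Finset.mem_range, forall_exists_index, and_imp]
      rintro q j hj rfl
      exact ⟨(hsplit _).1 (Nat.nth_mem_of_infinite hinf j), hmono.monotone (Nat.le_sub_one_of_lt hj)⟩)
    _ (Finset.mem_image_of_mem _ (Finset.mem_range.2 hi))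
  exact ⟨x, hx, hxi, fun j hj hji => hxj _ (Finset.mem_image_of_mem _ (Finset.mem_range.2 hj))
    (hmono.injective.ne hji)⟩
end

section
/- Let k = ℚ(√Δ) ⊂ ℂ be an imaginary quadratic field of discriminant Δ. Let p be an odd rational prime not dividing Δ, and let x be an integer such that p divides x² − Δ but p² does not divide x² − Δ. Then x + √Δ is not a square in k; consequently k(√(x + √Δ)) is a degree-2 extension of k. -/
open NumberField

/-- A quadratic number field inside `ℂ` that is not contained in `ℝ` has negative discriminant. -/
theorem discr_neg_of_quadratic_of_not_subset_real
    (k : IntermediateField ℚ ℂ) [NumberField ↥k]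
    (hquad : Module.finrank ℚ ↥k = 2)
    (himag : ¬ (k : Set ℂ) ⊆ Set.range (Complex.ofReal)) :
    NumberField.discr ↥k < 0 := by
  classical
  obtain ⟨z, hz, hzr⟩ := Set.not_subset.mp himag
  have hcomplex : (InfinitePlace.mk (algebraMap k ℂ)).IsComplex := by
    rw [InfinitePlace.isComplex_mk_iff]
    intro h
    have hconj := RingHom.congr_fun (ComplexEmbedding.isReal_iff.mp h) ⟨z, hz⟩
    obtain ⟨r, hr⟩ := Complex.conj_eq_iff_real.mp hconj
    exact hzr ⟨r, hr.symm⟩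
  have hpos : 0 < InfinitePlace.nrComplexPlaces k :=
    Fintype.card_pos_iff.mpr ⟨⟨_, hcomplex⟩⟩
  have hcard := InfinitePlace.card_add_two_mul_card_eq_rank k
  have hone : InfinitePlace.nrComplexPlaces k = 1 := by omega
  rw [← Int.sign_eq_neg_one_iff_neg, sign_discr, hone, pow_one]

/-- A complex square root of a negative integer is purely imaginary and nonzero. -/
theorem Complex.re_eq_zero_and_im_ne_zero_of_sq_eq_intCast {s : ℂ} {D : ℤ} (hD : D < 0)
    (hs : s ^ 2 = (D : ℂ)) : s.re = 0 ∧ s.im ≠ 0 := by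
  have hre := congrArg Complex.re hs
  have him := congrArg Complex.im hs
  simp only [pow_two, Complex.mul_re, Complex.mul_im, Complex.intCast_re,
    Complex.intCast_im] at hre him
  have hD' : (D : ℝ) < 0 := by exact_mod_cast hD
  have him0 : s.im ≠ 0 := by
    intro h
    rw [h] at hre
    nlinarith [mul_self_nonneg s.re]
  refine ⟨?_, him0⟩
  have : s.re * s.im = 0 := by linarith
  exact (mul_eq_zero.mp this).resolve_right him0

/-- In a two-dimensional field inside `ℂ`, every element is a rational combination of `1` and
any given non-real purely imaginary element. -/
theorem exists_rat_add_mul_of_finrank_eq_two (k : IntermediateField ℚ ℂ)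
    (hquad : Module.finrank ℚ ↥k = 2) {s : ℂ} (hsk : s ∈ k) (hre : s.re = 0) (him : s.im ≠ 0)
    {y : ℂ} (hy : y ∈ k) : ∃ a b : ℚ, y = a + b * s := by
  have hli : LinearIndependent ℚ ![(1 : k), ⟨s, hsk⟩] := by
    rw [LinearIndependent.pair_iff]
    intro a b h
    have h' : (a : ℂ) + b * s = 0 := by
      simpa [Algebra.smul_def] using congrArg (algebraMap k ℂ) h
    have h₁ := congrArg Complex.re h'
    have h₂ := congrArg Complex.im h'
    simp [hre, him] at h₁ h₂
    exact ⟨h₁, h₂⟩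
  have hspan := hli.span_eq_top_of_card_eq_finrank (by simp [hquad])
  have hmem : (⟨y, hy⟩ : k) ∈ Submodule.span ℚ (Set.range ![(1 : k), ⟨s, hsk⟩]) := by
    rw [hspan]; trivial
  rw [Matrix.range_cons, Matrix.range_cons, Matrix.range_empty, Set.union_empty,
    Set.singleton_union, Submodule.mem_span_pair] at hmem
  obtain ⟨a, b, hab⟩ := hmem
  refine ⟨a, b, ?_⟩
  simpa [Algebra.smul_def] using (congrArg (algebraMap k ℂ) hab).symm

/-- If a prime divides an integer that is the square of a rational, so does its square. -/
theorem Int.sq_dvd_of_rat_sq_eq {p n : ℤ} (hp : Prime p) {q : ℚ} (hq : q ^ 2 = n)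
    (hpn : p ∣ n) : p ^ 2 ∣ n := by
  obtain ⟨m, rfl⟩ : ∃ m : ℤ, algebraMap ℤ ℚ m = q :=
    IsIntegrallyClosed.exists_algebraMap_eq_of_isIntegral_pow (n := 2) two_pos
      (hq ▸ isIntegral_algebraMap (x := n))
  rw [eq_intCast] at hq
  obtain rfl : m ^ 2 = n := by exact_mod_cast hq
  exact pow_dvd_pow_of_dvd (hp.dvd_of_dvd_pow hpn) 2

/-- Adjoining a square root of a non-square gives an extension of degree two. -/
theorem IntermediateField.finrank_adjoin_simple_eq_two_of_sq_eq {K L : Type*} [Field K] [Field L]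
    [Algebra K L] {a : K} (ha : ∀ b : K, b ^ 2 ≠ a) {t : L} (ht : t ^ 2 = algebraMap K L a) :
    Module.finrank K (IntermediateField.adjoin K {t}) = 2 := by
  have hirr := X_pow_sub_C_irreducible_of_prime Nat.prime_two ha
  have hmonic : (Polynomial.X ^ 2 - Polynomial.C a).Monic :=
    Polynomial.monic_X_pow_sub_C a two_ne_zero
  have hroot : Polynomial.aeval t (Polynomial.X ^ 2 - Polynomial.C a) = 0 := by simp [ht]
  rw [IntermediateField.adjoin.finrank ⟨_, hmonic, hroot⟩,
    ← minpoly.eq_of_irreducible_of_monic hirr hroot hmonic, Polynomial.natDegree_X_pow_sub_C]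

/-- Let `k = ℚ(√Δ) ⊂ ℂ` be an imaginary quadratic field of discriminant `Δ`, `p` an odd
prime not dividing `Δ`, and `x` an integer with `p ∣ x² − Δ` but `p² ∤ x² − Δ`.  Then
`x + √Δ` is not a square in `k`; consequently `k(√(x + √Δ))` has degree `2` over `k`. -/
theorem not_square_and_adjoin_sqrt_quadratic
    (k : IntermediateField ℚ ℂ) [NumberField ↥k]
    (hquad : Module.finrank ℚ ↥k = 2)
    (himag : ¬ (k : Set ℂ) ⊆ Set.range (Complex.ofReal))
    (sΔ : ℂ) (hsΔk : sΔ ∈ k) (hsΔ : sΔ ^ 2 = (NumberField.discr ↥k : ℂ))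
    (p : ℕ) (hp : p.Prime) (hodd : p ≠ 2)
    (hpΔ : ¬ (p : ℤ) ∣ NumberField.discr ↥k)
    (x : ℤ)
    (hdvd : (p : ℤ) ∣ x ^ 2 - NumberField.discr ↥k)
    (hndvd : ¬ ((p : ℤ) ^ 2 ∣ x ^ 2 - NumberField.discr ↥k)) :
    (¬ ∃ y ∈ k, y ^ 2 = (x : ℂ) + sΔ) ∧
      ∀ t : ℂ, t ^ 2 = (x : ℂ) + sΔ →
        Module.finrank ↥k ↥(IntermediateField.adjoin ↥k {t}) = 2 := by
  have hneg := discr_neg_of_quadratic_of_not_subset_real k hquad himag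
  obtain ⟨hre, him⟩ := Complex.re_eq_zero_and_im_ne_zero_of_sq_eq_intCast hneg hsΔ
  have hns : ¬ ∃ y ∈ k, y ^ 2 = (x : ℂ) + sΔ := by
    rintro ⟨y, hyk, hy⟩
    obtain ⟨a, b, rfl⟩ := exists_rat_add_mul_of_finrank_eq_two k hquad hsΔk hre him hyk
    have hexp : ((a ^ 2 + b ^ 2 * NumberField.discr k - x : ℚ) : ℂ)
        + ((2 * a * b - 1 : ℚ) : ℂ) * sΔ = 0 := by
      push_cast
      linear_combination hy - (b : ℂ) ^ 2 * hsΔ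
    have him' : 2 * a * b - 1 = 0 := by
      have h := congrArg Complex.im hexp
      simp only [Complex.add_im, Complex.mul_im, Complex.ratCast_im, Complex.ratCast_re,
        Complex.zero_im, zero_mul, add_zero, zero_add] at h
      exact_mod_cast (mul_eq_zero.mp h).resolve_right him
    have hre' : a ^ 2 + b ^ 2 * NumberField.discr k - x = 0 := by
      rw [him', Rat.cast_zero, zero_mul, add_zero] at hexp
      exact_mod_cast hexp
    have hnorm : (a ^ 2 - b ^ 2 * NumberField.discr k) ^ 2
        = ((x ^ 2 - NumberField.discr k : ℤ) : ℚ) := by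
      push_cast
      linear_combination (a ^ 2 + b ^ 2 * NumberField.discr k + x) * hre'
        - (NumberField.discr k : ℚ) * (2 * a * b + 1) * him'
    exact hndvd (Int.sq_dvd_of_rat_sq_eq (Nat.prime_iff_prime_int.mp hp) hnorm hdvd)
  refine ⟨hns, fun t ht => ?_⟩
  refine IntermediateField.finrank_adjoin_simple_eq_two_of_sq_eq (a := (x : k) + ⟨sΔ, hsΔk⟩)
    (fun b hb => hns ⟨b, b.2, ?_⟩) ?_
  · simpa using congrArg (algebraMap k ℂ) hb
  · simpa using ht
end

section
/- Let k be a number field and let L₁, …, L_m be quadratic extensions of k inside a fixed algebraic closure of k. Suppose that for each i ∈ {1, …, m} there exists a nonzero prime ideal 𝔭_i of the ring of integers O_k that ramifies in the extension L_i/k but is unramified in L_j/k for every j ≠ i. Then the compositum L₁⋯L_m has degree 2^m over k. -/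
open NumberField

/-- A nonzero prime ideal `𝔭` of `O_K` *ramifies* in the extension `L/K` if some prime
ideal of `O_L` occurs in the factorization of `𝔭 O_L` with exponent at least `2`,
i.e. `𝔭 O_L ⊆ P²` for some nonzero prime `P` of `O_L`. -/
def RamifiesIn {K : Type*} [Field K] {Ω : Type*} [Field Ω] [Algebra K Ω]
    (L : IntermediateField K Ω) (𝔭 : Ideal (𝓞 K)) : Prop :=
  ∃ P : Ideal (𝓞 ↥L), P.IsPrime ∧ P ≠ ⊥ ∧
    Ideal.map (RingOfIntegers.mapRingHom (algebraMap K ↥L)) 𝔭 ≤ P ^ 2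

namespace NumberField

open _root_.Ideal

section Inertia

variable {K L F : Type*} [Field K] [Field L] [Field F] [Algebra K L] [Algebra K F] [Algebra F L]
  [IsScalarTower K F L]

/-- Restriction to a normal subextension preserves inertia. -/
theorem restrictNormalHom_mem_inertia [Normal K F] {P : Ideal (𝓞 L)} {σ : Gal(L/K)}
    (hσ : σ ∈ P.inertia Gal(L/K)) :
    AlgEquiv.restrictNormalHom F σ ∈ (P.under (𝓞 F)).inertia Gal(F/K) := by
  intro x
  have hx := hσ (algebraMap (𝓞 F) (𝓞 L) x)
  rw [Submodule.mem_toAddSubgroup] at hx ⊢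
  rw [Ideal.under_def, Ideal.mem_comap, map_sub]
  convert! hx using 2
  apply RingOfIntegers.ext
  exact σ.restrictNormal_commutes F x

variable [NumberField K]

/-- In a Galois extension of number fields, the inertia group of a prime `P` above `𝔭` is trivial
if and only if `P ^ 2` does not divide `𝔭`. -/
theorem inertia_eq_bot_iff_not_map_le_sq [NumberField L] [IsGalois K L]
    {𝔭 : Ideal (𝓞 K)} [𝔭.IsPrime] (h𝔭 : 𝔭 ≠ ⊥) (P : Ideal (𝓞 L)) [P.IsPrime] [P.LiesOver 𝔭] :
    P.inertia Gal(L/K) = ⊥ ↔ ¬ 𝔭.map (algebraMap (𝓞 K) (𝓞 L)) ≤ P ^ 2 := by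
  have : 𝔭.IsMaximal := ‹𝔭.IsPrime›.isMaximal h𝔭
  rw [← ramificationIdx'_ne_one_iff (map_le_iff_le_comap.2 (P.over_def 𝔭).le), not_not,
    Ideal.ramificationIdx'_eq_ramificationIdx 𝔭 P h𝔭,
    ← ramificationIdxIn_eq_ramificationIdx 𝔭 P Gal(L/K),
    ← card_inertia_eq_ramificationIdxIn (G := Gal(L/K)) 𝔭 P, ← Subgroup.card_eq_one]

/-- If `𝔭` ramifies in a subextension, then some prime above `𝔭` has nontrivial inertia. -/
theorem exists_inertia_ne_bot [NumberField F] [NumberField L] [IsGalois K L]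
    {𝔭 : Ideal (𝓞 K)} [𝔭.IsPrime] (h𝔭 : 𝔭 ≠ ⊥) (Q : Ideal (𝓞 F)) [Q.IsPrime]
    (hQ : 𝔭.map (algebraMap (𝓞 K) (𝓞 F)) ≤ Q ^ 2) :
    ∃ P : Ideal (𝓞 L), P.IsPrime ∧ P.LiesOver 𝔭 ∧ P.inertia Gal(L/K) ≠ ⊥ := by
  have h𝔭max : 𝔭.IsMaximal := ‹𝔭.IsPrime›.isMaximal h𝔭
  have hQ𝔭 : Q.LiesOver 𝔭 := ⟨h𝔭max.eq_of_le (comap_ne_top _ IsPrime.ne_top')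
    (map_le_iff_le_comap.1 (hQ.trans (pow_le_self two_ne_zero)))⟩
  obtain ⟨⟨P, hP, hPQ⟩⟩ := (inferInstance : Nonempty (primesOver Q (𝓞 L)))
  have hP𝔭 : P.LiesOver 𝔭 := LiesOver.trans P Q 𝔭
  refine ⟨P, hP, hP𝔭, fun h ↦ (inertia_eq_bot_iff_not_map_le_sq h𝔭 P).1 h ?_⟩
  rw [IsScalarTower.algebraMap_eq (𝓞 K) (𝓞 F) (𝓞 L), ← Ideal.map_map]
  refine (map_mono hQ).trans ?_
  rw [Ideal.map_pow]
  exact pow_right_mono (map_le_iff_le_comap.2 (P.over_def Q).le) 2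

/-- If `𝔭` is unramified in a Galois subextension `F`, then inertia above `𝔭` fixes `F`. -/
theorem restrictNormalHom_eq_one_of_mem_inertia [NumberField F] [IsGalois K F]
    {𝔭 : Ideal (𝓞 K)} [𝔭.IsPrime] (h𝔭 : 𝔭 ≠ ⊥)
    (hF : ∀ Q : Ideal (𝓞 F), Q.IsPrime → Q ≠ ⊥ →
      ¬ 𝔭.map (algebraMap (𝓞 K) (𝓞 F)) ≤ Q ^ 2)
    {P : Ideal (𝓞 L)} [P.IsPrime] [P.LiesOver 𝔭] {σ : Gal(L/K)}
    (hσ : σ ∈ P.inertia Gal(L/K)) :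
    AlgEquiv.restrictNormalHom F σ = 1 := by
  have : (P.under (𝓞 F)).LiesOver 𝔭 := LiesOver.tower_bot P _ 𝔭
  have hbot := (inertia_eq_bot_iff_not_map_le_sq h𝔭 (P.under (𝓞 F))).2
    (hF _ inferInstance (ne_bot_of_liesOver_of_ne_bot h𝔭 _))
  exact (Subgroup.mem_bot (G := Gal(F/K))).1 (hbot ▸ restrictNormalHom_mem_inertia hσ)

end Inertia

end NumberField

namespace IntermediateField

variable {K Ω ι : Type*} [Field K] [Field Ω] [Algebra K Ω] (L : ι → IntermediateField K Ω)

/-- The inclusion of a field in a compositum containing it, as an algebra structure. -/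
abbrev algebraISup (i : ι) : Algebra (L i) ↥(⨆ i, L i) :=
  (inclusion (le_iSup L i)).toAlgebra

attribute [local instance] algebraISup

theorem isScalarTower_iSup (i : ι) : IsScalarTower K (L i) ↥(⨆ i, L i) :=
  .of_algebraMap_eq' (inclusion (le_iSup L i)).comp_algebraMap.symm

attribute [local instance] isScalarTower_iSup

variable [∀ i, Normal K (L i)]

/-- Restriction of automorphisms of a compositum to its constituents. -/
noncomputable def restrictISup : Gal(↥(⨆ i, L i)/K) →* ∀ i, Gal(L i/K) :=
  MonoidHom.pi fun i ↦ AlgEquiv.restrictNormalHom (L i)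

theorem restrictISup_injective : Function.Injective (restrictISup L) := by
  rw [injective_iff_map_eq_one]
  intro σ hσ
  have hle : ⨆ i, L i ≤ (fixedField (Subgroup.zpowers σ)).map (⨆ i, L i).val := by
    refine iSup_le fun i x hx ↦ ⟨inclusion (le_iSup L i) ⟨x, hx⟩, ?_, rfl⟩
    have h := σ.restrictNormal_commutes (L i) ⟨x, hx⟩
    rw [show σ.restrictNormal (L i) = 1 from congrFun hσ i] at h
    refine (mem_fixedField_iff _ _).2 fun g hg ↦ ?_
    have hσx : Subgroup.zpowers σ ≤ MulAction.stabilizer _ (inclusion (le_iSup L i) ⟨x, hx⟩) :=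
      Subgroup.zpowers_le.2 h.symm
    exact hσx hg
  ext ⟨x, hx⟩
  obtain ⟨y, hy, rfl⟩ := hle hx
  exact congrArg Subtype.val ((mem_fixedField_iff _ _).1 hy σ (Subgroup.mem_zpowers σ))

/-- A compositum of quadratic extensions has full degree if each of them is moved by an automorphism
fixing all the others. -/
theorem finrank_iSup_eq_two_pow [Fintype ι] [∀ i, Algebra.IsSeparable K (L i)]
    (hL : ∀ i, Module.finrank K (L i) = 2)
    (h : ∀ i, ∃ σ : Gal(↥(⨆ i, L i)/K), σ ≠ 1 ∧
      ∀ j, j ≠ i → AlgEquiv.restrictNormalHom (L j) σ = 1) :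
    Module.finrank K ↥(⨆ i, L i) = 2 ^ Fintype.card ι := by
  classical
  have (i : ι) : FiniteDimensional K (L i) := .of_finrank_pos (by simp [hL])
  have (i : ι) : IsGalois K (L i) := ⟨⟩
  have hcard (i : ι) : Nat.card Gal(L i/K) = 2 := by rw [IsGalois.card_aut_eq_finrank, hL]
  have hsurj : Function.Surjective (restrictISup L) := by
    rw [← MonoidHom.range_eq_top, eq_top_iff]
    refine fun x _ ↦ Subgroup.pi_mem_of_mulSingle_mem x fun i ↦ ?_
    by_cases hx : x i = 1
    · rw [hx, Pi.mulSingle_one]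
      exact one_mem _
    obtain ⟨σ, hσ, hσj⟩ := h i
    have hσeq : restrictISup L σ = Pi.mulSingle i (restrictISup L σ i) :=
      funext fun j ↦ by
        by_cases hj : j = i
        · subst hj; simp
        · rw [Pi.mulSingle_eq_of_ne hj]
          exact hσj j hj
    have hσi : restrictISup L σ i ≠ 1 := fun h1 ↦ hσ <| restrictISup_injective L <| by
      rw [hσeq, h1, Pi.mulSingle_one, map_one]
    refine ⟨σ, hσeq.trans (congrArg _ ?_)⟩
    obtain ⟨y, -, hy⟩ := (Nat.card_eq_two_iff' (1 : Gal(L i/K))).1 (hcard i)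
    rw [hy _ hσi, hy _ hx]
  have : IsGalois K ↥(⨆ i, L i) := ⟨⟩
  rw [← IsGalois.card_aut_eq_finrank,
    Nat.card_congr (Equiv.ofBijective _ ⟨restrictISup_injective L, hsurj⟩), Nat.card_pi,
    Finset.prod_congr rfl fun i _ ↦ hcard i, Finset.prod_const, Finset.card_univ]

end IntermediateField

/-- Let `K` be a number field and `L₁, …, L_m` quadratic extensions of `K` inside a fixed
algebraic closure of `K`.  If for each `i` there is a nonzero prime of `O_K` ramifying in
`L_i/K` but unramified in `L_j/K` for all `j ≠ i`, then the compositum `L₁⋯L_m` has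
degree `2^m` over `K`. -/
theorem finrank_compositum_of_ramified_primes
    (K : Type*) [Field K] [NumberField K]
    (Ω : Type*) [Field Ω] [Algebra K Ω] [IsAlgClosure K Ω]
    (m : ℕ) (L : Fin m → IntermediateField K Ω)
    (hquad : ∀ i, Module.finrank K ↥(L i) = 2)
    (hram : ∀ i, ∃ 𝔭 : Ideal (𝓞 K), 𝔭.IsPrime ∧ 𝔭 ≠ ⊥ ∧
      RamifiesIn (L i) 𝔭 ∧ ∀ j, j ≠ i → ¬ RamifiesIn (L j) 𝔭) :
    Module.finrank K ↥(⨆ i, L i) = 2 ^ m := by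
  have (i : Fin m) : Algebra.IsQuadraticExtension K (L i) := ⟨hquad i⟩
  have (i : Fin m) : NumberField (L i) := .of_module_finite K (L i)
  have : NumberField ↥(⨆ i, L i) := .of_module_finite K _
  have : IsGalois K ↥(⨆ i, L i) := ⟨⟩
  let (i : Fin m) := IntermediateField.algebraISup L i
  have (i : Fin m) := IntermediateField.isScalarTower_iSup L i
  refine (IntermediateField.finrank_iSup_eq_two_pow L hquad fun i ↦ ?_).trans (by simp)
  obtain ⟨𝔭, _, h𝔭, ⟨Q, _, -, hQ⟩, hunram⟩ := hram i
  obtain ⟨P, _, _, hP⟩ := exists_inertia_ne_bot (L := ↥(⨆ i, L i)) h𝔭 Q hQ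
  obtain ⟨σ, hσ, hσ1⟩ := (P.inertia Gal(↥(⨆ i, L i)/K)).bot_or_exists_ne_one.resolve_left hP
  exact ⟨σ, hσ1, fun j hj ↦ restrictNormalHom_eq_one_of_mem_inertia h𝔭
    (fun Q hQ hQ0 hle ↦ hunram j hj ⟨Q, hQ, hQ0, hle⟩) hσ⟩
end
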